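/- There exists a constant c > 0, depending only on n, D, and L, such that the following holds. Let (M,d) be a closed, connected metric manifold of dimension n ≥ 1 that is D-doubling and L-linearly locally contractible. If S ⊆ M is a closed set and U, V are two distinct connected components of M ∖ S, then H_{n−1}(S) ≥ c · min(inrad(U), inrad(V))^{n−1}. -/

import Mathlib

open Metric MeasureTheory

/-- `M` is a topological `n`-manifold: every point has an open neighborhood
homeomorphic to an open subset of `ℝⁿ`. -/
def IsTopManifold (n : ℕ) (M : Type*) [TopologicalSpace M] : Prop :=
  ∀ x : M, ∃ (U : Set M) (V : Set (EuclideanSpace ℝ (Fin n))),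
    IsOpen U ∧ x ∈ U ∧ IsOpen V ∧ Nonempty (U ≃ₜ V)

/-- `M` is `D`-doubling: every open ball `B(z,r)` contains at most `D` points that are
pairwise at distance `≥ r/2` from each other. -/
def IsDoubling (D : ℕ) (M : Type*) [MetricSpace M] : Prop :=
  ∀ (z : M) (r : ℝ) (s : Finset M), (↑s ⊆ ball z r) →
    (∀ a ∈ s, ∀ b ∈ s, a ≠ b → r / 2 ≤ dist a b) → s.card ≤ D

/-- `M` is `L`-linearly locally contractible: every ball `B(z,r)` with
`0 < r ≤ diam M / L` can be contracted to a point inside `B(z,Lr)`. -/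
def IsLLC (L : ℝ) (M : Type*) [MetricSpace M] : Prop :=
  ∀ (z : M) (r : ℝ), 0 < r → r ≤ diam (Set.univ : Set M) / L →
    ∃ h : ℝ → M → M,
      ContinuousOn (fun p : ℝ × M => h p.1 p.2) (Set.Icc 0 1 ×ˢ ball z r) ∧
      (∀ x ∈ ball z r, h 0 x = x) ∧
      (∃ c : M, ∀ x ∈ ball z r, h 1 x = c) ∧
      (∀ t ∈ Set.Icc (0:ℝ) 1, ∀ x ∈ ball z r, h t x ∈ ball z (L * r))

/-- The in-radius of a subset `E` of a metric space:
`inrad E = sup {r ≥ 0 : B(x,r) ⊆ E for some x}`. -/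
noncomputable def inrad {M : Type*} [MetricSpace M] (E : Set M) : ℝ :=
  sSup {r : ℝ | 0 ≤ r ∧ ∃ x : M, ball x r ⊆ E}

namespace AlexanderSpanier

set_option linter.unusedSectionVars false

open Filter Topology

section Chains

variable {X Y : Type*} [DecidableEq X] [DecidableEq Y]

/-- Augmented unordered simplicial chains modulo two on the full simplex with vertex set `X`. -/
abbrev Chain (X : Type*) := Finset X →₀ ZMod 2

/-- The chain consisting of a single simplex. -/
noncomputable abbrev simplex (s : Finset X) : Chain X := Finsupp.single s 1

/-- The chains all of whose simplices belong to `A`. -/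
abbrev chainsIn (A : Set (Finset X)) : Submodule (ZMod 2) (Chain X) :=
  Finsupp.supported (ZMod 2) (ZMod 2) A

lemma simplex_mem {A : Set (Finset X)} {s : Finset X} (h : s ∈ A) : simplex s ∈ chainsIn A :=
  Finsupp.single_mem_supported _ _ h

lemma map_mem_of_simplex {V : Type*} [AddCommGroup V] [Module (ZMod 2) V]
    {A : Set (Finset X)} (F : Chain X →ₗ[ZMod 2] V) (B : Submodule (ZMod 2) V)
    (h : ∀ s ∈ A, F (simplex s) ∈ B) {c : Chain X} (hc : c ∈ chainsIn A) : F c ∈ B := by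
  have h1 : chainsIn A ≤ B.comap F := by
    rw [chainsIn, Finsupp.supported_eq_span_single, Submodule.span_le]
    rintro _ ⟨s, hs, rfl⟩
    exact h s hs
  exact h1 hc

lemma map_eq_of_simplex {V : Type*} [AddCommGroup V] [Module (ZMod 2) V]
    {A : Set (Finset X)} (F G : Chain X →ₗ[ZMod 2] V)
    (h : ∀ s ∈ A, F (simplex s) = G (simplex s)) {c : Chain X} (hc : c ∈ chainsIn A) :
    F c = G c := by
  have := map_mem_of_simplex (F - G) ⊥ (fun s hs => by simp [h s hs]) hc
  simpa [sub_eq_zero] using this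

lemma linearMap_ext {V : Type*} [AddCommGroup V] [Module (ZMod 2) V]
    (F G : Chain X →ₗ[ZMod 2] V)
    (h : ∀ s, F (simplex s) = G (simplex s)) (c : Chain X) : F c = G c :=
  map_eq_of_simplex (A := Set.univ) F G (fun s _ => h s) (by simp)

/-- The augmented boundary operator. -/
noncomputable def bd : Chain X →ₗ[ZMod 2] Chain X :=
  Finsupp.linearCombination (ZMod 2) (fun s => ∑ p ∈ s, simplex (s.erase p))

@[simp] lemma bd_simplex (s : Finset X) : bd (simplex s) = ∑ p ∈ s, simplex (s.erase p) := by
  simp [bd]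

lemma sum_sum_erase_eq_zero {G : Type*} [AddCommGroup G] [Module (ZMod 2) G] (s : Finset X)
    (a : X → X → G) (ha : ∀ p q, a p q = a q p) : ∑ p ∈ s, ∑ q ∈ s.erase p, a p q = 0 := by
  rw [Finset.sum_sigma']
  refine Finset.sum_involution (f := fun b : (_ : X) × X => a b.1 b.2)
    (fun b _ => (⟨b.2, b.1⟩ : (_ : X) × X)) ?_ ?_ ?_ ?_
  · rintro ⟨p, q⟩ -
    change a p q + a q p = 0
    rw [ha p q]
    exact ZModModule.add_self _
  · rintro ⟨p, q⟩ h _ h'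
    simp only [Finset.mem_sigma, Finset.mem_erase] at h
    exact h.2.1 (congrArg Sigma.fst h')
  · rintro ⟨p, q⟩ h
    simp only [Finset.mem_sigma, Finset.mem_erase] at h ⊢
    exact ⟨h.2.2, fun e => h.2.1 e.symm, h.1⟩
  · rintro ⟨p, q⟩ _
    rfl

lemma bd_bd (c : Chain X) : bd (bd c) = 0 := by
  suffices h : bd ∘ₗ bd = (0 : Chain X →ₗ[ZMod 2] Chain X) from
    LinearMap.congr_fun h c
  refine LinearMap.ext fun c => linearMap_ext (bd ∘ₗ bd) 0 (fun s => ?_) c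
  simp only [LinearMap.comp_apply, bd_simplex, map_sum, LinearMap.zero_apply]
  exact sum_sum_erase_eq_zero s (fun p q => simplex ((s.erase p).erase q))
    fun p q => congrArg _ Finset.erase_right_comm

open scoped Classical in
/-- The chain map induced by a map of vertices; degenerate simplices are sent to zero. -/
noncomputable def push (f : X → Y) : Chain X →ₗ[ZMod 2] Chain Y :=
  Finsupp.linearCombination (ZMod 2)
    (fun s => if Set.InjOn f s then simplex (s.image f) else 0)

lemma push_simplex_of_injOn {f : X → Y} {s : Finset X} (h : Set.InjOn f s) :
    push f (simplex s) = simplex (s.image f) := by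
  simp [push, h]

lemma push_simplex_of_not_injOn {f : X → Y} {s : Finset X} (h : ¬ Set.InjOn f s) :
    push f (simplex s) = 0 := by
  simp [push, h]

lemma push_simplex_mem (f : X → Y) (s : Finset X) :
    push f (simplex s) ∈ chainsIn {t | t = s.image f ∧ t.card = s.card} := by
  by_cases h : Set.InjOn f s
  · rw [push_simplex_of_injOn h]
    exact simplex_mem ⟨rfl, Finset.card_image_of_injOn h⟩
  · rw [push_simplex_of_not_injOn h]
    exact Submodule.zero_mem _

lemma push_simplex_of_eqOn_id {f : X → X} {s : Finset X} (h : ∀ p ∈ s, f p = p) :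
    push f (simplex s) = simplex s := by
  have h1 : Set.InjOn f s := fun a ha b hb e => by rwa [h a ha, h b hb] at e
  rw [push_simplex_of_injOn h1]
  congr 1
  ext x
  simp only [Finset.mem_image]
  exact ⟨fun ⟨a, ha, e⟩ => by rw [← e, h a ha]; exact ha, fun hx => ⟨x, hx, h x hx⟩⟩

lemma bd_push (f : X → Y) (c : Chain X) : bd (push f c) = push f (bd c) := by
  refine linearMap_ext (bd ∘ₗ push f) (push f ∘ₗ bd) (fun s => ?_) c
  simp only [LinearMap.comp_apply, bd_simplex, map_sum]
  by_cases h : Set.InjOn f s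
  · rw [push_simplex_of_injOn h, bd_simplex, Finset.sum_image h]
    refine Finset.sum_congr rfl fun p hp => ?_
    rw [push_simplex_of_injOn (h.mono (by simp))]
    congr 1
    ext y
    simp only [Finset.mem_erase, Finset.mem_image]
    constructor
    · rintro ⟨h1, a, ha, rfl⟩
      exact ⟨a, ⟨fun e => h1 (by rw [e]), ha⟩, rfl⟩
    · rintro ⟨a, ⟨h1, ha⟩, rfl⟩
      exact ⟨fun e => h1 (h ha hp e), a, ha, rfl⟩
  · rw [push_simplex_of_not_injOn h, map_zero]
    rw [Set.InjOn] at h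
    push Not at h
    obtain ⟨p, hp, q, hq, e, hne⟩ := h
    simp only [Finset.mem_coe] at hp hq
    rw [← Finset.add_sum_erase s _ hp,
      ← Finset.add_sum_erase (s.erase p) _ (Finset.mem_erase.2 ⟨fun h => hne h.symm, hq⟩)]
    rw [Finset.sum_eq_zero, add_zero]
    · have himg : (s.erase p).image f = (s.erase q).image f := by
        ext y
        simp only [Finset.mem_erase, Finset.mem_image]
        constructor
        · rintro ⟨a, ⟨h1, ha⟩, rfl⟩
          by_cases haq : a = q
          · exact ⟨p, ⟨hne, hp⟩, by rw [e, haq]⟩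
          · exact ⟨a, ⟨haq, ha⟩, rfl⟩
        · rintro ⟨a, ⟨h1, ha⟩, rfl⟩
          by_cases haq : a = p
          · exact ⟨q, ⟨fun h => hne h.symm, hq⟩, by rw [← e, haq]⟩
          · exact ⟨a, ⟨haq, ha⟩, rfl⟩
      have hiff : Set.InjOn f (s.erase p) ↔ Set.InjOn f (s.erase q) := by
        rw [← Finset.card_image_iff, ← Finset.card_image_iff, himg,
          Finset.card_erase_of_mem hp, Finset.card_erase_of_mem hq]
      by_cases h1 : Set.InjOn f (s.erase p)
      · rw [push_simplex_of_injOn h1, push_simplex_of_injOn (hiff.1 h1), himg]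
        exact (ZModModule.add_self _).symm
      · rw [push_simplex_of_not_injOn h1, push_simplex_of_not_injOn (fun h => h1 (hiff.2 h)),
          add_zero]
    · intro x hx
      simp only [Finset.mem_erase] at hx
      refine push_simplex_of_not_injOn fun h => hne (h ?_ ?_ e)
      · exact Finset.mem_coe.2 (Finset.mem_erase.2 ⟨fun h => hx.2.1 h.symm, hp⟩)
      · exact Finset.mem_coe.2 (Finset.mem_erase.2 ⟨fun h => hx.1 h.symm, hq⟩)

/-- The cone operator with apex `w`. -/
noncomputable def cone (w : X) : Chain X →ₗ[ZMod 2] Chain X :=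
  Finsupp.linearCombination (ZMod 2) (fun s => if w ∈ s then 0 else simplex (insert w s))

lemma cone_simplex (w : X) (s : Finset X) :
    cone w (simplex s) = if w ∈ s then 0 else simplex (insert w s) := by
  simp [cone]

lemma bd_cone (w : X) (c : Chain X) : bd (cone w c) = c + cone w (bd c) := by
  refine linearMap_ext (bd ∘ₗ cone w) (LinearMap.id + cone w ∘ₗ bd) (fun s => ?_) c
  simp only [LinearMap.comp_apply, bd_simplex, map_sum, cone_simplex, LinearMap.add_apply,
    LinearMap.id_apply]
  by_cases h : w ∈ s
  · rw [if_pos h, map_zero, ← Finset.add_sum_erase s _ h, Finset.sum_eq_zero, add_zero,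
      if_neg (by simp), Finset.insert_erase h]
    · exact (ZModModule.add_self _).symm
    · intro x hx
      simp only [Finset.mem_erase] at hx
      exact if_pos (Finset.mem_erase.2 ⟨fun e => hx.1 e.symm, h⟩)
  · rw [if_neg h, bd_simplex, Finset.sum_insert h, Finset.erase_insert h]
    congr 1
    refine Finset.sum_congr rfl fun p hp => ?_
    rw [if_neg (fun h' => h (Finset.mem_of_mem_erase h')), Finset.erase_insert_of_ne]
    rintro rfl
    exact h hp

/-- A chain homotopy between the chain maps of two vertex maps, built from cones. -/
noncomputable def homotopySimplex (f g : X → Y) (s : Finset X) : Chain Y :=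
  if h : s.Nonempty then
    cone (f h.choose) (push f (simplex s) + push g (simplex s) +
      ∑ p : s, homotopySimplex f g (s.erase p))
  else 0
termination_by s.card
decreasing_by exact Finset.card_erase_lt_of_mem p.2

/-- The linear extension of `homotopySimplex`. -/
noncomputable def homotopy (f g : X → Y) : Chain X →ₗ[ZMod 2] Chain Y :=
  Finsupp.linearCombination (ZMod 2) (homotopySimplex f g)

lemma homotopy_simplex (f g : X → Y) (s : Finset X) (h : s.Nonempty) :
    homotopy f g (simplex s) = cone (f h.choose) (push f (simplex s) + push g (simplex s) +
      homotopy f g (bd (simplex s))) := by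
  rw [bd_simplex, map_sum]
  simp only [homotopy, Finsupp.linearCombination_single, one_smul]
  rw [homotopySimplex, dif_pos h, Finset.sum_coe_sort s (fun p => homotopySimplex f g (s.erase p))]

lemma homotopy_empty (f g : X → Y) : homotopy f g (simplex ∅) = 0 := by
  simp only [homotopy, Finsupp.linearCombination_single, one_smul]
  rw [homotopySimplex, dif_neg (by simp)]

lemma bd_homotopy (f g : X → Y) (c : Chain X) :
    bd (homotopy f g c) = push f c + push g c + homotopy f g (bd c) := by
  refine linearMap_ext (bd ∘ₗ homotopy f g) (push f + push g + homotopy f g ∘ₗ bd)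
    (fun s => ?_) c
  simp only [LinearMap.comp_apply, LinearMap.add_apply]
  induction hk : s.card using Nat.strong_induction_on generalizing s with
  | _ k ih =>
    rcases s.eq_empty_or_nonempty with rfl | h
    · rw [homotopy_empty, map_zero, bd_simplex, Finset.sum_empty, map_zero, add_zero,
        push_simplex_of_injOn (by simp), push_simplex_of_injOn (by simp)]
      simp only [Finset.image_empty]
      exact (ZModModule.add_self _).symm
    · rw [homotopy_simplex f g s h, bd_cone]
      have hb : bd (homotopy f g (bd (simplex s))) =
          push f (bd (simplex s)) + push g (bd (simplex s)) +
            homotopy f g (bd (bd (simplex s))) := by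
        refine map_eq_of_simplex (A := {t | t.card < k}) (bd ∘ₗ homotopy f g)
          (push f + push g + homotopy f g ∘ₗ bd) (fun t ht => ?_) ?_
        · simpa using ih t.card ht t rfl
        · rw [bd_simplex]
          refine Submodule.sum_mem _ fun p hp => simplex_mem ?_
          rw [← hk]
          exact Finset.card_erase_lt_of_mem hp
      rw [bd_bd, map_zero, add_zero] at hb
      have hz : bd (push f (simplex s) + push g (simplex s) + homotopy f g (bd (simplex s))) = 0 := by
        rw [map_add, map_add, hb, bd_push, bd_push]
        exact ZModModule.add_self _
      rw [hz, map_zero, add_zero]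

lemma cone_mem {w : X} {A B : Set (Finset X)} (h : ∀ s ∈ A, w ∉ s → insert w s ∈ B)
    {c : Chain X} (hc : c ∈ chainsIn A) : cone w c ∈ chainsIn B := by
  refine map_mem_of_simplex _ _ (fun s hs => ?_) hc
  rw [cone_simplex]
  split_ifs with h1
  · exact Submodule.zero_mem _
  · exact simplex_mem (h s hs h1)

lemma homotopy_simplex_mem (f g : X → Y) (s : Finset X) :
    homotopy f g (simplex s) ∈
      chainsIn {t | t ⊆ s.image f ∪ s.image g ∧ t.card = s.card + 1} := by
  induction hk : s.card using Nat.strong_induction_on generalizing s with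
  | _ k ih =>
    rcases s.eq_empty_or_nonempty with rfl | h
    · rw [homotopy_empty]
      exact Submodule.zero_mem _
    · rw [homotopy_simplex f g s h]
      refine cone_mem (A := {t | t ⊆ s.image f ∪ s.image g ∧ t.card = s.card}) ?_ ?_
      · rintro t ⟨h1, h2⟩ h3
        refine ⟨Finset.insert_subset ?_ h1, by rw [Finset.card_insert_of_notMem h3, h2, hk]⟩
        exact Finset.mem_union_left _ (Finset.mem_image_of_mem _ h.choose_spec)
      · refine Submodule.add_mem _ (Submodule.add_mem _ ?_ ?_) ?_
        · refine Finsupp.supported_mono ?_ (push_simplex_mem f s)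
          rintro t ⟨rfl, h2⟩
          exact ⟨Finset.subset_union_left, h2⟩
        · refine Finsupp.supported_mono ?_ (push_simplex_mem g s)
          rintro t ⟨rfl, h2⟩
          exact ⟨Finset.subset_union_right, h2⟩
        · rw [bd_simplex, map_sum]
          refine Submodule.sum_mem _ fun p hp => ?_
          have hlt := Finset.card_erase_lt_of_mem hp
          refine Finsupp.supported_mono ?_ (ih _ (hk ▸ hlt) (s.erase p) rfl)
          rintro t ⟨h1, h2⟩
          refine ⟨h1.trans (Finset.union_subset_union (Finset.image_subset_image ?_)
            (Finset.image_subset_image ?_)), ?_⟩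
          · exact Finset.erase_subset _ _
          · exact Finset.erase_subset _ _
          · rw [h2, Finset.card_erase_add_one hp]

/-- The evaluation of a cochain on chains. -/
noncomputable def ev (u : Finset X → ZMod 2) : Chain X →ₗ[ZMod 2] ZMod 2 :=
  Finsupp.linearCombination (ZMod 2) u

@[simp] lemma ev_simplex (u : Finset X → ZMod 2) (s : Finset X) : ev u (simplex s) = u s := by
  simp [ev]

lemma ev_eq_of_mem {u v : Finset X → ZMod 2} {A : Set (Finset X)} (h : ∀ s ∈ A, u s = v s)
    {c : Chain X} (hc : c ∈ chainsIn A) : ev u c = ev v c :=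
  map_eq_of_simplex _ _ (by simpa using h) hc

lemma ev_eq_zero {u : Finset X → ZMod 2} {A : Set (Finset X)} (h : ∀ s ∈ A, u s = 0)
    {c : Chain X} (hc : c ∈ chainsIn A) : ev u c = 0 :=
  map_eq_of_simplex (ev u) 0 (by simpa using h) hc

lemma ev_add (u v : Finset X → ZMod 2) (c : Chain X) : ev (u + v) c = ev u c + ev v c :=
  linearMap_ext (ev (u + v)) (ev u + ev v) (by simp) c

/-- The coboundary of a cochain. -/
def cobd (u : Finset X → ZMod 2) (s : Finset X) : ZMod 2 := ∑ p ∈ s, u (s.erase p)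

lemma ev_cobd (u : Finset X → ZMod 2) (c : Chain X) : ev (cobd u) c = ev u (bd c) :=
  linearMap_ext (ev (cobd u)) (ev u ∘ₗ bd) (by simp [cobd]) c

lemma cobd_eq_ev (u : Finset X → ZMod 2) (s : Finset X) : cobd u s = ev u (bd (simplex s)) := by
  rw [← ev_cobd, ev_simplex]

lemma cobd_add (u v : Finset X → ZMod 2) : cobd (u + v) = cobd u + cobd v := by
  ext s
  simp [cobd, Finset.sum_add_distrib]

lemma cobd_sum {ι : Type*} (I : Finset ι) (u : ι → Finset X → ZMod 2) :
    cobd (∑ i ∈ I, u i) = ∑ i ∈ I, cobd (u i) := by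
  ext s
  simp only [cobd, Finset.sum_apply]
  exact Finset.sum_comm

lemma cobd_cobd (u : Finset X → ZMod 2) : cobd (cobd u) = 0 := by
  ext s
  rw [cobd_eq_ev, ev_cobd, bd_bd, map_zero, Pi.zero_apply]

/-- The pullback of a cochain along a map of vertices. -/
noncomputable def pull (f : X → Y) (u : Finset Y → ZMod 2) (s : Finset X) : ZMod 2 :=
  ev u (push f (simplex s))

lemma pull_of_injOn {f : X → Y} (u : Finset Y → ZMod 2) {s : Finset X} (h : Set.InjOn f s) :
    pull f u s = u (s.image f) := by
  rw [pull, push_simplex_of_injOn h, ev_simplex]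

lemma pull_of_not_injOn {f : X → Y} (u : Finset Y → ZMod 2) {s : Finset X}
    (h : ¬ Set.InjOn f s) : pull f u s = 0 := by
  rw [pull, push_simplex_of_not_injOn h, map_zero]

lemma ev_pull (f : X → Y) (u : Finset Y → ZMod 2) (c : Chain X) :
    ev (pull f u) c = ev u (push f c) :=
  linearMap_ext (ev (pull f u)) (ev u ∘ₗ push f) (by simp [pull]) c

lemma cobd_pull (f : X → Y) (u : Finset Y → ZMod 2) : cobd (pull f u) = pull f (cobd u) := by
  ext s
  rw [cobd_eq_ev, ev_pull, ← bd_push, ← ev_cobd, pull]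

lemma pull_add (f : X → Y) (u v : Finset Y → ZMod 2) : pull f (u + v) = pull f u + pull f v := by
  ext s
  simp [pull, ev_add]

lemma push_comp {Z : Type*} [DecidableEq Z] (f : X → Y) (g : Y → Z) (s : Finset X) :
    push g (push f (simplex s)) = push (g ∘ f) (simplex s) := by
  by_cases h : Set.InjOn f s
  · rw [push_simplex_of_injOn h]
    by_cases h' : Set.InjOn g (s.image f)
    · rw [push_simplex_of_injOn h', push_simplex_of_injOn, Finset.image_image]
      rw [Finset.coe_image] at h'
      exact h'.comp h (Set.mapsTo_image f s)
    · rw [push_simplex_of_not_injOn h', push_simplex_of_not_injOn]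
      rw [Finset.coe_image] at h'
      exact fun h'' => h' h''.image_of_comp
  · rw [push_simplex_of_not_injOn h, map_zero, push_simplex_of_not_injOn]
    exact fun h' => h h'.of_comp

lemma pull_pull {Z : Type*} [DecidableEq Z] (f : X → Y) (g : Y → Z) (u : Finset Z → ZMod 2) :
    pull f (pull g u) = pull (g ∘ f) u := by
  ext s
  rw [pull, ev_pull, push_comp, pull]

lemma pull_of_eqOn_id {f : X → X} {u : Finset X → ZMod 2} {s : Finset X}
    (h : ∀ p ∈ s, f p = p) : pull f u s = u s := by
  rw [pull, push_simplex_of_eqOn_id h, ev_simplex]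

lemma pull_id (u : Finset X → ZMod 2) : pull id u = u :=
  funext fun _ => pull_of_eqOn_id fun _ _ => rfl

lemma pull_empty (f : X → Y) (u : Finset Y → ZMod 2) : pull f u ∅ = u ∅ := by
  rw [pull_of_injOn _ (by simp), Finset.image_empty]

lemma cobd_empty (u : Finset X → ZMod 2) : cobd u ∅ = 0 := Finset.sum_empty

lemma cobd_ev_homotopy (f g : X → Y) (u : Finset Y → ZMod 2) (s : Finset X) :
    cobd (fun t => ev u (homotopy f g (simplex t))) s =
      pull f u s + pull g u s + ev (cobd u) (homotopy f g (simplex s)) := by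
  have h1 : cobd (fun t => ev u (homotopy f g (simplex t))) s =
      ev u (homotopy f g (bd (simplex s))) := by
    simp [cobd]
  rw [h1, ev_cobd, bd_homotopy, map_add, map_add, pull, pull]
  rw [← add_assoc, ZModModule.add_self, zero_add]

end Chains

section Local

variable {X Y : Type*} [DecidableEq X] [DecidableEq Y] [TopologicalSpace X] [TopologicalSpace Y]

/-- The filter of finite sets contained in small neighborhoods of `p`. -/
def sm (p : X) : Filter (Finset X) := (𝓝 p).smallSets.comap (fun s => (s : Set X))

lemma eventually_sm {p : X} {P : Finset X → Prop} :
    (∀ᶠ s in sm p, P s) ↔ ∃ N ∈ 𝓝 p, ∀ s : Finset X, (s : Set X) ⊆ N → P s := by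
  rw [sm, eventually_comap, eventually_smallSets]
  constructor
  · rintro ⟨N, hN, h⟩
    exact ⟨N, hN, fun s hs => h _ hs s rfl⟩
  · rintro ⟨N, hN, h⟩
    exact ⟨N, hN, fun t ht s hs => h s (hs ▸ ht)⟩

lemma eventually_sm_subset_of_mem {p : X} {N : Set X} (hN : N ∈ 𝓝 p) :
    ∀ᶠ s : Finset X in sm p, (s : Set X) ⊆ N :=
  eventually_sm.2 ⟨N, hN, fun _ h => h⟩

lemma eventually_sm_forall_subset {p : X} {P : Finset X → Prop} (h : ∀ᶠ s in sm p, P s) :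
    ∀ᶠ s in sm p, ∀ t ⊆ s, P t := by
  rw [eventually_sm] at h ⊢
  obtain ⟨N, hN, h⟩ := h
  exact ⟨N, hN, fun s hs t ht => h t ((Finset.coe_subset.2 ht).trans hs)⟩

lemma tendsto_image_sm {f : X → Y} {p : X} (hf : ContinuousAt f p) :
    Tendsto (fun s : Finset X => s.image f) (sm p) (sm (f p)) := by
  intro P hP
  obtain ⟨N, hN, h⟩ := eventually_sm.1 hP
  refine eventually_sm.2 ⟨f ⁻¹' N, hf hN, fun s hs => h _ ?_⟩
  rw [Finset.coe_image]
  exact Set.image_subset_iff.2 hs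

/-- Cochains which vanish on the simplices with `k` vertices that are close to `p`. -/
def van (k : ℕ) (p : X) : AddSubgroup (Finset X → ZMod 2) where
  carrier := {u | ∀ᶠ s in sm p, s.card = k → u s = 0}
  zero_mem' := by simp
  add_mem' := by
    intro u v hu hv
    change ∀ᶠ s in sm p, _
    filter_upwards [hu, hv] with s h1 h2 h
    simp [h1 h, h2 h]
  neg_mem' := by
    intro u hu
    change ∀ᶠ s in sm p, _
    filter_upwards [hu] with s h1 h
    simp [h1 h]

lemma mem_van {k : ℕ} {p : X} {u : Finset X → ZMod 2} :
    u ∈ van k p ↔ ∀ᶠ s in sm p, s.card = k → u s = 0 := Iff.rfl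

lemma cobd_mem_van {k : ℕ} {p : X} {u : Finset X → ZMod 2} (h : u ∈ van k p) :
    cobd u ∈ van (k + 1) p := by
  filter_upwards [eventually_sm_forall_subset h] with s hs hk
  refine Finset.sum_eq_zero fun q hq => hs _ (Finset.erase_subset _ _) ?_
  rw [Finset.card_erase_of_mem hq, hk, Nat.add_sub_cancel]

lemma pull_mem_van {k : ℕ} {f : X → Y} {p : X} (hf : ContinuousAt f p)
    {u : Finset Y → ZMod 2} (hu : u ∈ van k (f p)) : pull f u ∈ van k p := by
  filter_upwards [(tendsto_image_sm hf).eventually hu] with s hs hk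
  by_cases h : Set.InjOn f s
  · rw [pull_of_injOn _ h]
    exact hs (by rw [Finset.card_image_of_injOn h, hk])
  · exact pull_of_not_injOn _ h

/-- Cochains which vanish on all sufficiently small simplices with `k` vertices. -/
def zer (X : Type*) [TopologicalSpace X] (k : ℕ) : AddSubgroup (Finset X → ZMod 2) :=
  ⨅ p, van k p

lemma mem_zer {k : ℕ} {u : Finset X → ZMod 2} : u ∈ zer X k ↔ ∀ p, u ∈ van k p :=
  AddSubgroup.mem_iInf

lemma pull_mem_zer {k : ℕ} {f : X → Y} (hf : Continuous f)
    {u : Finset Y → ZMod 2} (hu : u ∈ zer Y k) : pull f u ∈ zer X k :=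
  mem_zer.2 fun p => pull_mem_van hf.continuousAt (mem_zer.1 hu (f p))

/-- Cochains whose support (on simplices with `k` vertices) is a compact subset of `O`. -/
def csupp (k : ℕ) (O : Set X) : AddSubgroup (Finset X → ZMod 2) where
  carrier := {u | ∃ K ⊆ O, IsCompact K ∧ ∀ p ∉ K, u ∈ van k p}
  zero_mem' := ⟨∅, by simp, isCompact_empty, fun p _ => zero_mem _⟩
  add_mem' := by
    rintro u v ⟨K, h1, h2, h3⟩ ⟨K', h1', h2', h3'⟩
    exact ⟨K ∪ K', Set.union_subset h1 h1', h2.union h2', fun p hp =>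
      add_mem (h3 p fun h => hp (Or.inl h)) (h3' p fun h => hp (Or.inr h))⟩
  neg_mem' := by
    rintro u ⟨K, h1, h2, h3⟩
    exact ⟨K, h1, h2, fun p hp => neg_mem (h3 p hp)⟩

lemma csupp_mono {k : ℕ} {O O' : Set X} (h : O ⊆ O') : csupp k O ≤ csupp k O' :=
  fun _ ⟨K, h1, h2, h3⟩ => ⟨K, h1.trans h, h2, h3⟩

lemma cobd_mem_csupp {k : ℕ} {O : Set X} {u : Finset X → ZMod 2} (h : u ∈ csupp k O) :
    cobd u ∈ csupp (k + 1) O := by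
  obtain ⟨K, h1, h2, h3⟩ := h
  exact ⟨K, h1, h2, fun p hp => cobd_mem_van (h3 p hp)⟩

lemma zer_le_csupp {k : ℕ} {O : Set X} : zer X k ≤ csupp k O :=
  fun _ hu => ⟨∅, by simp, isCompact_empty, fun p _ => mem_zer.1 hu p⟩

lemma cobd_mem_zer {k : ℕ} {u : Finset X → ZMod 2} (h : u ∈ zer X k) :
    cobd u ∈ zer X (k + 1) :=
  mem_zer.2 fun p => cobd_mem_van (mem_zer.1 h p)

lemma cobd_zero : cobd (0 : Finset X → ZMod 2) = 0 := by
  ext s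
  simp [cobd]

/-- The compactly supported `n`-cocycles with support in `O`. -/
def cocyc (n : ℕ) (O : Set X) : AddSubgroup (Finset X → ZMod 2) where
  carrier := {u | u ∈ csupp (n + 1) O ∧ cobd u ∈ zer X (n + 2)}
  zero_mem' := ⟨zero_mem _, by rw [cobd_zero]; exact zero_mem _⟩
  add_mem' := by
    rintro u v ⟨h1, h2⟩ ⟨h3, h4⟩
    exact ⟨add_mem h1 h3, by rw [cobd_add]; exact add_mem h2 h4⟩
  neg_mem' := by
    rintro u h
    rwa [show -u = u from funext fun s => ZModModule.neg_eq_self _]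

lemma cocyc_mono {n : ℕ} {O O' : Set X} (h : O ⊆ O') : cocyc n O ≤ cocyc n O' :=
  fun _ ⟨h1, h2⟩ => ⟨csupp_mono h h1, h2⟩

lemma cobd_mem_cocyc {n : ℕ} {O : Set X} {e : Finset X → ZMod 2} (h : e ∈ csupp n O) :
    cobd e ∈ cocyc n O :=
  ⟨cobd_mem_csupp h, by rw [cobd_cobd]; exact zero_mem _⟩

/-- The cochains which are coboundaries of cochains compactly supported in `O`. -/
def null (n : ℕ) (O : Set X) : AddSubgroup (Finset X → ZMod 2) where
  carrier := {u | ∃ e ∈ csupp n O, e ∅ = 0 ∧ u + cobd e ∈ zer X (n + 1)}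
  zero_mem' := ⟨0, zero_mem _, rfl, by rw [cobd_zero, add_zero]; exact zero_mem _⟩
  add_mem' := by
    rintro u v ⟨e, h1, h0, h2⟩ ⟨e', h3, h0', h4⟩
    exact ⟨e + e', add_mem h1 h3, by simp [h0, h0'], by rw [cobd_add, add_add_add_comm]; exact add_mem h2 h4⟩
  neg_mem' := by
    rintro u h
    rwa [show -u = u from funext fun s => ZModModule.neg_eq_self _]

lemma mem_null {n : ℕ} {O : Set X} {u : Finset X → ZMod 2} :
    u ∈ null n O ↔ ∃ e ∈ csupp n O, e ∅ = 0 ∧ u + cobd e ∈ zer X (n + 1) := Iff.rfl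

lemma null_mono {n : ℕ} {O O' : Set X} (h : O ⊆ O') : null n O ≤ null n O' :=
  fun _ ⟨e, h1, h2⟩ => ⟨e, csupp_mono h h1, h2⟩

lemma zer_le_null {n : ℕ} {O : Set X} : zer X (n + 1) ≤ null n O :=
  fun _ h => ⟨0, zero_mem _, rfl, by rwa [cobd_zero, add_zero]⟩

lemma cochain_add_self (u : Finset X → ZMod 2) : u + u = 0 :=
  funext fun _ => ZModModule.add_self _

lemma cobd_mem_null {n : ℕ} {O : Set X} {e : Finset X → ZMod 2} (h : e ∈ csupp n O)
    (h0 : e ∅ = 0) : cobd e ∈ null n O :=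
  ⟨e, h, h0, by rw [cochain_add_self]; exact zero_mem _⟩

open scoped Classical in
/-- The restriction of a cochain to the simplices contained in `A`. -/
noncomputable def restr (A : Set X) (u : Finset X → ZMod 2) (s : Finset X) : ZMod 2 :=
  if (s : Set X) ⊆ A then u s else 0

lemma restr_of_subset {A : Set X} {u : Finset X → ZMod 2} {s : Finset X}
    (h : (s : Set X) ⊆ A) : restr A u s = u s := if_pos h

lemma restr_of_not_subset {A : Set X} {u : Finset X → ZMod 2} {s : Finset X}
    (h : ¬ (s : Set X) ⊆ A) : restr A u s = 0 := if_neg h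

lemma add_restr_mem_zer {k : ℕ} {A K : Set X} {u : Finset X → ZMod 2} (hK : K ⊆ interior A)
    (hu : ∀ p ∉ K, u ∈ van k p) : u + restr A u ∈ zer X k := by
  refine mem_zer.2 fun p => ?_
  by_cases hp : p ∈ K
  · have hA : A ∈ 𝓝 p := mem_interior_iff_mem_nhds.1 (hK hp)
    rw [mem_van]
    filter_upwards [eventually_sm_subset_of_mem hA] with s hs _
    rw [Pi.add_apply, restr_of_subset hs]
    exact ZModModule.add_self _
  · rw [mem_van]
    filter_upwards [hu p hp] with s hs hk
    rw [Pi.add_apply, hs hk, zero_add]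
    by_cases h : (s : Set X) ⊆ A
    · rw [restr_of_subset h, hs hk]
    · exact restr_of_not_subset h

/-- Partition of a compactly supported cochain subordinate to a finite open cover. -/
lemma exists_partition {ι : Type*} [T2Space X] [LocallyCompactSpace X] {k : ℕ} (hk : 0 < k)
    (I : Finset ι) (O : ι → Set X) (hO : ∀ i ∈ I, IsOpen (O i)) {e : Finset X → ZMod 2}
    (he : e ∈ csupp k (⋃ i ∈ I, O i)) :
    ∃ f : ι → Finset X → ZMod 2, (∀ i ∈ I, f i ∈ csupp k (O i)) ∧ (∀ i, f i ∅ = 0) ∧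
      e + ∑ i ∈ I, f i ∈ zer X k := by
  classical
  obtain ⟨K, hKO, hK, hKe⟩ := he
  obtain ⟨K', hK', h1, h2⟩ := exists_compact_between hK (isOpen_biUnion hO) hKO
  obtain ⟨C, hC, hCO, hKC⟩ := hK'.finite_compact_cover I O hO h2
  have hidx : ∀ q ∈ K', ∃ i ∈ I, q ∈ C i := fun q hq => by
    rw [hKC] at hq
    simpa using hq
  let f : ι → Finset X → ZMod 2 := fun i s =>
    if h : ∃ hs : s.Nonempty, ∃ h : hs.choose ∈ K', (hidx _ h).choose = i then e s else 0
  refine ⟨f, fun i hi => ⟨C i, hCO i, hC i, fun p hp => ?_⟩, fun i => dif_neg ?_, mem_zer.2 fun p => ?_⟩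
  · filter_upwards [eventually_sm_subset_of_mem ((hC i).isClosed.isOpen_compl.mem_nhds hp)]
      with s hs _
    refine dif_neg ?_
    rintro ⟨h, h', rfl⟩
    exact hs h.choose_spec (hidx _ h').choose_spec.2
  · rintro ⟨h, -⟩
    exact Finset.not_nonempty_empty h
  · by_cases hp : p ∈ K
    · have hA : K' ∈ 𝓝 p := mem_interior_iff_mem_nhds.1 (h1 hp)
      rw [mem_van]
      filter_upwards [eventually_sm_subset_of_mem hA] with s hs hsk
      have hne : s.Nonempty := by
        rw [← Finset.card_pos, hsk]
        exact hk
      have hmem : hne.choose ∈ K' := hs hne.choose_spec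
      rw [Pi.add_apply, Finset.sum_apply, Finset.sum_eq_single (hidx _ hmem).choose]
      · have : f (hidx _ hmem).choose s = e s := dif_pos ⟨hne, hmem, rfl⟩
        rw [this]
        exact ZModModule.add_self _
      · intro j _ hj
        refine dif_neg ?_
        rintro ⟨h, h', rfl⟩
        exact hj rfl
      · intro h
        exact absurd (hidx _ hmem).choose_spec.1 h
    · rw [mem_van]
      filter_upwards [hKe p hp] with s hs hsk
      rw [Pi.add_apply, Finset.sum_apply, hs hsk, zero_add]
      refine Finset.sum_eq_zero fun i _ => ?_
      simp only [f, hs hsk, dite_eq_ite, ite_self]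

end Local

section Lebesgue

variable {X : Type*} [DecidableEq X] [MetricSpace X]

lemma exists_uniform_sm {K : Set X} (hK : IsCompact K) {P : Finset X → Prop}
    (h : ∀ p ∈ K, ∀ᶠ s in sm p, P s) :
    ∃ η > 0, ∀ p ∈ K, ∀ s : Finset X, (s : Set X) ⊆ ball p η → P s := by
  have h' := fun p hp => eventually_sm.1 (h p hp)
  choose N hN hP using h'
  obtain ⟨η, hη, h⟩ := Metric.uniformity_basis_dist.lebesgue_number_lemma_nhds' hK hN
  refine ⟨η, hη, fun p hp s hs => ?_⟩
  obtain ⟨y, hy⟩ := h p hp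
  exact hP y y.2 s (hs.trans fun q hq => hy (by
    rw [Metric.mem_ball'] at hq
    exact hq))

lemma exists_uniform_of_mem_zer {k : ℕ} (hk : 0 < k) {K : Set X}
    (hK : IsCompact K) {u : Finset X → ZMod 2} (hu : ∀ p ∈ K, u ∈ van k p) :
    ∃ η > 0, ∀ s : Finset X, (s : Set X) ⊆ K → s.card = k → (∀ p ∈ s, ∀ q ∈ s, dist p q < η) →
      u s = 0 := by
  obtain ⟨η, hη, h⟩ := exists_uniform_sm hK hu
  refine ⟨η, hη, fun s hs hc hd => ?_⟩
  have hne : s.Nonempty := by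
    rw [← Finset.card_pos, hc]
    exact hk
  obtain ⟨p, hp⟩ := hne
  exact h p (hs hp) s (fun q hq => hd q hq p hp) hc

end Lebesgue

section Sweep

variable {Y Z : Type*} [DecidableEq Y] [DecidableEq Z]

/-- The evaluation of a cochain on the track of a simplex under a sequence of maps. -/
noncomputable def sweep (N : ℕ) (G : ℕ → Z → Y) (v : Finset Y → ZMod 2) (s : Finset Z) : ZMod 2 :=
  ∑ m ∈ Finset.range N, ev v (homotopy (G m) (G (m + 1)) (simplex s))

lemma sweep_empty (N : ℕ) (G : ℕ → Z → Y) (v : Finset Y → ZMod 2) : sweep N G v ∅ = 0 := by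
  simp [sweep, homotopy_empty]

lemma cobd_sweep (N : ℕ) (G : ℕ → Z → Y) (v : Finset Y → ZMod 2) (s : Finset Z) :
    cobd (sweep N G v) s = pull (G 0) v s + pull (G N) v s +
      ∑ m ∈ Finset.range N, ev (cobd v) (homotopy (G m) (G (m + 1)) (simplex s)) := by
  have h : sweep N G v =
      ∑ m ∈ Finset.range N, fun t => ev v (homotopy (G m) (G (m + 1)) (simplex t)) := by
    ext t
    simp [sweep]
  rw [h, cobd_sum, Finset.sum_apply]
  simp only [cobd_ev_homotopy]
  rw [Finset.sum_add_distrib]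
  congr 1
  clear h
  induction N with
  | zero => simp [ZModModule.add_self]
  | succ N ih =>
    rw [Finset.sum_range_succ, ih]
    have := ZModModule.add_self (pull (G N) v s)
    linear_combination this

lemma sweep_mem_van [TopologicalSpace Z] {N : ℕ} {G : ℕ → Z → Y} {v : Finset Y → ZMod 2}
    {k : ℕ} {z : Z} (h : ∀ᶠ s in sm z, ∀ m < N, ∀ t ⊆ s.image (G m) ∪ s.image (G (m + 1)),
      t.card = k + 1 → v t = 0) : sweep N G v ∈ van k z := by
  filter_upwards [h] with s hs hk
  refine Finset.sum_eq_zero fun m hm => ?_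
  refine ev_eq_zero ?_ (homotopy_simplex_mem _ _ s)
  rintro t ⟨h1, h2⟩
  exact hs m (Finset.mem_range.1 hm) t h1 (by rw [h2, hk])

lemma cobd_sweep_mem_van [TopologicalSpace Z] [MetricSpace Y] {N : ℕ} {G : ℕ → Z → Y}
    {v : Finset Y → ZMod 2} {k : ℕ} {z : Z} {η : ℝ} {A : Set Y}
    (hv : ∀ t : Finset Y, (t : Set Y) ⊆ A → t.card = k + 1 →
      (∀ p ∈ t, ∀ q ∈ t, dist p q < η) → cobd v t = 0)
    (hG : ∀ m, ContinuousAt (G m) z) (hd : ∀ m < N, dist (G m z) (G (m + 1) z) < η)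
    (hA : ∀ᶠ x in 𝓝 z, ∀ m, G m x ∈ A) :
    cobd (sweep N G v) + pull (G 0) v + pull (G N) v ∈ van k z := by
  have h1 : ∀ m < N, ∀ᶠ x in 𝓝 z,
      dist (G m x) (G m z) < (η - dist (G m z) (G (m + 1) z)) / 2 ∧
      dist (G (m + 1) x) (G (m + 1) z) < (η - dist (G m z) (G (m + 1) z)) / 2 := by
    intro m hm
    have hpos : 0 < (η - dist (G m z) (G (m + 1) z)) / 2 := by linarith [hd m hm]
    exact ((hG m).eventually (ball_mem_nhds _ hpos)).and
      ((hG (m + 1)).eventually (ball_mem_nhds _ hpos))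
  have h2 : ∀ᶠ x in 𝓝 z, ∀ m < N,
      dist (G m x) (G m z) < (η - dist (G m z) (G (m + 1) z)) / 2 ∧
      dist (G (m + 1) x) (G (m + 1) z) < (η - dist (G m z) (G (m + 1) z)) / 2 := by
    have := (Finset.range N).eventually_all.2 (fun m hm => h1 m (Finset.mem_range.1 hm))
    filter_upwards [this] with x hx m hm using hx m (Finset.mem_range.2 hm)
  rw [mem_van]
  filter_upwards [eventually_sm_subset_of_mem h2, eventually_sm_subset_of_mem hA] with s hs hsA hk
  rw [Pi.add_apply, Pi.add_apply, cobd_sweep, Finset.sum_eq_zero, add_zero]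
  · have h3 := ZModModule.add_self (pull (G 0) v s)
    have h4 := ZModModule.add_self (pull (G N) v s)
    linear_combination h3 + h4
  intro m hm
  have hm := Finset.mem_range.1 hm
  refine ev_eq_zero ?_ (homotopy_simplex_mem _ _ s)
  rintro t ⟨ht, htc⟩
  have key : ∀ p ∈ t, ∃ x ∈ s, p = G m x ∨ p = G (m + 1) x := by
    intro p hp
    have := ht hp
    rw [Finset.mem_union, Finset.mem_image, Finset.mem_image] at this
    rcases this with ⟨x, hx, rfl⟩ | ⟨x, hx, rfl⟩
    · exact ⟨x, hx, Or.inl rfl⟩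
    · exact ⟨x, hx, Or.inr rfl⟩
  refine hv t ?_ (by rw [htc, hk]) ?_
  · intro p hp
    obtain ⟨x, hx, rfl | rfl⟩ := key p hp
    · exact hsA hx _
    · exact hsA hx _
  · intro p hp q hq
    obtain ⟨x, hx, hpx⟩ := key p hp
    obtain ⟨y, hy, hqy⟩ := key q hq
    have hx := hs hx m hm
    have hy := hs hy m hm
    have hdm := hd m hm
    have h0 : 0 ≤ dist (G m z) (G (m + 1) z) := dist_nonneg
    rcases hpx with rfl | rfl <;> rcases hqy with rfl | rfl
    · linarith [dist_triangle_right (G m x) (G m y) (G m z), hx.1, hy.1]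
    · linarith [dist_triangle4_right (G m x) (G (m + 1) y) (G m z) (G (m + 1) z), hx.1, hy.2]
    · have := dist_triangle4_right (G (m + 1) x) (G m y) (G (m + 1) z) (G m z)
      rw [dist_comm (G (m + 1) z) (G m z)] at this
      linarith [hx.2, hy.1]
    · linarith [dist_triangle_right (G (m + 1) x) (G (m + 1) y) (G (m + 1) z), hx.2, hy.2]

lemma exists_uniform_cobd [MetricSpace Y] [ProperSpace Y] {k : ℕ} {v : Finset Y → ZMod 2}
    {A K : Set Y} (hK : IsCompact K)
    (hv : ∀ t : Finset Y, (t : Set Y) ⊆ A → t.card = k → Disjoint (t : Set Y) K → v t = 0)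
    (hc : cobd v ∈ zer Y (k + 1)) :
    ∃ η > 0, ∀ t : Finset Y, (t : Set Y) ⊆ A → t.card = k + 1 →
      (∀ p ∈ t, ∀ q ∈ t, dist p q < η) → cobd v t = 0 := by
  obtain ⟨η, hη, h⟩ := exists_uniform_sm (hK.cthickening (r := 1)) fun p _ => mem_zer.1 hc p
  refine ⟨η, hη, fun t htA htc hd => ?_⟩
  by_cases hex : ∃ p ∈ t, p ∈ cthickening 1 K
  · obtain ⟨p, hp, hpK⟩ := hex
    exact h p hpK t (fun q hq => hd q hq p hp) htc
  · push Not at hex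
    refine Finset.sum_eq_zero fun p hp => hv _ ?_ ?_ ?_
    · exact (Finset.coe_subset.2 (Finset.erase_subset _ _)).trans htA
    · rw [Finset.card_erase_of_mem hp, htc, Nat.add_sub_cancel]
    · rw [Set.disjoint_left]
      intro q hq hqK
      exact hex q (Finset.mem_of_mem_erase hq) (self_subset_cthickening K hqK)

end Sweep

section Product

lemma restr_eq_zero_of_mem {X : Type*} [DecidableEq X] [TopologicalSpace X] {A : Set X} {u : Finset X → ZMod 2} {s : Finset X} {p : X}
    (hp : p ∈ s) (hA : p ∉ A) : restr A u s = 0 :=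
  restr_of_not_subset fun h => hA (h hp)

lemma restr_empty {X : Type*} [DecidableEq X] [TopologicalSpace X] (A : Set X) (u : Finset X → ZMod 2) : restr A u ∅ = u ∅ :=
  restr_of_subset (by simp)

lemma sweep_mem_van_of_mem {Y Z : Type*} [DecidableEq Y] [DecidableEq Z] [TopologicalSpace Z]
    {N : ℕ} {G : ℕ → Z → Y} {v : Finset Y → ZMod 2} {k : ℕ} {z : Z} {B : Set Y}
    (h : ∀ᶠ x in 𝓝 z, ∀ m, G m x ∈ B) (hv : ∀ t, t.card = k + 1 → ∀ p ∈ t, p ∈ B → v t = 0) :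
    sweep N G v ∈ van k z := by
  refine sweep_mem_van ?_
  filter_upwards [eventually_sm_subset_of_mem h] with s hs m _ t ht hc
  have hne : t.Nonempty := by
    rw [← Finset.card_pos, hc]
    exact k.succ_pos
  obtain ⟨p, hp⟩ := hne
  refine hv t hc p hp ?_
  have := ht hp
  rw [Finset.mem_union, Finset.mem_image, Finset.mem_image] at this
  rcases this with ⟨x, hx, rfl⟩ | ⟨x, hx, rfl⟩
  · exact hs hx _
  · exact hs hx _

lemma pull_eq_zero_of_mem {X Y : Type*} [DecidableEq X] [DecidableEq Y] {f : X → Y}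
    {u : Finset Y → ZMod 2} {s : Finset X} {p : X} {B : Set Y} (hp : p ∈ s) (hB : f p ∈ B)
    (hu : ∀ t, ∀ q ∈ t, q ∈ B → u t = 0) : pull f u s = 0 := by
  by_cases h : Set.InjOn f s
  · rw [pull_of_injOn _ h]
    exact hu _ _ (Finset.mem_image_of_mem f hp) hB
  · exact pull_of_not_injOn _ h

lemma van_of_forall_mem {X : Type*} [DecidableEq X] [TopologicalSpace X] {k : ℕ} {p : X}
    {u : Finset X → ZMod 2} {B : Set X} (hB : B ∈ 𝓝 p)
    (h : ∀ s, ∀ q ∈ s, q ∈ B → u s = 0) : u ∈ van (k + 1) p := by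
  filter_upwards [eventually_sm_subset_of_mem hB] with s hs hk
  have hne : s.Nonempty := by
    rw [← Finset.card_pos, hk]
    exact k.succ_pos
  obtain ⟨q, hq⟩ := hne
  exact h s q hq (hs hq)

variable {W : Type*} [DecidableEq W] [MetricSpace W] [ProperSpace W]

lemma exists_restr {X : Type*} [DecidableEq X] [MetricSpace X] {K : Set X} {k : ℕ}
    {f : Finset X → ZMod 2} (hf : ∀ p ∉ K, f ∈ van k p) :
    f + restr (cthickening 1 K) f ∈ zer X k := by
  refine add_restr_mem_zer ?_ hf
  exact (self_subset_thickening one_pos K).trans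
    (interior_maximal (thickening_subset_cthickening 1 K) isOpen_thickening)

lemma exists_upward_primitive {k : ℕ} {f : Finset (W × ℝ) → ZMod 2}
    (hf : f ∈ cocyc (k + 1) (Set.univ : Set (W × ℝ))) :
    ∃ (e : Finset (W × ℝ) → ZMod 2) (C : Set W) (R : ℝ), IsCompact C ∧ 0 ≤ R ∧ e ∅ = 0 ∧
      f + cobd e ∈ zer (W × ℝ) (k + 2) ∧
      ∀ p : W × ℝ, p.1 ∉ C ∨ p.2 < -R → e ∈ van (k + 1) p := by
  obtain ⟨⟨K, -, hK, hKf⟩, hfc⟩ := hf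
  have hff' := exists_restr hKf
  set K' := cthickening 1 K with hK'def
  have hK' : IsCompact K' := hK.cthickening
  set f' := restr K' f with hf'
  have hf0 : ∀ t : Finset (W × ℝ), ∀ p ∈ t, p ∉ K' → f' t = 0 :=
    fun t p hp hpK => restr_eq_zero_of_mem hp hpK
  have hf'c : cobd f' ∈ zer (W × ℝ) (k + 2 + 1) := by
    have h1 : cobd f' = cobd (f + f') + cobd f := by
      rw [cobd_add, add_comm (cobd f), add_assoc, cochain_add_self, add_zero]
    rw [h1]
    exact add_mem (cobd_mem_zer hff') hfc
  obtain ⟨η, hη, hu⟩ := exists_uniform_cobd (A := Set.univ) (v := f') hK'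
    (fun t _ hc hd => by
      have hne : t.Nonempty := by
        rw [← Finset.card_pos, hc]
        omega
      obtain ⟨p, hp⟩ := hne
      exact hf0 t p hp fun h => Set.disjoint_left.1 hd hp h) hf'c
  obtain ⟨R, hR⟩ := (hK'.image continuous_snd).isBounded.exists_norm_le
  have hR' : ∀ p ∈ K', |p.2| ≤ max R 0 := fun p hp =>
    (hR p.2 (Set.mem_image_of_mem _ hp)).trans (le_max_left _ _)
  clear hR
  obtain ⟨R, hR0, hR⟩ : ∃ R : ℝ, 0 ≤ R ∧ ∀ p ∈ K', |p.2| ≤ R := ⟨_, le_max_right _ _, hR'⟩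
  obtain ⟨N, hN⟩ := exists_nat_gt (2 * (R + 1) / η)
  have hN0 : (0 : ℝ) < N := lt_of_le_of_lt (by positivity) hN
  have hstep : 2 * (R + 1) / N < η := by
    rw [div_lt_iff₀ hη] at hN
    rw [div_lt_iff₀ hN0]
    linarith
  let G : ℕ → W × ℝ → W × ℝ := fun m p => (p.1, min p.2 (-(R + 1) + m * (2 * (R + 1) / N)))
  have hGc : ∀ m, Continuous (G m) := fun m => by fun_prop
  have hGN : ∀ p, G N p = (p.1, min p.2 (R + 1)) := fun p => by
    have : -(R + 1) + N * (2 * (R + 1) / N) = R + 1 := by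
      field_simp
      ring
    simp only [G, this]
  have hG0 : ∀ p, G 0 p = (p.1, min p.2 (-(R + 1))) := fun p => by simp [G]
  have hmain : ∀ z, cobd (sweep N G f') + pull (G 0) f' + pull (G N) f' ∈ van (k + 2) z := by
    intro z
    refine cobd_sweep_mem_van hu (fun m => (hGc m).continuousAt) (fun m _ => ?_) (by simp)
    refine lt_of_le_of_lt ?_ hstep
    rw [Prod.dist_eq]
    simp only [G, dist_self, Real.dist_eq]
    refine max_le (by positivity) ((abs_min_sub_min_le_max _ _ _ _).trans ?_)
    rw [sub_self, abs_zero]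
    refine max_le (by positivity) (le_of_eq ?_)
    push_cast
    rw [show -(R + 1) + (m : ℝ) * (2 * (R + 1) / N) -
      (-(R + 1) + ((m : ℝ) + 1) * (2 * (R + 1) / N)) = -(2 * (R + 1) / N) by ring, abs_neg]
    exact abs_of_nonneg (by positivity)
  have hz0 : pull (G 0) f' ∈ zer (W × ℝ) (k + 2) := by
    refine mem_zer.2 fun z => van_of_forall_mem univ_mem fun s q hq _ => ?_
    refine pull_eq_zero_of_mem (B := K'ᶜ) hq (fun h => ?_) fun t q hq h => hf0 t q hq h
    have := hR _ h
    rw [hG0, abs_le] at this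
    have h2 := min_le_right q.2 (-(R + 1))
    simp only at this
    linarith [this.1]
  have hzN : pull (G N) f' + f' ∈ zer (W × ℝ) (k + 2) := by
    refine mem_zer.2 fun z => ?_
    by_cases hz : z.2 < R + 1
    · have : {p : W × ℝ | p.2 < R + 1} ∈ 𝓝 z :=
        (isOpen_lt continuous_snd continuous_const).mem_nhds hz
      rw [mem_van]
      filter_upwards [eventually_sm_subset_of_mem this] with s hs _
      rw [Pi.add_apply, pull_of_eqOn_id]
      · exact ZModModule.add_self _
      · intro p hp
        have : p.2 < R + 1 := hs hp
        rw [hGN, min_eq_left this.le]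
    · have : {p : W × ℝ | R < p.2} ∈ 𝓝 z :=
        (isOpen_lt continuous_const continuous_snd).mem_nhds (by
          change R < z.2
          linarith)
      refine van_of_forall_mem this fun s q hq hq2 => ?_
      have hq2 : R < q.2 := hq2
      rw [Pi.add_apply, hf0 s q hq, add_zero]
      · refine pull_eq_zero_of_mem (B := K'ᶜ) hq (fun h => ?_) fun t q hq h => hf0 t q hq h
        have := hR _ h
        rw [hGN, abs_le] at this
        have h2 : R < min q.2 (R + 1) := lt_min hq2 (by linarith)
        simp only at this
        linarith [this.2]
      · intro h
        have := hR _ h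
        rw [abs_le] at this
        linarith [this.2]
  refine ⟨sweep N G f', Prod.fst '' K', R, hK'.image continuous_fst, hR0, sweep_empty _ _ _, ?_, ?_⟩
  · have : f + cobd (sweep N G f') = (f + f') + (pull (G N) f' + f') + pull (G 0) f' +
        (cobd (sweep N G f') + pull (G 0) f' + pull (G N) f') := by
      ext s
      simp only [Pi.add_apply]
      linear_combination -ZModModule.add_self (f' s) - ZModModule.add_self (pull (G N) f' s)
        - ZModModule.add_self (pull (G 0) f' s)
    rw [this]
    exact add_mem (add_mem (add_mem hff' hzN) hz0) (mem_zer.2 hmain)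
  · rintro p (hp | hp)
    · have hnhds : ∀ᶠ x : W × ℝ in 𝓝 p, x.1 ∈ (Prod.fst '' K')ᶜ :=
        continuous_fst.continuousAt.eventually
          ((hK'.image continuous_fst).isClosed.isOpen_compl.mem_nhds hp)
      refine sweep_mem_van_of_mem (B := K'ᶜ) ?_ fun t _ q hq h => hf0 t q hq h
      filter_upwards [hnhds] with x hx m h
      exact hx ⟨_, h, rfl⟩
    · have hnhds : {p : W × ℝ | p.2 < -R} ∈ 𝓝 p :=
        (isOpen_lt continuous_snd continuous_const).mem_nhds hp
      refine sweep_mem_van_of_mem (B := K'ᶜ) ?_ fun t _ q hq h => hf0 t q hq h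
      filter_upwards [hnhds] with x hx m h
      have h1 := hR _ h
      rw [abs_le] at h1
      have h2 : (G m x).2 ≤ x.2 := min_le_left _ _
      have h3 : x.2 < -R := hx
      linarith [h1.1]

end Product

section Homeomorph

variable {X Y : Type*} [DecidableEq X] [DecidableEq Y] [TopologicalSpace X] [TopologicalSpace Y]

lemma pull_mem_csupp_preimage (φ : X ≃ₜ Y) {k : ℕ} {O : Set Y} {u : Finset Y → ZMod 2}
    (hu : u ∈ csupp k O) : pull φ u ∈ csupp k (φ ⁻¹' O) := by
  obtain ⟨K, hKO, hK, h⟩ := hu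
  exact ⟨φ ⁻¹' K, Set.preimage_mono hKO, φ.isCompact_preimage.2 hK,
    fun p hp => pull_mem_van φ.continuous.continuousAt (h _ hp)⟩

lemma pull_mem_cocyc_preimage (φ : X ≃ₜ Y) {k : ℕ} {O : Set Y} {u : Finset Y → ZMod 2}
    (hu : u ∈ cocyc k O) : pull φ u ∈ cocyc k (φ ⁻¹' O) :=
  ⟨pull_mem_csupp_preimage φ hu.1, by
    rw [cobd_pull]
    exact pull_mem_zer φ.continuous hu.2⟩

lemma pull_mem_null_preimage (φ : X ≃ₜ Y) {k : ℕ} {O : Set Y} {u : Finset Y → ZMod 2}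
    (hu : u ∈ null k O) : pull φ u ∈ null k (φ ⁻¹' O) := by
  obtain ⟨e, he, h0, h⟩ := hu
  refine ⟨pull φ e, pull_mem_csupp_preimage φ he, by rw [pull_empty, h0], ?_⟩
  rw [cobd_pull, ← pull_add]
  exact pull_mem_zer φ.continuous h

lemma pull_symm_pull (φ : X ≃ₜ Y) (u : Finset Y → ZMod 2) : pull φ.symm (pull φ u) = u := by
  rw [pull_pull]
  have : (φ ∘ φ.symm : Y → Y) = id := by
    ext
    simp
  rw [this, pull_id]

end Homeomorph

section Fiber

variable {W : Type*} [DecidableEq W] [MetricSpace W] [ProperSpace W]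

lemma restr_mem_van {X : Type*} [DecidableEq X] [TopologicalSpace X] {A : Set X} {k : ℕ} {p : X}
    {u : Finset X → ZMod 2} (hu : u ∈ van k p) : restr A u ∈ van k p := by
  rw [mem_van]
  filter_upwards [hu] with s hs hk
  by_cases h : (s : Set X) ⊆ A
  · rw [restr_of_subset h, hs hk]
  · rw [restr_of_not_subset h]

/-- `F` represents the class obtained from the cocycle `f` by integration along the fibres of
`W × ℝ → W`. -/
def FiberRel (k : ℕ) (f : Finset (W × ℝ) → ZMod 2) (F : Finset W → ZMod 2) : Prop :=
  ∃ (e e' : Finset (W × ℝ) → ZMod 2) (C : Set W) (R : ℝ), IsCompact C ∧ 0 ≤ R ∧ e ∅ = 0 ∧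
    e' ∅ = 0 ∧ f + cobd e ∈ zer (W × ℝ) (k + 2) ∧ f + cobd e' ∈ zer (W × ℝ) (k + 2) ∧
    (∀ p : W × ℝ, p.1 ∉ C ∨ p.2 < -R → e ∈ van (k + 1) p) ∧
    (∀ p : W × ℝ, p.1 ∉ C ∨ R < p.2 → e' ∈ van (k + 1) p) ∧
    F + pull (fun w : W => (w, (0 : ℝ))) (e + e') ∈ zer W (k + 1)

lemma FiberRel.add {k : ℕ} {f g : Finset (W × ℝ) → ZMod 2} {F G : Finset W → ZMod 2}
    (hf : FiberRel k f F) (hg : FiberRel k g G) : FiberRel k (f + g) (F + G) := by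
  obtain ⟨e, e', C, R, hC, hR, h0, h0', h1, h1', h2, h2', h3⟩ := hf
  obtain ⟨d, d', B, Q, hB, hQ, i0, i0', i1, i1', i2, i2', i3⟩ := hg
  refine ⟨e + d, e' + d', C ∪ B, max R Q, hC.union hB, le_max_of_le_left hR, by simp [h0, i0],
    by simp [h0', i0'], ?_, ?_, ?_, ?_, ?_⟩
  · rw [cobd_add, add_add_add_comm]
    exact add_mem h1 i1
  · rw [cobd_add, add_add_add_comm]
    exact add_mem h1' i1'
  · rintro p hp
    refine add_mem (h2 p ?_) (i2 p ?_)
    · exact hp.imp (fun h h' => h (Or.inl h')) fun h => by linarith [le_max_left R Q]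
    · exact hp.imp (fun h h' => h (Or.inr h')) fun h => by linarith [le_max_right R Q]
  · rintro p hp
    refine add_mem (h2' p ?_) (i2' p ?_)
    · exact hp.imp (fun h h' => h (Or.inl h')) fun h => by linarith [le_max_left R Q]
    · exact hp.imp (fun h h' => h (Or.inr h')) fun h => by linarith [le_max_right R Q]
  · rw [add_add_add_comm e d, pull_add, add_add_add_comm]
    exact add_mem h3 i3

lemma exists_fiberRel {k : ℕ} {f : Finset (W × ℝ) → ZMod 2}
    (hf : f ∈ cocyc (k + 1) (Set.univ : Set (W × ℝ))) :
    ∃ F ∈ cocyc k (Set.univ : Set W), FiberRel k f F := by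
  obtain ⟨e, C, R, hC, hR, h0, h1, h2⟩ := exists_upward_primitive hf
  let ρ : W × ℝ ≃ₜ W × ℝ := (Homeomorph.refl W).prodCongr (Homeomorph.neg ℝ)
  have hρ : ∀ p, ρ p = (p.1, -p.2) := fun p => rfl
  have hρρ : (ρ ∘ ρ : W × ℝ → W × ℝ) = id := by
    ext p <;> simp [hρ]
  obtain ⟨d, B, Q, hB, hQ, i0, i1, i2⟩ := exists_upward_primitive (pull_mem_cocyc_preimage ρ hf)
  have j1 : f + cobd (pull ρ d) ∈ zer (W × ℝ) (k + 2) := by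
    have := pull_mem_zer ρ.continuous i1
    rwa [pull_add, pull_pull, hρρ, pull_id, ← cobd_pull] at this
  have j2 : ∀ p : W × ℝ, p.1 ∉ B ∨ Q < p.2 → pull ρ d ∈ van (k + 1) p := fun p hp =>
    pull_mem_van ρ.continuous.continuousAt (i2 _ (hp.imp id fun h => by
      rw [hρ]
      change -p.2 < -Q
      linarith))
  have hι : Continuous fun w : W => (w, (0 : ℝ)) := by fun_prop
  refine ⟨pull (fun w : W => (w, (0 : ℝ))) (e + pull ρ d), ⟨⟨C ∪ B, Set.subset_univ _,
    hC.union hB, fun p hp => ?_⟩, ?_⟩, e, pull ρ d, C ∪ B, max R Q, hC.union hB,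
    le_max_of_le_left hR, h0, by rw [pull_empty, i0], h1, j1, ?_, ?_, ?_⟩
  · refine pull_mem_van hι.continuousAt (add_mem (h2 _ (Or.inl ?_)) (j2 _ (Or.inl ?_)))
    · exact fun h => hp (Or.inl h)
    · exact fun h => hp (Or.inr h)
  · rw [cobd_pull, cobd_add]
    refine pull_mem_zer hι ?_
    have : cobd e + cobd (pull ρ d) = (f + cobd e) + (f + cobd (pull ρ d)) := by
      rw [add_add_add_comm, cochain_add_self, zero_add]
    rw [this]
    exact add_mem h1 j1
  · rintro p hp
    refine h2 p ?_
    exact hp.imp (fun h h' => h (Or.inl h')) fun h => by linarith [le_max_left R Q]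
  · rintro p hp
    refine j2 p ?_
    exact hp.imp (fun h h' => h (Or.inr h')) fun h => by linarith [le_max_right R Q]
  · rw [cochain_add_self]
    exact zero_mem _

lemma abs_clamp_sub_clamp_le (x s t : ℝ) :
    |max (-s) (min x s) - max (-t) (min x t)| ≤ |s - t| := by
  refine (abs_max_sub_max_le_max _ _ _ _).trans (max_le ?_ ?_)
  · rw [neg_sub_neg, abs_sub_comm]
  · refine (abs_min_sub_min_le_max _ _ _ _).trans (max_le ?_ le_rfl)
    rw [sub_self, abs_zero]
    exact abs_nonneg _

/-- A cocycle on `W × ℝ` with fibrewise-proper support is, over a slab, the coboundary of a cochain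
as soon as its restriction to the zero section is. -/
lemma exists_slab_primitive {k : ℕ} {z : Finset (W × ℝ) → ZMod 2} {F eF : Finset W → ZMod 2}
    {C : Set W} (hC : IsCompact C) (hzc : cobd z ∈ zer (W × ℝ) (k + 2))
    (hz : ∀ p : W × ℝ, p.1 ∉ C → z ∈ van (k + 1) p)
    (hF : F + pull (fun w : W => (w, (0 : ℝ))) z ∈ zer W (k + 1))
    (heF : eF ∈ csupp k (Set.univ : Set W)) (he0 : eF ∅ = 0) (he : F + cobd eF ∈ zer W (k + 1))
    {R : ℝ} (hR : 0 < R) :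
    ∃ (d : Finset (W × ℝ) → ZMod 2) (C' : Set W), IsCompact C' ∧ d ∅ = 0 ∧
      (∀ p : W × ℝ, p.1 ∉ C' → d ∈ van k p) ∧
      ∀ p : W × ℝ, |p.2| < R → z + cobd d ∈ van (k + 1) p := by
  obtain ⟨KF, -, hKF, hKFe⟩ := heF
  set C₁ := cthickening 1 C with hC₁def
  have hC₁ : IsCompact C₁ := hC.cthickening
  set z' := restr (Prod.fst ⁻¹' C₁) z with hz'def
  have hzz' : z + z' ∈ zer (W × ℝ) (k + 1) := by
    refine add_restr_mem_zer (K := Prod.fst ⁻¹' C) ?_ hz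
    refine (Set.preimage_mono (self_subset_thickening one_pos C)).trans
      (interior_maximal (Set.preimage_mono (thickening_subset_cthickening 1 C))
        (isOpen_thickening.preimage continuous_fst))
  have hz'0 : ∀ t : Finset (W × ℝ), ∀ p ∈ t, p.1 ∉ C₁ → z' t = 0 :=
    fun t p hp h => restr_eq_zero_of_mem hp h
  have hz'c : cobd z' ∈ zer (W × ℝ) (k + 1 + 1) := by
    have h1 : cobd z' = cobd (z + z') + cobd z := by
      rw [cobd_add, add_comm (cobd z), add_assoc, cochain_add_self, add_zero]
    rw [h1]
    exact add_mem (cobd_mem_zer hzz') hzc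
  set A : Set (W × ℝ) := {p | |p.2| ≤ R} with hA
  obtain ⟨η, hη, hu⟩ := exists_uniform_cobd (A := A) (v := z') (K := C₁ ×ˢ Set.Icc (-R) R)
    (hC₁.prod isCompact_Icc)
    (fun t htA hc hd => by
      have hne : t.Nonempty := by
        rw [← Finset.card_pos, hc]
        omega
      obtain ⟨p, hp⟩ := hne
      refine hz'0 t p hp fun h => Set.disjoint_left.1 hd hp ⟨h, abs_le.1 (htA hp)⟩) hz'c
  obtain ⟨N, hN⟩ := exists_nat_gt (R / η)
  have hN0 : (0 : ℝ) < N := lt_of_le_of_lt (by positivity) hN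
  have hstep : R / N < η := by
    rw [div_lt_iff₀ hη] at hN
    rw [div_lt_iff₀ hN0]
    linarith
  let T : ℕ → ℝ := fun m => min (m * (R / N)) R
  have hT0 : ∀ m, 0 ≤ T m := fun m => le_min (by positivity) hR.le
  let G : ℕ → W × ℝ → W × ℝ := fun m p => (p.1, max (-(T m)) (min p.2 (T m)))
  have hGc : ∀ m, Continuous (G m) := fun m => by fun_prop
  have hTN : T N = R := by
    have : (N : ℝ) * (R / N) = R := by field_simp
    simp only [T, this, min_self]
  have hTz : T 0 = 0 := by simp [T, hR.le]
  have hG0 : G 0 = (fun w : W => (w, (0 : ℝ))) ∘ Prod.fst := by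
    ext p
    · rfl
    · simp [G, hTz]
  have hGN : ∀ p : W × ℝ, |p.2| < R → G N p = p := fun p hp => by
    rw [abs_lt] at hp
    simp only [G, hTN, min_eq_left hp.2.le, max_eq_right hp.1.le]
  have hGA : ∀ m p, G m p ∈ A := fun m p => by
    have h1 : T m ≤ R := min_le_right _ _
    have h2 := hT0 m
    refine abs_le.2 ⟨(neg_le_neg h1).trans (le_max_left _ _), max_le (by linarith) ?_⟩
    exact (min_le_right _ _).trans h1
  have hmain : ∀ p, cobd (sweep N G z') + pull (G 0) z' + pull (G N) z' ∈ van (k + 1) p := by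
    intro p
    refine cobd_sweep_mem_van hu (fun m => (hGc m).continuousAt) (fun m _ => ?_)
      (Eventually.of_forall fun x m => hGA m x)
    refine lt_of_le_of_lt ?_ hstep
    rw [Prod.dist_eq]
    simp only [G, dist_self, Real.dist_eq]
    refine max_le (by positivity) ((abs_clamp_sub_clamp_le _ _ _).trans
      ((abs_min_sub_min_le_max _ _ _ _).trans ?_))
    rw [sub_self, abs_zero]
    refine max_le (le_of_eq ?_) (by positivity)
    push_cast
    rw [show (m : ℝ) * (R / N) - ((m : ℝ) + 1) * (R / N) = -(R / N) by ring, abs_neg]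
    exact abs_of_nonneg (by positivity)
  refine ⟨pull Prod.fst eF + sweep N G z', C₁ ∪ KF, hC₁.union hKF, ?_, ?_, ?_⟩
  · rw [Pi.add_apply, pull_empty, he0, sweep_empty, add_zero]
  · intro p hp
    refine add_mem (pull_mem_van continuous_fst.continuousAt (hKFe _ fun h => hp (Or.inr h))) ?_
    have hnhds : ∀ᶠ x : W × ℝ in 𝓝 p, x.1 ∈ C₁ᶜ :=
      continuous_fst.continuousAt.eventually
        (hC₁.isClosed.isOpen_compl.mem_nhds fun h => hp (Or.inl h))
    refine sweep_mem_van_of_mem (B := {q | q.1 ∉ C₁}) ?_ fun t _ q hq h => hz'0 t q hq h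
    filter_upwards [hnhds] with x hx m using hx
  · intro p hp
    have h1 : pull (G N) z' + z' ∈ van (k + 1) p := by
      have : {q : W × ℝ | |q.2| < R} ∈ 𝓝 p :=
        (isOpen_lt continuous_snd.abs continuous_const).mem_nhds hp
      rw [mem_van]
      filter_upwards [eventually_sm_subset_of_mem this] with s hs _
      rw [Pi.add_apply, pull_of_eqOn_id fun q hq => hGN q (hs hq)]
      exact ZModModule.add_self _
    have h2 : pull Prod.fst F + pull (G 0) z ∈ van (k + 1) p := by
      rw [hG0, ← pull_pull, ← pull_add]
      exact pull_mem_van continuous_fst.continuousAt (mem_zer.1 hF _)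
    have h3 : pull (G 0) z + pull (G 0) z' ∈ van (k + 1) p := by
      rw [← pull_add]
      exact pull_mem_van (hGc 0).continuousAt (mem_zer.1 hzz' _)
    have h4 : pull Prod.fst F + cobd (pull Prod.fst eF) ∈ van (k + 1) p := by
      rw [cobd_pull, ← pull_add]
      exact pull_mem_van continuous_fst.continuousAt (mem_zer.1 he _)
    have key : z + cobd (pull Prod.fst eF + sweep N G z') =
        (cobd (sweep N G z') + pull (G 0) z' + pull (G N) z') + (pull (G N) z' + z') + (z + z') +
        (pull Prod.fst F + pull (G 0) z) + (pull (G 0) z + pull (G 0) z') +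
        (pull Prod.fst F + cobd (pull Prod.fst eF)) := by
      rw [cobd_add]
      ext s
      simp only [Pi.add_apply]
      linear_combination -ZModModule.add_self (z' s) - ZModModule.add_self (pull (G N) z' s)
        - ZModModule.add_self (pull (G 0) z' s) - ZModModule.add_self (pull (G 0) z s)
        - ZModModule.add_self (pull Prod.fst F s)
    rw [key]
    exact add_mem (add_mem (add_mem (add_mem (add_mem (hmain p) h1) (mem_zer.1 hzz' p)) h2) h3) h4

lemma restr_mem_van_of_notMem {X : Type*} [DecidableEq X] [TopologicalSpace X] {A : Set X} {k : ℕ}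
    {p : X} {u : Finset X → ZMod 2} (h : Aᶜ ∈ 𝓝 p) : restr A u ∈ van (k + 1) p :=
  van_of_forall_mem h fun _ _ hq hqA => restr_eq_zero_of_mem hq hqA

lemma add_restr_mem_van {X : Type*} [DecidableEq X] [TopologicalSpace X] {A : Set X} {k : ℕ}
    {p : X} {u : Finset X → ZMod 2} (h : A ∈ 𝓝 p) : u + restr A u ∈ van k p := by
  rw [mem_van]
  filter_upwards [eventually_sm_subset_of_mem h] with s hs _
  rw [Pi.add_apply, restr_of_subset hs]
  exact ZModModule.add_self _

lemma FiberRel.mem_null {k : ℕ} {f : Finset (W × ℝ) → ZMod 2} {F : Finset W → ZMod 2}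
    (h : FiberRel k f F) (hF : F ∈ null k (Set.univ : Set W)) :
    f ∈ null (k + 1) (Set.univ : Set (W × ℝ)) := by
  obtain ⟨e, e', C, R, hC, hR, h0, h0', h1, h1', h2, h2', h3⟩ := h
  obtain ⟨eF, heF, heF0, hF⟩ := hF
  have hzc : cobd (e + e') ∈ zer (W × ℝ) (k + 2) := by
    have : cobd (e + e') = (f + cobd e) + (f + cobd e') := by
      rw [cobd_add, add_add_add_comm, cochain_add_self, zero_add]
    rw [this]
    exact add_mem h1 h1'
  obtain ⟨d, C', hC', d0, d1, d2⟩ := exists_slab_primitive hC hzc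
    (fun p hp => add_mem (h2 p (Or.inl hp)) (h2' p (Or.inl hp))) h3 heF heF0 hF
    (R := R + 2) (by linarith)
  set P : Set (W × ℝ) := {p | 0 < p.2} with hP
  set A : Set (W × ℝ) := {p | |p.2| ≤ R + 1} with hA
  set e₂ := e + cobd (restr P d) with he₂
  have hlow : ∀ p : W × ℝ, p.2 < 0 → e + e₂ ∈ van (k + 1) p := by
    intro p hp
    rw [he₂, ← add_assoc, cochain_add_self, zero_add]
    have hPp : Pᶜ ∈ 𝓝 p := by
      refine mem_of_superset ((isOpen_lt continuous_snd continuous_const).mem_nhds hp) ?_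
      intro q hq hq'
      exact lt_asymm (a := q.2) hq hq'
    cases k with
    | zero =>
      refine cobd_mem_van ?_
      rw [mem_van]
      refine Eventually.of_forall fun s hs => ?_
      rw [Finset.card_eq_zero.1 hs, restr_empty, d0]
    | succ k => exact cobd_mem_van (restr_mem_van_of_notMem hPp)
  have hhigh : ∀ p : W × ℝ, 0 < p.2 → |p.2| < R + 2 → e' + e₂ ∈ van (k + 1) p := by
    intro p hp hpR
    have hPp : P ∈ 𝓝 p := (isOpen_lt continuous_const continuous_snd).mem_nhds hp
    have : e' + e₂ = (e + e' + cobd d) + cobd (d + restr P d) := by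
      rw [he₂, cobd_add]
      ext s
      simp only [Pi.add_apply]
      linear_combination -ZModModule.add_self (cobd d s)
    rw [this]
    exact add_mem (d2 p hpR) (cobd_mem_van (add_restr_mem_van hPp))
  have hside : ∀ p : W × ℝ, p.1 ∉ C ∪ C' → e₂ ∈ van (k + 1) p := by
    intro p hp
    exact add_mem (h2 p (Or.inl fun h => hp (Or.inl h)))
      (cobd_mem_van (restr_mem_van (d1 p fun h => hp (Or.inr h))))
  have hvan : ∀ p : W × ℝ, R < |p.2| → |p.2| < R + 2 → e₂ ∈ van (k + 1) p := by
    intro p hp hpR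
    rcases lt_or_ge p.2 0 with h | h
    · rw [abs_of_neg h] at hp
      have := add_mem (h2 p (Or.inr (by linarith))) (hlow p h)
      rwa [← add_assoc, cochain_add_self, zero_add] at this
    · rw [abs_of_nonneg h] at hp
      have := add_mem (h2' p (Or.inr hp)) (hhigh p (by linarith) hpR)
      rwa [← add_assoc, cochain_add_self, zero_add] at this
  have hA2 : ∀ p : W × ℝ, |p.2| < R + 1 → A ∈ 𝓝 p := fun p hp =>
    mem_of_superset ((isOpen_lt continuous_snd.abs continuous_const).mem_nhds hp)
      fun q hq => le_of_lt (a := |q.2|) hq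
  have hA3 : ∀ p : W × ℝ, R + 1 < |p.2| → Aᶜ ∈ 𝓝 p := fun p hp =>
    mem_of_superset ((isOpen_lt continuous_const continuous_snd.abs).mem_nhds hp)
      fun q hq (h : |q.2| ≤ R + 1) => absurd hq (not_lt.2 h)
  have hfe₂ : f + cobd e₂ ∈ zer (W × ℝ) (k + 2) := by
    rw [he₂, cobd_add, cobd_cobd, add_zero]
    exact h1
  refine ⟨restr A e₂, ⟨(C ∪ C') ×ˢ Set.Icc (-R) R, Set.subset_univ _,
    (hC.union hC').prod isCompact_Icc, fun p hp => ?_⟩, ?_, mem_zer.2 fun p => ?_⟩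
  · by_cases h : p.1 ∈ C ∪ C'
    · have hp2 : R < |p.2| := by
        by_contra hcon
        exact hp ⟨h, abs_le.1 (not_lt.1 hcon)⟩
      rcases lt_or_ge (|p.2|) (R + 2) with h' | h'
      · exact restr_mem_van (hvan p hp2 h')
      · exact restr_mem_van_of_notMem (hA3 p (by linarith))
    · exact restr_mem_van (hside p h)
  · rw [restr_empty, he₂, Pi.add_apply, h0, cobd_empty, add_zero]
  · rcases lt_or_ge (|p.2|) (R + 1) with h | h
    · have : f + cobd (restr A e₂) = (f + cobd e₂) + cobd (e₂ + restr A e₂) := by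
        rw [cobd_add e₂ (restr A e₂)]
        ext s
        simp only [Pi.add_apply]
        linear_combination -ZModModule.add_self (cobd e₂ s)
      rw [this]
      exact add_mem (mem_zer.1 hfe₂ p) (cobd_mem_van (add_restr_mem_van (hA2 p h)))
    · have hv : cobd (restr A e₂) ∈ van (k + 2) p := by
        rcases lt_or_ge (|p.2|) (R + 2) with h' | h'
        · exact cobd_mem_van (restr_mem_van (hvan p (by linarith) h'))
        · exact cobd_mem_van (restr_mem_van_of_notMem (hA3 p (by linarith)))
      refine add_mem ?_ hv
      rcases le_abs.1 h with h' | h'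
      · have := add_mem (mem_zer.1 h1' p) (cobd_mem_van (h2' p (Or.inr (by linarith))))
        rwa [add_assoc, cochain_add_self, add_zero] at this
      · have := add_mem (mem_zer.1 h1 p) (cobd_mem_van (h2 p (Or.inr (by linarith))))
        rwa [add_assoc, cochain_add_self, add_zero] at this

end Fiber

section Generators

/-- The sum of two compactly supported `n`-cocycles that are not coboundaries is a coboundary. -/
def IndexTwo (n : ℕ) (X : Type*) [DecidableEq X] [TopologicalSpace X] : Prop :=
  ∀ f ∈ cocyc n (Set.univ : Set X), ∀ g ∈ cocyc n (Set.univ : Set X),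
    f ∉ null n (Set.univ : Set X) → g ∉ null n (Set.univ : Set X) →
    f + g ∈ null n (Set.univ : Set X)

/-- Every point supports an `n`-cocycle which is not the coboundary of a compactly supported
cochain. -/
def HasGen (n : ℕ) (X : Type*) [DecidableEq X] [TopologicalSpace X] : Prop :=
  ∀ p : X, ∃ u : Finset X → ZMod 2, (∀ q ≠ p, u ∈ van (n + 1) q) ∧ cobd u ∈ zer X (n + 2) ∧
    u ∉ null n (Set.univ : Set X)

variable {X Y : Type*} [DecidableEq X] [DecidableEq Y] [TopologicalSpace X] [TopologicalSpace Y]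

lemma pull_mem_cocyc_univ (φ : X ≃ₜ Y) {k : ℕ} {u : Finset Y → ZMod 2}
    (hu : u ∈ cocyc k (Set.univ : Set Y)) : pull φ u ∈ cocyc k (Set.univ : Set X) :=
  cocyc_mono (Set.subset_univ _) (pull_mem_cocyc_preimage φ hu)

lemma pull_mem_null_univ (φ : X ≃ₜ Y) {k : ℕ} {u : Finset Y → ZMod 2} :
    pull φ u ∈ null k (Set.univ : Set X) ↔ u ∈ null k (Set.univ : Set Y) := by
  constructor
  · intro h
    have := null_mono (Set.subset_univ _) (pull_mem_null_preimage φ.symm h)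
    rwa [pull_symm_pull] at this
  · exact fun h => null_mono (Set.subset_univ _) (pull_mem_null_preimage φ h)

lemma IndexTwo.of_homeomorph {n : ℕ} (φ : X ≃ₜ Y) (h : IndexTwo n X) : IndexTwo n Y := by
  intro f hf g hg hfn hgn
  rw [← pull_mem_null_univ φ] at hfn hgn ⊢
  rw [pull_add]
  exact h _ (pull_mem_cocyc_univ φ hf) _ (pull_mem_cocyc_univ φ hg) hfn hgn

lemma HasGen.of_homeomorph {n : ℕ} (φ : X ≃ₜ Y) (h : HasGen n X) : HasGen n Y := by
  intro p
  obtain ⟨u, h1, h2, h3⟩ := h (φ.symm p)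
  refine ⟨pull φ.symm u, fun q hq => ?_, ?_, fun h => h3 ((pull_mem_null_univ φ.symm).1 h)⟩
  · exact pull_mem_van φ.symm.continuous.continuousAt (h1 _ fun h => hq (φ.symm.injective h))
  · rw [cobd_pull]
    exact pull_mem_zer φ.symm.continuous h2

lemma mem_null_zero_of_unique [Unique X] {O : Set X} {u : Finset X → ZMod 2} :
    u ∈ null 0 O ↔ u {default} = 0 := by
  constructor
  · rintro ⟨e, -, h0, h⟩
    obtain ⟨N, hN, h⟩ := eventually_sm.1 (mem_zer.1 h default)
    have := h {default} (by simpa using mem_of_mem_nhds hN) (by simp)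
    simpa [cobd, h0] using this
  · intro h
    refine zer_le_null (mem_zer.2 fun p => mem_van.2 <| Eventually.of_forall fun s hs => ?_)
    obtain ⟨a, rfl⟩ := Finset.card_eq_one.1 hs
    rwa [Unique.eq_default a]

lemma indexTwo_zero_of_unique [Unique X] : IndexTwo 0 X := by
  intro f _ g _
  simp only [mem_null_zero_of_unique, Pi.add_apply]
  generalize f {default} = a
  generalize g {default} = b
  revert a b
  decide

lemma hasGen_zero_of_unique [Unique X] : HasGen 0 X := by
  intro p
  refine ⟨fun _ => 1, fun q hq => absurd (Subsingleton.elim q p) hq,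
    mem_zer.2 fun q => mem_van.2 <| Eventually.of_forall fun s hs => ?_, ?_⟩
  · have := Finset.card_le_one_of_subsingleton s
    omega
  · rw [mem_null_zero_of_unique]
    exact one_ne_zero

variable {W : Type*} [DecidableEq W] [MetricSpace W] [ProperSpace W]

lemma IndexTwo.prod_real {n : ℕ} (h : IndexTwo n W) : IndexTwo (n + 1) (W × ℝ) := by
  intro f hf g hg hfn hgn
  obtain ⟨F, hF, hfF⟩ := exists_fiberRel hf
  obtain ⟨G, hG, hgG⟩ := exists_fiberRel hg
  exact (hfF.add hgG).mem_null
    (h F hF G hG (fun h => hfn (hfF.mem_null h)) fun h => hgn (hgG.mem_null h))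

lemma exists_gen_of_gen {n : ℕ} {w : W} {u : Finset W → ZMod 2}
    (h1 : ∀ q ≠ w, u ∈ van (n + 1) q) (h2 : cobd u ∈ zer W (n + 2))
    (h3 : u ∉ null n (Set.univ : Set W)) :
    ∃ f : Finset (W × ℝ) → ZMod 2, (∀ q ≠ (w, 0), f ∈ van (n + 2) q) ∧
      cobd f ∈ zer (W × ℝ) (n + 3) ∧ f ∉ null (n + 1) (Set.univ : Set (W × ℝ)) := by
  set B := closedBall w 1 with hB
  have hBc : IsCompact B := isCompact_closedBall w 1
  set u₁ := restr B u with hu₁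
  have huu : u + u₁ ∈ zer W (n + 1) := by
    refine add_restr_mem_zer (K := {w}) ?_ fun p hp => h1 p hp
    rw [Set.singleton_subset_iff, mem_interior_iff_mem_nhds]
    exact closedBall_mem_nhds w one_pos
  have hu₁c : cobd u₁ ∈ zer W (n + 2) := by
    have : cobd u₁ = cobd (u + u₁) + cobd u := by
      rw [cobd_add, add_comm (cobd u), add_assoc, cochain_add_self, add_zero]
    rw [this]
    exact add_mem (cobd_mem_zer huu) h2
  have hu₁v : ∀ q ≠ w, u₁ ∈ van (n + 1) q := fun q hq => restr_mem_van (h1 q hq)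
  have hu₁n : u₁ ∉ null n (Set.univ : Set W) := fun h => h3 (by
    have := add_mem (zer_le_null huu) h
    rwa [add_assoc, cochain_add_self, add_zero] at this)
  set P : Set (W × ℝ) := {p | 0 < p.2} with hP
  set E := restr P (pull Prod.fst u₁) with hE
  have hPlow : ∀ p : W × ℝ, p.2 < 0 → Pᶜ ∈ 𝓝 p := fun p hp =>
    mem_of_superset ((isOpen_lt continuous_snd continuous_const).mem_nhds hp)
      fun q hq hq' => lt_asymm (a := q.2) hq hq'
  have hPhigh : ∀ p : W × ℝ, 0 < p.2 → P ∈ 𝓝 p := fun p hp =>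
    (isOpen_lt continuous_const continuous_snd).mem_nhds hp
  have hEB : ∀ t : Finset (W × ℝ), ∀ p ∈ t, p.1 ∉ B → E t = 0 := by
    intro t p hp hpB
    by_cases h : (t : Set (W × ℝ)) ⊆ P
    · rw [hE, restr_of_subset h]
      exact pull_eq_zero_of_mem (B := Bᶜ) hp hpB fun s q hq hqB => restr_eq_zero_of_mem hq hqB
    · exact restr_of_not_subset h
  refine ⟨cobd E, fun q hq => ?_, by rw [cobd_cobd]; exact zero_mem _, ?_⟩
  · by_cases hq1 : q.1 = w
    · have hq2 : q.2 ≠ 0 := fun h => hq (Prod.ext hq1 h)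
      rcases hq2.lt_or_gt with h | h
      · exact cobd_mem_van (restr_mem_van_of_notMem (hPlow q h))
      · have : cobd E = cobd (pull Prod.fst u₁ + E) + cobd (pull Prod.fst u₁) := by
          rw [cobd_add, add_comm (cobd (pull Prod.fst u₁)), add_assoc, cochain_add_self, add_zero]
        rw [this]
        refine add_mem (cobd_mem_van (add_restr_mem_van (hPhigh q h))) ?_
        rw [cobd_pull]
        exact pull_mem_van continuous_fst.continuousAt (mem_zer.1 hu₁c _)
    · exact cobd_mem_van (restr_mem_van
        (pull_mem_van continuous_fst.continuousAt (hu₁v _ hq1)))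
  rintro ⟨e, ⟨K, -, hK, hKe⟩, he0, he⟩
  have hee := exists_restr hKe
  set K' := cthickening 1 K with hK'def
  have hK' : IsCompact K' := hK.cthickening
  set e₁ := restr K' e with he₁
  have he₁0 : ∀ t : Finset (W × ℝ), ∀ p ∈ t, p ∉ K' → e₁ t = 0 :=
    fun t p hp hpK => restr_eq_zero_of_mem hp hpK
  set v := E + e₁ with hv
  have hvc : cobd v ∈ zer (W × ℝ) (n + 1 + 1) := by
    have : cobd v = (cobd E + cobd e) + cobd (e + e₁) := by
      rw [hv, cobd_add, cobd_add]
      ext s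
      simp only [Pi.add_apply]
      linear_combination -ZModModule.add_self (cobd e s)
    rw [this]
    exact add_mem he (cobd_mem_zer hee)
  obtain ⟨R, hR⟩ := (hK'.image continuous_snd).isBounded.exists_norm_le
  have hR' : ∀ p ∈ K', |p.2| < max R 0 + 1 := fun p hp =>
    lt_of_le_of_lt ((hR p.2 (Set.mem_image_of_mem _ hp)).trans (le_max_left _ _)) (lt_add_one _)
  clear hR
  obtain ⟨R, hR0, hR⟩ : ∃ R : ℝ, 0 < R ∧ ∀ p ∈ K', |p.2| < R :=
    ⟨_, lt_of_le_of_lt (le_max_right _ _) (lt_add_one _), hR'⟩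
  set C := B ∪ Prod.fst '' K' with hC
  have hCc : IsCompact C := hBc.union (hK'.image continuous_fst)
  have hvC : ∀ t : Finset (W × ℝ), ∀ p ∈ t, p.1 ∉ C → v t = 0 := by
    intro t p hp hpC
    rw [hv, Pi.add_apply, hEB t p hp fun h => hpC (Or.inl h),
      he₁0 t p hp fun h => hpC (Or.inr ⟨p, h, rfl⟩), add_zero]
  obtain ⟨η, hη, hu⟩ := exists_uniform_cobd (A := {p : W × ℝ | |p.2| ≤ R}) (v := v)
    (K := C ×ˢ Set.Icc (-R) R) (hCc.prod isCompact_Icc)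
    (fun t htA hc hd => by
      have hne : t.Nonempty := by
        rw [← Finset.card_pos, hc]
        omega
      obtain ⟨p, hp⟩ := hne
      exact hvC t p hp fun h => Set.disjoint_left.1 hd hp ⟨h, abs_le.1 (htA hp)⟩) hvc
  obtain ⟨N, hN⟩ := exists_nat_gt (2 * R / η)
  have hN0 : (0 : ℝ) < N := lt_of_le_of_lt (by positivity) hN
  have hstep : 2 * R / N < η := by
    rw [div_lt_iff₀ hη] at hN
    rw [div_lt_iff₀ hN0]
    linarith
  let T : ℕ → ℝ := fun m => min (-R + m * (2 * R / N)) R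
  let G : ℕ → W → W × ℝ := fun m p => (p, T m)
  have hGc : ∀ m, Continuous (G m) := fun m => by fun_prop
  have hTN : T N = R := by
    have : -R + (N : ℝ) * (2 * R / N) = R := by
      field_simp
      ring
    simp only [T, this, min_self]
  have hTz : T 0 = -R := by
    simp only [T, Nat.cast_zero, zero_mul, add_zero]
    exact min_eq_left (by linarith)
  have hGA : ∀ m p, G m p ∈ {p : W × ℝ | |p.2| ≤ R} := fun m p => by
    have h0 : 0 ≤ (m : ℝ) * (2 * R / N) := by positivity
    have h1 : -R ≤ T m := le_min (by linarith) (by linarith)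
    exact abs_le.2 ⟨h1, min_le_right _ _⟩
  have hmain : ∀ p, cobd (sweep N G v) + pull (G 0) v + pull (G N) v ∈ van (n + 1) p := by
    intro p
    refine cobd_sweep_mem_van hu (fun m => (hGc m).continuousAt) (fun m _ => ?_)
      (Eventually.of_forall fun x m => hGA m x)
    refine lt_of_le_of_lt ?_ hstep
    rw [Prod.dist_eq]
    simp only [G, dist_self, Real.dist_eq]
    refine max_le (by positivity) ((abs_min_sub_min_le_max _ _ _ _).trans ?_)
    rw [sub_self, abs_zero]
    refine max_le (le_of_eq ?_) (by positivity)
    push_cast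
    rw [show -R + (m : ℝ) * (2 * R / N) - (-R + ((m : ℝ) + 1) * (2 * R / N)) = -(2 * R / N) by
      ring, abs_neg]
    exact abs_of_nonneg (by positivity)
  have hlow : pull (G 0) v ∈ zer W (n + 1) := by
    refine mem_zer.2 fun p => van_of_forall_mem univ_mem fun s q hq _ => ?_
    refine pull_eq_zero_of_mem (B := {p : W × ℝ | p.2 = -R}) hq hTz fun t q hq hqR => ?_
    have hqR : q.2 = -R := hqR
    rw [hv, Pi.add_apply, he₁0 t q hq, add_zero, hE]
    · refine restr_eq_zero_of_mem hq fun h => ?_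
      have h : 0 < q.2 := h
      linarith
    · intro h
      have := hR q h
      rw [hqR, abs_neg, abs_of_pos hR0] at this
      exact lt_irrefl _ this
  have hhigh : u₁ + pull (G N) v ∈ zer W (n + 1) := by
    refine mem_zer.2 fun p => van_of_forall_mem univ_mem fun s q hq _ => ?_
    have h4 : pull (G N) e₁ s = 0 := by
      refine pull_eq_zero_of_mem (B := {p : W × ℝ | p.2 = R}) hq hTN fun t q hq hqR => ?_
      refine he₁0 t q hq fun h => ?_
      have hqR : q.2 = R := hqR
      have := hR q h
      rw [hqR, abs_of_pos hR0] at this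
      exact lt_irrefl _ this
    have h5 : pull (G N) E s = u₁ s := by
      have hinj : Set.InjOn (G N) s := fun a _ b _ h => (Prod.ext_iff.1 h).1
      have h6 : ((s.image (G N) : Finset (W × ℝ)) : Set (W × ℝ)) ⊆ P := by
        intro p hp
        obtain ⟨a, -, rfl⟩ := Finset.mem_image.1 hp
        change 0 < T N
        rwa [hTN]
      rw [pull_of_injOn _ hinj, hE, restr_of_subset h6, ← pull_of_injOn (pull Prod.fst u₁) hinj, pull_pull]
      exact pull_of_eqOn_id fun _ _ => rfl
    rw [hv, pull_add, Pi.add_apply, Pi.add_apply, h4, h5, add_zero]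
    exact ZModModule.add_self _
  refine hu₁n ⟨sweep N G v, ⟨C, Set.subset_univ _, hCc, fun p hp => ?_⟩, sweep_empty _ _ _, ?_⟩
  · refine sweep_mem_van_of_mem (B := {q : W × ℝ | q.1 ∉ C}) ?_ fun t _ q hq h => hvC t q hq h
    filter_upwards [hCc.isClosed.isOpen_compl.mem_nhds hp] with x hx m using hx
  · have : u₁ + cobd (sweep N G v) = (u₁ + pull (G N) v) + pull (G 0) v +
        (cobd (sweep N G v) + pull (G 0) v + pull (G N) v) := by
      ext s
      simp only [Pi.add_apply]
      linear_combination -ZModModule.add_self (pull (G N) v s) - ZModModule.add_self (pull (G 0) v s)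
    rw [this]
    exact add_mem (add_mem hhigh hlow) (mem_zer.2 hmain)

lemma HasGen.prod_real {n : ℕ} (h : HasGen n W) : HasGen (n + 1) (W × ℝ) := by
  rintro ⟨w, x⟩
  obtain ⟨u, h1, h2, h3⟩ := h w
  obtain ⟨f, h4, h5, h6⟩ := exists_gen_of_gen h1 h2 h3
  let φ : W × ℝ ≃ₜ W × ℝ := (Homeomorph.refl W).prodCongr (Homeomorph.addRight (-x))
  have hφ : ∀ q, φ q = (q.1, q.2 + -x) := fun _ => rfl
  refine ⟨pull φ f, fun q hq => ?_, ?_, fun h => h6 ((pull_mem_null_univ φ).1 h)⟩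
  · refine pull_mem_van φ.continuous.continuousAt (h4 _ fun h => hq ?_)
    rw [hφ, Prod.ext_iff] at h
    refine Prod.ext h.1 ?_
    have := h.2
    simp only at this
    change q.2 = x
    linarith
  · rw [cobd_pull]
    exact pull_mem_zer φ.continuous h5

end Generators

section Euclidean

lemma indexTwo_and_hasGen (n : ℕ) :
    IndexTwo n (Fin n → ℝ) ∧ HasGen n (Fin n → ℝ) := by
  induction n with
  | zero => exact ⟨indexTwo_zero_of_unique, hasGen_zero_of_unique⟩
  | succ n ih =>
    let φ : (Fin n → ℝ) × ℝ ≃ₜ (Fin (n + 1) → ℝ) :=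
      (Homeomorph.prodComm _ _).trans (Fin.consEquivL ℝ fun _ : Fin (n + 1) => ℝ).toHomeomorph
    exact ⟨(IndexTwo.prod_real ih.1).of_homeomorph φ, (HasGen.prod_real ih.2).of_homeomorph φ⟩

end Euclidean

section Extension

variable {X Y : Type*} [DecidableEq X] [DecidableEq Y] [TopologicalSpace X] [TopologicalSpace Y]

lemma pull_mem_van_iff {ψ : Y → X} (hψ : IsOpenEmbedding ψ) {k : ℕ} {q : Y}
    {u : Finset X → ZMod 2} : pull ψ u ∈ van k q ↔ u ∈ van k (ψ q) := by
  refine ⟨fun h => ?_, pull_mem_van hψ.continuous.continuousAt⟩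
  obtain ⟨N, hN, h⟩ := eventually_sm.1 h
  rw [mem_van]
  filter_upwards [eventually_sm_subset_of_mem (hψ.isOpenMap.image_mem_nhds hN)] with s hs hk
  have hs' : ((s.preimage ψ hψ.injective.injOn).image ψ) = s := by
    ext x
    simp only [Finset.mem_image, Finset.mem_preimage]
    refine ⟨fun ⟨y, hy, h⟩ => h ▸ hy, fun hx => ?_⟩
    obtain ⟨y, -, rfl⟩ := hs hx
    exact ⟨y, hx, rfl⟩
  have := h (s.preimage ψ hψ.injective.injOn) (fun y hy => by
    have hy : ψ y ∈ s := Finset.mem_preimage.1 hy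
    obtain ⟨y', hy', h⟩ := hs hy
    rwa [← hψ.injective h]) (by
      rw [← hk, ← hs', Finset.card_image_of_injective _ hψ.injective, hs'])
  rwa [pull_of_injOn _ hψ.injective.injOn, hs'] at this

lemma pull_mem_csupp_of_isOpenEmbedding {ψ : Y → X} (hψ : IsOpenEmbedding ψ) {k : ℕ} {O : Set Y}
    {u : Finset X → ZMod 2} (hu : u ∈ csupp k (ψ '' O)) : pull ψ u ∈ csupp k O := by
  obtain ⟨K, hKO, hK, h⟩ := hu
  refine ⟨ψ ⁻¹' K, ?_, ?_, fun p hp => pull_mem_van hψ.continuous.continuousAt (h _ hp)⟩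
  · rw [← Set.preimage_image_eq O hψ.injective]
    exact Set.preimage_mono hKO
  · rw [hψ.isInducing.isCompact_iff, Set.image_preimage_eq_of_subset]
    · exact hK
    · exact hKO.trans (Set.image_subset_range _ _)

lemma exists_extension [T2Space X] [LocallyCompactSpace Y] [Nonempty Y] {ψ : Y → X}
    (hψ : IsOpenEmbedding ψ) {k : ℕ} {O : Set Y} {g : Finset Y → ZMod 2} (hg : g ∈ csupp k O)
    (h0 : g ∅ = 0) :
    ∃ u ∈ csupp k (ψ '' O), u ∅ = 0 ∧ pull ψ u + g ∈ zer Y k := by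
  obtain ⟨K, hKO, hK, hKg⟩ := hg
  obtain ⟨K', hK', hKK', -⟩ := exists_compact_between hK isOpen_univ (Set.subset_univ K)
  have hgg := add_restr_mem_zer hKK' hKg
  set g' := restr K' g with hg'
  set σ := Function.invFun ψ with hσ
  have hσψ : ∀ y, σ (ψ y) = y := Function.leftInverse_invFun hψ.injective
  set u := restr (Set.range ψ) (pull σ g') with hu
  have hu0 : u ∅ = 0 := by rw [hu, restr_empty, pull_empty, hg', restr_empty, h0]
  have huψ : pull ψ u = g' := by
    ext s
    have : ((s.image ψ : Finset X) : Set X) ⊆ Set.range ψ := by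
      rw [Finset.coe_image]
      exact Set.image_subset_range _ _
    rw [pull_of_injOn _ hψ.injective.injOn, hu, restr_of_subset this,
      ← pull_of_injOn (pull σ g') hψ.injective.injOn, pull_pull]
    exact pull_of_eqOn_id fun y _ => hσψ y
  refine ⟨u, ⟨ψ '' K, Set.image_mono hKO, hK.image hψ.continuous, fun p hp => ?_⟩, hu0, ?_⟩
  · cases k with
    | zero =>
      refine mem_van.2 (Eventually.of_forall fun s hs => ?_)
      rw [Finset.card_eq_zero.1 hs, hu0]
    | succ k =>
    by_cases hpr : p ∈ Set.range ψ
    · obtain ⟨q, rfl⟩ := hpr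
      rw [← pull_mem_van_iff hψ, huψ]
      exact restr_mem_van (hKg q fun h => hp ⟨q, h, rfl⟩)
    · have hcl : IsClosed (ψ '' K') := (hK'.image hψ.continuous).isClosed
      refine van_of_forall_mem (hcl.isOpen_compl.mem_nhds fun h =>
        hpr (Set.image_subset_range _ _ h)) fun s q hq hqK => ?_
      by_cases h : (s : Set X) ⊆ Set.range ψ
      · rw [hu, restr_of_subset h]
        obtain ⟨y, rfl⟩ := h hq
        refine pull_eq_zero_of_mem (B := K'ᶜ) hq ?_ fun t a ha haK => restr_eq_zero_of_mem ha haK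
        rw [hσψ]
        exact fun hy => hqK ⟨y, hy, rfl⟩
      · exact restr_of_not_subset h
  · rw [huψ, add_comm]
    exact hgg

lemma pull_mem_cocyc_of_isOpenEmbedding {ψ : Y → X} (hψ : IsOpenEmbedding ψ) {k : ℕ} {O : Set Y}
    {u : Finset X → ZMod 2} (hu : u ∈ cocyc k (ψ '' O)) : pull ψ u ∈ cocyc k O :=
  ⟨pull_mem_csupp_of_isOpenEmbedding hψ hu.1, by
    rw [cobd_pull]
    exact pull_mem_zer hψ.continuous hu.2⟩

lemma van_of_notMem_of_mem_csupp {k : ℕ} {O : Set X} {u : Finset X → ZMod 2} (hu : u ∈ csupp k O)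
    {p : X} (hp : p ∉ O) : u ∈ van k p := by
  obtain ⟨K, h1, -, h3⟩ := hu
  exact h3 p fun h => hp (h1 h)

lemma pull_mem_null_iff [T2Space X] [LocallyCompactSpace Y] [Nonempty Y] {ψ : Y → X}
    (hψ : IsOpenEmbedding ψ) {k : ℕ} {O : Set Y} {u : Finset X → ZMod 2}
    (hu : u ∈ csupp (k + 1) (ψ '' O)) : pull ψ u ∈ null k O ↔ u ∈ null k (ψ '' O) := by
  constructor
  · rintro ⟨e, he, he0, h⟩
    obtain ⟨d, hd, hd0, hde⟩ := exists_extension hψ he he0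
    refine ⟨d, hd, hd0, mem_zer.2 fun p => ?_⟩
    by_cases hp : p ∈ Set.range ψ
    · obtain ⟨q, rfl⟩ := hp
      rw [← pull_mem_van_iff hψ]
      have : pull ψ (u + cobd d) = (pull ψ u + cobd e) + cobd (pull ψ d + e) := by
        rw [pull_add, cobd_add, ← cobd_pull]
        ext s
        simp only [Pi.add_apply]
        linear_combination -ZModModule.add_self (cobd e s)
      rw [this]
      exact add_mem (mem_zer.1 h q) (cobd_mem_van (mem_zer.1 hde q))
    · have hp' : p ∉ ψ '' O := fun h => hp (Set.image_subset_range _ _ h)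
      exact add_mem (van_of_notMem_of_mem_csupp hu hp')
        (cobd_mem_van (van_of_notMem_of_mem_csupp hd hp'))
  · rintro ⟨e, he, he0, h⟩
    refine ⟨pull ψ e, pull_mem_csupp_of_isOpenEmbedding hψ he, by rw [pull_empty, he0], ?_⟩
    rw [cobd_pull, ← pull_add]
    exact pull_mem_zer hψ.continuous h

end Extension

section Cells

variable {X : Type*} [DecidableEq X] [TopologicalSpace X]

/-- A subset which is the image of `ℝⁿ` under an open embedding. -/
def IsCell (n : ℕ) (Q : Set X) : Prop :=
  ∃ ψ : (Fin n → ℝ) → X, IsOpenEmbedding ψ ∧ Set.range ψ = Q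

lemma IsCell.isOpen {n : ℕ} {Q : Set X} (h : IsCell n Q) : IsOpen Q := by
  obtain ⟨ψ, hψ, rfl⟩ := h
  exact hψ.isOpen_range

lemma IsCell.nonempty {n : ℕ} {Q : Set X} (h : IsCell n Q) : Q.Nonempty := by
  obtain ⟨ψ, hψ, rfl⟩ := h
  exact Set.range_nonempty _

variable [T2Space X]

lemma IsCell.exists_gen {n : ℕ} {Q : Set X} (h : IsCell n Q) {p : X} (hp : p ∈ Q) :
    ∃ u : Finset X → ZMod 2, (∀ q ≠ p, u ∈ van (n + 1) q) ∧ cobd u ∈ zer X (n + 2) ∧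
      u ∉ null n Q := by
  obtain ⟨ψ, hψ, rfl⟩ := h
  obtain ⟨q, rfl⟩ := hp
  obtain ⟨u₀, h1, h2, h3⟩ := (indexTwo_and_hasGen n).2 q
  obtain ⟨u, hu0, huu⟩ : ∃ u : Finset (Fin n → ℝ) → ZMod 2, u ∅ = 0 ∧
      ∀ k, u₀ + u ∈ zer (Fin n → ℝ) (k + 1) := by
    refine ⟨Function.update u₀ ∅ 0, Function.update_self _ _ _, fun k => mem_zer.2 fun p =>
      mem_van.2 (Eventually.of_forall fun s hs => ?_)⟩
    have : s ≠ ∅ := by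
      rintro rfl
      simp at hs
    rw [Pi.add_apply, Function.update_of_ne this]
    exact ZModModule.add_self _
  have hu1 : ∀ q' ≠ q, u ∈ van (n + 1) q' := fun q' hq' => by
    have := add_mem (h1 q' hq') (mem_zer.1 (huu n) q')
    rwa [← add_assoc, cochain_add_self, zero_add] at this
  have hu2 : cobd u ∈ zer (Fin n → ℝ) (n + 2) := by
    have : cobd u = cobd (u₀ + u) + cobd u₀ := by
      rw [cobd_add, add_comm (cobd u₀), add_assoc, cochain_add_self, add_zero]
    rw [this]
    exact add_mem (cobd_mem_zer (huu n)) h2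
  obtain ⟨v, hv, -, hvu⟩ := exists_extension hψ (k := n + 1) (O := {q}) (g := u)
    ⟨{q}, subset_rfl, isCompact_singleton, hu1⟩ hu0
  have hvQ : v ∈ csupp (n + 1) (ψ '' Set.univ) := csupp_mono (Set.image_mono (Set.subset_univ _)) hv
  refine ⟨v, fun p hp => van_of_notMem_of_mem_csupp hv ?_, mem_zer.2 fun p => ?_, fun h => h3 ?_⟩
  · rw [Set.image_singleton]
    exact hp
  · by_cases hp : p ∈ Set.range ψ
    · obtain ⟨q', rfl⟩ := hp
      rw [← pull_mem_van_iff hψ, ← cobd_pull]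
      have : cobd (pull ψ v) = cobd (pull ψ v + u) + cobd u := by
        rw [cobd_add, add_assoc, cochain_add_self, add_zero]
      rw [this]
      exact add_mem (cobd_mem_van (mem_zer.1 hvu q')) (mem_zer.1 hu2 q')
    · exact cobd_mem_van (van_of_notMem_of_mem_csupp hvQ fun h =>
        hp (Set.image_subset_range _ _ h))
  · rw [← Set.image_univ, ← pull_mem_null_iff hψ hvQ] at h
    have : u₀ = (u₀ + u) + (pull ψ v + u) + pull ψ v := by
      ext s
      simp only [Pi.add_apply]
      linear_combination -ZModModule.add_self (u s) - ZModModule.add_self (pull ψ v s)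
    rw [this]
    exact add_mem (add_mem (zer_le_null (huu n)) (zer_le_null hvu)) h

lemma IsCell.add_mem_null {n : ℕ} {Q : Set X} (h : IsCell n Q) {f g : Finset X → ZMod 2}
    (hf : f ∈ cocyc n Q) (hg : g ∈ cocyc n Q) (hfn : f ∉ null n Q) (hgn : g ∉ null n Q) :
    f + g ∈ null n Q := by
  obtain ⟨ψ, hψ, rfl⟩ := h
  rw [← Set.image_univ] at *
  have hfg := add_mem hf hg
  rw [← pull_mem_null_iff hψ hf.1] at hfn
  rw [← pull_mem_null_iff hψ hg.1] at hgn
  rw [← pull_mem_null_iff hψ hfg.1, pull_add]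
  exact (indexTwo_and_hasGen n).1 _ (pull_mem_cocyc_of_isOpenEmbedding hψ hf) _
    (pull_mem_cocyc_of_isOpenEmbedding hψ hg) hfn hgn

lemma mem_null_iff_of_add_mem_null {n : ℕ} {O : Set X} {f g : Finset X → ZMod 2}
    (h : f + g ∈ null n O) : f ∈ null n O ↔ g ∈ null n O := by
  constructor
  · intro hf
    have := add_mem hf h
    rwa [← add_assoc, cochain_add_self, zero_add] at this
  · intro hg
    have := add_mem h hg
    rwa [add_assoc, cochain_add_self, add_zero] at this

lemma IsCell.mem_null_of_subset {n : ℕ} {Q Q' : Set X} (h : IsCell n Q) (h' : IsCell n Q')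
    (hQ : Q' ⊆ Q) {f : Finset X → ZMod 2} (hf : f ∈ cocyc n Q') (hfn : f ∈ null n Q) :
    f ∈ null n Q' := by
  by_contra hcon
  obtain ⟨p, hp⟩ := h'.nonempty
  obtain ⟨u, h1, h2, h3⟩ := h.exists_gen (hQ hp)
  have huQ' : u ∈ cocyc n Q' :=
    ⟨⟨{p}, Set.singleton_subset_iff.2 hp, isCompact_singleton, h1⟩, h2⟩
  have h4 := h'.add_mem_null hf huQ' hcon fun hu => h3 (null_mono hQ hu)
  exact h3 ((mem_null_iff_of_add_mem_null (null_mono hQ h4)).1 hfn)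

end Cells

section Rounding

/-- Two lattice points that are comparable and differ by at most one in each coordinate. -/
def Stair {n : ℕ} (a b : Fin n → ℤ) : Prop :=
  (∀ i, a i ≤ b i ∧ b i ≤ a i + 1) ∨ ∀ i, b i ≤ a i ∧ a i ≤ b i + 1

lemma card_le_of_stair {n : ℕ} {T : Finset (Fin n → ℤ)} (h : ∀ a ∈ T, ∀ b ∈ T, Stair a b) :
    T.card ≤ n + 1 := by
  rcases T.eq_empty_or_nonempty with rfl | hT
  · simp
  obtain ⟨a, ha, hmin⟩ := T.exists_min_image (fun a => ∑ i, a i) hT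
  have hsum : ∀ b c : Fin n → ℤ, (∀ i, b i ≤ c i ∧ c i ≤ b i + 1) →
      ∑ i, c i ≤ ∑ i, b i + n := by
    intro b c hbc
    have := Finset.sum_le_sum fun i (_ : i ∈ Finset.univ) => (hbc i).2
    simpa [Finset.sum_add_distrib] using this
  have hle : ∀ b c : Fin n → ℤ, (∀ i, b i ≤ c i ∧ c i ≤ b i + 1) → ∑ i, b i ≤ ∑ i, c i :=
    fun b c hbc => Finset.sum_le_sum fun i _ => (hbc i).1
  have heq : ∀ b c : Fin n → ℤ, (∀ i, b i ≤ c i ∧ c i ≤ b i + 1) → ∑ i, b i = ∑ i, c i →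
      b = c := by
    intro b c hbc hs
    ext i
    exact (Finset.sum_eq_sum_iff_of_le fun i _ => (hbc i).1).1 hs i (Finset.mem_univ i)
  have hcard := Finset.card_le_card_of_injOn (s := T) (t := Finset.Icc (∑ i, a i) (∑ i, a i + n))
    (fun a => ∑ i, a i) (fun b hb => by
      refine Finset.mem_coe.2 (Finset.mem_Icc.2 ⟨hmin b hb, ?_⟩)
      rcases h a ha b hb with h' | h'
      · exact hsum _ _ h'
      · exact (hle _ _ h').trans (by simp)) (fun b hb c hc hbc => by
      rcases h b hb c hc with h' | h'
      · exact heq _ _ h' hbc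
      · exact (heq _ _ h' hbc.symm).symm)
  refine hcard.trans ?_
  rw [Int.card_Icc]
  omega

lemma exists_shift {n : ℕ} (x : Fin n → ℝ) :
    ∃ j : Fin (n + 1), ∀ (i : Fin n) (a : ℤ),
      1 / (2 * ((n : ℝ) + 1)) ≤ |x i + (j : ℝ) / (n + 1) - a| := by
  by_contra! hcon
  choose i a h using hcon
  obtain ⟨j, j', hne, hi⟩ := Fintype.exists_ne_map_eq_of_card_lt i (by simp)
  have h1 := h j
  have h2 := h j'
  rw [← hi] at h2
  have hn : (0 : ℝ) < n + 1 := by positivity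
  have h3 : |((j : ℝ) - j') / (n + 1) - (a j - a j')| < 1 / (n + 1) := by
    have : ((j : ℝ) - j') / (n + 1) - (a j - a j') =
        (x (i j) + (j : ℝ) / (n + 1) - a j) - (x (i j) + (j' : ℝ) / (n + 1) - a j') := by ring
    rw [this]
    refine (abs_sub _ _).trans_lt ((add_lt_add h1 h2).trans_eq ?_)
    field_simp
    ring
  have h4 : |((j : ℤ) - (j' : ℤ)) - ((n : ℤ) + 1) * (a j - a j')| < 1 := by
    have h5 : ((j : ℝ) - j') / (n + 1) - (a j - a j') =
        (((j : ℝ) - j') - (n + 1) * (a j - a j')) / (n + 1) := by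
      field_simp
    rw [h5, abs_div, abs_of_pos hn, div_lt_div_iff_of_pos_right hn] at h3
    exact_mod_cast h3
  rw [Int.abs_lt_one_iff] at h4
  have hj := j.2
  have hj' := j'.2
  apply hne
  ext
  have h6 : |(a j - a j' : ℤ)| < 1 := by
    by_contra! h6
    have h7 : |((n : ℤ) + 1) * (a j - a j')| ≥ (n : ℤ) + 1 := by
      rw [abs_mul, abs_of_pos (by positivity : (0 : ℤ) < n + 1)]
      nlinarith
    rw [← sub_eq_zero.1 h4] at h7
    have : |(j : ℤ) - j'| < n + 1 := abs_lt.2 (by omega)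
    linarith
  rw [Int.abs_lt_one_iff.1 h6] at h4
  omega

lemma exists_rounding {n : ℕ} {h : ℝ} (hh : 0 < h) :
    ∃ r : (Fin n → ℝ) → Fin n → ℤ, (∀ p i, |h * r p i - p i| ≤ h) ∧
      ∀ p q, (∀ i, |p i - q i| < h / (2 * ((n : ℝ) + 1))) → Stair (r p) (r q) := by
  choose j hj using fun p : Fin n → ℝ => exists_shift fun i => p i / h
  have hn : (0 : ℝ) < n + 1 := by positivity
  have hj0 : ∀ p, 0 ≤ (j p : ℝ) / (n + 1) := fun p => by positivity
  have hj1 : ∀ p, (j p : ℝ) / (n + 1) ≤ 1 := fun p => by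
    rw [div_le_one hn]
    exact_mod_cast (j p).2.le
  let r : (Fin n → ℝ) → Fin n → ℤ := fun p i => ⌊p i / h + (j p : ℝ) / (n + 1)⌋
  have hr1 : ∀ p i, (r p i : ℝ) + 1 / (2 * ((n : ℝ) + 1)) ≤ p i / h + (j p : ℝ) / (n + 1) := by
    intro p i
    have h1 := hj p i (r p i)
    have h2 : (r p i : ℝ) ≤ p i / h + (j p : ℝ) / (n + 1) := Int.floor_le _
    rw [abs_of_nonneg (sub_nonneg.2 h2)] at h1
    linarith
  have hr2 : ∀ p i, p i / h + (j p : ℝ) / (n + 1) < r p i + 1 := fun p i => Int.lt_floor_add_one _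
  have key : ∀ p q, (∀ i, |p i - q i| < h / (2 * ((n : ℝ) + 1))) → j p ≤ j q →
      ∀ i, r p i ≤ r q i ∧ r q i ≤ r p i + 1 := by
    intro p q hpq hjj i
    have h1 : |p i / h - q i / h| < 1 / (2 * ((n : ℝ) + 1)) := by
      rw [← sub_div, abs_div, abs_of_pos hh, div_lt_iff₀ hh]
      refine (hpq i).trans_eq ?_
      ring
    rw [abs_lt] at h1
    have h2 : (j p : ℝ) / (n + 1) ≤ (j q : ℝ) / (n + 1) := by
      gcongr
      exact_mod_cast hjj
    have h3 : (j q : ℝ) / (n + 1) ≤ (j p : ℝ) / (n + 1) + 1 := by linarith [hj1 q, hj0 p]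
    constructor
    · refine Int.le_floor.2 ?_
      linarith [hr1 p i]
    · have : (r q i : ℝ) < r p i + 2 := by linarith [hr1 q i, hr2 p i]
      have : r q i < r p i + 2 := by exact_mod_cast this
      omega
  refine ⟨r, fun p i => ?_, fun p q hpq => ?_⟩
  · have h1 : h * (p i / h) = p i := by field_simp
    have h0 : (0 : ℝ) ≤ 1 / (2 * ((n : ℝ) + 1)) := by positivity
    have h2 : h * r p i ≤ h * (p i / h + 1) := by
      gcongr
      linarith [hr1 p i, hj1 p]
    have h3 : h * (p i / h - 1) ≤ h * r p i := by
      gcongr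
      linarith [hr2 p i, hj0 p]
    rw [abs_le]
    constructor <;> linarith
  · rcases le_total (j p) (j q) with h | h
    · exact Or.inl (key p q hpq h)
    · exact Or.inr (key q p (fun i => by rw [abs_sub_comm]; exact hpq i) h)

end Rounding

section Decomposition

lemma isCell_ball {n : ℕ} (c : Fin n → ℝ) {r : ℝ} (hr : 0 < r) : IsCell n (ball c r) := by
  refine ⟨OpenPartialHomeomorph.univBall c r, OpenPartialHomeomorph.isOpenEmbedding _
    (OpenPartialHomeomorph.univBall_source c r), ?_⟩
  rw [← OpenPartialHomeomorph.univBall_target c hr,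
    ← OpenPartialHomeomorph.image_source_eq_target, OpenPartialHomeomorph.univBall_source,
    Set.image_univ]

/-- The cochain which is one on `T` and zero on other simplices. -/
def single {X : Type*} [DecidableEq X] (T : Finset X) (s : Finset X) : ZMod 2 :=
  if s = T then 1 else 0

lemma exists_fine_decomposition {n : ℕ} {ι : Type*} {I : Set ι} {O : ι → Set (Fin n → ℝ)}
    (hO : ∀ i ∈ I, IsOpen (O i)) {f : Finset (Fin n → ℝ) → ZMod 2}
    (hf : f ∈ cocyc n (⋃ i ∈ I, O i)) :
    ∃ (J : Finset (Finset (Fin n → ℤ))) (g : Finset (Fin n → ℤ) → Finset (Fin n → ℝ) → ZMod 2)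
      (e : Finset (Fin n → ℝ) → ZMod 2), e ∈ csupp n (⋃ i ∈ I, O i) ∧ e ∅ = 0 ∧
      f + cobd e + ∑ T ∈ J, g T ∈ zer (Fin n → ℝ) (n + 1) ∧
      ∀ T ∈ J, ∃ i ∈ I, ∃ Q ⊆ O i, IsCell n Q ∧ g T ∈ cocyc n Q ∧ g T ∅ = 0 := by
  obtain ⟨⟨K, hKO, hK, hKf⟩, hfc⟩ := hf
  obtain ⟨δ, hδ, hδO⟩ := lebesgue_number_lemma_of_metric (ι := I) hK (fun i => hO i i.2)
    (hKO.trans (by rw [Set.biUnion_eq_iUnion]))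
  set ε := δ / 4 with hε
  have hε0 : 0 < ε := by positivity
  set K' := cthickening ε K with hK'def
  have hK' : IsCompact K' := hK.cthickening
  have hnear : ∀ {ε'}, 0 ≤ ε' → ∀ x ∈ cthickening ε' K, ∃ c ∈ K, dist x c ≤ ε' := by
    intro ε' hε' x hx
    rw [hK.cthickening_eq_biUnion_closedBall hε'] at hx
    simpa using hx
  set f' := restr K' f with hf'
  have hff' : f + f' ∈ zer (Fin n → ℝ) (n + 1) := add_restr_mem_zer
    ((self_subset_thickening hε0 K).trans
      (interior_maximal (thickening_subset_cthickening ε K) isOpen_thickening)) hKf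
  have hf'0 : ∀ t : Finset (Fin n → ℝ), ∀ p ∈ t, p ∉ K' → f' t = 0 :=
    fun t p hp h => restr_eq_zero_of_mem hp h
  have hf'c : cobd f' ∈ zer (Fin n → ℝ) (n + 1 + 1) := by
    have h1 : cobd f' = cobd (f + f') + cobd f := by
      rw [cobd_add, add_comm (cobd f), add_assoc, cochain_add_self, add_zero]
    rw [h1]
    exact add_mem (cobd_mem_zer hff') hfc
  obtain ⟨η, hη, hu⟩ := exists_uniform_cobd (A := Set.univ) (v := f') hK'
    (fun t _ hc hd => by
      have hne : t.Nonempty := by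
        rw [← Finset.card_pos, hc]
        omega
      obtain ⟨p, hp⟩ := hne
      exact hf'0 t p hp fun h => Set.disjoint_left.1 hd hp h) hf'c
  obtain ⟨h, hh, hhε, hhη⟩ : ∃ h : ℝ, 0 < h ∧ h ≤ ε ∧ 4 * h < η :=
    ⟨min ε (η / 8), by positivity, min_le_left _ _, by linarith [min_le_right ε (η / 8)]⟩
  obtain ⟨r, hr1, hr2⟩ := exists_rounding (n := n) hh
  let τ₀ : (Fin n → ℤ) → Fin n → ℝ := fun a i => h * a i
  have hτr : ∀ p, dist (τ₀ (r p)) p ≤ h := fun p =>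
    (dist_pi_le_iff hh.le).2 fun i => by
      rw [Real.dist_eq]
      exact hr1 p i
  set θ := h / (2 * ((n : ℝ) + 1)) with hθ
  have hθ0 : 0 < θ := by positivity
  have hθh : θ ≤ h := by
    rw [hθ]
    exact div_le_self hh.le (by linarith [(Nat.cast_nonneg n : (0 : ℝ) ≤ n)])
  have hfine : ∀ p : Fin n → ℝ, ∀ᶠ s : Finset (Fin n → ℝ) in sm p,
      ∀ x ∈ s, ∀ y ∈ s, dist x y < θ := by
    intro p
    filter_upwards [eventually_sm_subset_of_mem (ball_mem_nhds p (half_pos hθ0))] with s hs x hx y hy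
    have h1 : dist x p < θ / 2 := hs hx
    have h2 : dist y p < θ / 2 := hs hy
    linarith [dist_triangle_right x y p]
  have hstair : ∀ s : Finset (Fin n → ℝ), (∀ x ∈ s, ∀ y ∈ s, dist x y < θ) →
      (s.image r).card ≤ n + 1 := by
    intro s hs
    refine card_le_of_stair fun a ha b hb => ?_
    obtain ⟨x, hx, rfl⟩ := Finset.mem_image.1 ha
    obtain ⟨y, hy, rfl⟩ := Finset.mem_image.1 hb
    refine hr2 x y fun i => ?_
    rw [← Real.dist_eq]
    exact (dist_le_pi_dist x y i).trans_lt (hs x hx y hy)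
  set F := pull τ₀ f' with hF
  obtain ⟨R, hR⟩ := hK'.isBounded.exists_norm_le
  obtain ⟨M, hM⟩ := exists_nat_gt (R / h)
  let A : Finset (Fin n → ℤ) := Finset.Icc (fun _ => -(M : ℤ)) fun _ => (M : ℤ)
  have hA : ∀ a, τ₀ a ∈ K' → a ∈ A := by
    intro a ha
    have h1 : ∀ i, |a i| ≤ M := by
      intro i
      have h2 := (norm_le_pi_norm (τ₀ a) i).trans (hR _ ha)
      simp only [τ₀, norm_mul, Real.norm_eq_abs, abs_of_pos hh] at h2
      rw [div_lt_iff₀ hh] at hM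
      have h3 : h * |(a i : ℝ)| < h * M := by linarith
      have h4 := lt_of_mul_lt_mul_left h3 hh.le
      exact_mod_cast h4.le
    exact Finset.mem_Icc.2 ⟨fun i => (abs_le.1 (h1 i)).1, fun i => (abs_le.1 (h1 i)).2⟩
  have hFK : ∀ T, F T ≠ 0 → ∀ a ∈ T, τ₀ a ∈ K' := by
    intro T hT a ha
    by_contra hcon
    exact hT (pull_eq_zero_of_mem (B := K'ᶜ) ha hcon fun t q hq hqK => hf'0 t q hq hqK)
  let J := A.powerset.filter fun T => T.card = n + 1 ∧ F T ≠ 0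
  let e : Finset (Fin n → ℝ) → ZMod 2 := fun s => ev f' (homotopy id (τ₀ ∘ r) (simplex s))
  have he0 : e ∅ = 0 := by simp only [e, homotopy_empty, map_zero]
  refine ⟨J, fun T => pull r (single T), e, ⟨cthickening (2 * ε) K, ?_, hK.cthickening, ?_⟩, he0,
    mem_zer.2 fun p => ?_, ?_⟩
  · intro x hx
    obtain ⟨c, hc, hxc⟩ := hnear (by positivity) x hx
    obtain ⟨i, hi⟩ := hδO c hc
    exact Set.mem_biUnion i.2 (hi (lt_of_le_of_lt hxc (by linarith)))
  · intro p hp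
    rw [mem_van]
    filter_upwards [eventually_sm_subset_of_mem (isClosed_cthickening.isOpen_compl.mem_nhds hp)]
      with s hs hk
    refine ev_eq_zero ?_ (homotopy_simplex_mem _ _ s)
    rintro t ⟨ht, htc⟩
    have hne : t.Nonempty := by
      rw [← Finset.card_pos, htc]
      omega
    obtain ⟨a, ha⟩ := hne
    refine hf'0 t a ha fun haK => ?_
    obtain ⟨c, hc, hac⟩ := hnear hε0.le a haK
    obtain ⟨x, hx, hxa⟩ : ∃ x ∈ s, dist x a ≤ h := by
      have := ht ha
      rw [Finset.mem_union, Finset.mem_image, Finset.mem_image] at this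
      rcases this with ⟨x, hx, rfl⟩ | ⟨x, hx, rfl⟩
      · exact ⟨x, hx, by simp [hh.le]⟩
      · exact ⟨x, hx, by rw [dist_comm]; exact hτr x⟩
    refine hs hx (mem_cthickening_of_dist_le x c _ _ hc ?_)
    linarith [dist_triangle x a c]
  · have h1 : cobd e + f' + pull r F ∈ van (n + 1) p := by
      rw [mem_van]
      filter_upwards [hfine p] with s hs hk
      have h2 : cobd e s = f' s + pull r F s + 0 := by
        rw [cobd_ev_homotopy, pull_id, hF, pull_pull]
        congr 1
        refine ev_eq_zero ?_ (homotopy_simplex_mem _ _ s)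
        rintro t ⟨ht, htc⟩
        refine hu t (Set.subset_univ _) (by rw [htc, hk]) ?_
        have key : ∀ a ∈ t, ∃ x ∈ s, dist a x ≤ h := by
          intro a ha
          have := ht ha
          rw [Finset.mem_union, Finset.mem_image, Finset.mem_image] at this
          rcases this with ⟨x, hx, rfl⟩ | ⟨x, hx, rfl⟩
          · exact ⟨x, hx, by simp [hh.le]⟩
          · exact ⟨x, hx, hτr x⟩
        intro a ha b hb
        obtain ⟨x, hx, hax⟩ := key a ha
        obtain ⟨y, hy, hby⟩ := key b hb
        have h5 := dist_triangle4 a x y b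
        rw [dist_comm y b] at h5
        linarith [hs x hx y hy]
      rw [Pi.add_apply, Pi.add_apply, h2]
      linear_combination ZModModule.add_self (f' s) + ZModModule.add_self (pull r F s)
    have h2 : pull r F + ∑ T ∈ J, pull r (single T) ∈ van (n + 1) p := by
      rw [mem_van]
      filter_upwards [hfine p] with s hs hk
      rw [Pi.add_apply, Finset.sum_apply]
      by_cases hinj : Set.InjOn r s
      · simp only [pull_of_injOn _ hinj, single]
        rw [Finset.sum_ite_eq]
        by_cases hFs : F (s.image r) = 0
        · rw [if_neg, hFs, add_zero]
          intro hJ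
          exact (Finset.mem_filter.1 hJ).2.2 hFs
        · rw [if_pos]
          · generalize F (s.image r) = y at hFs
            revert y
            decide
          · refine Finset.mem_filter.2 ⟨Finset.mem_powerset.2 fun a ha => hA a (hFK _ hFs a ha),
              ?_, hFs⟩
            rw [Finset.card_image_of_injOn hinj, hk]
      · simp [pull_of_not_injOn _ hinj]
    have : f + cobd e + ∑ T ∈ J, pull r (single T) = (f + f') + (cobd e + f' + pull r F) +
        (pull r F + ∑ T ∈ J, pull r (single T)) := by
      ext s
      simp only [Pi.add_apply]
      linear_combination -ZModModule.add_self (f' s) - ZModModule.add_self (pull r F s)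
    rw [this]
    exact add_mem (add_mem (mem_zer.1 hff' p) h1) h2
  · intro T hT
    obtain ⟨hTA, hTc, hTF⟩ := Finset.mem_filter.1 hT
    have hne : T.Nonempty := by
      rw [← Finset.card_pos, hTc]
      omega
    obtain ⟨a, ha⟩ := hne
    obtain ⟨c, hc, hac⟩ := hnear hε0.le _ (hFK T hTF a ha)
    obtain ⟨i, hi⟩ := hδO c hc
    refine ⟨i, i.2, ball c δ, hi, isCell_ball c hδ, ⟨⟨closedBall (τ₀ a) h, fun x hx => ?_,
      isCompact_closedBall _ _, fun p hp => ?_⟩, mem_zer.2 fun p => ?_⟩, ?_⟩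
    · have hx : dist x (τ₀ a) ≤ h := hx
      have := dist_triangle x (τ₀ a) c
      refine mem_ball.2 ?_
      linarith
    · rw [mem_van]
      filter_upwards [eventually_sm_subset_of_mem (isClosed_closedBall.isOpen_compl.mem_nhds hp)]
        with s hs hk
      by_cases hinj : Set.InjOn r s
      · rw [pull_of_injOn _ hinj, single, if_neg]
        rintro rfl
        obtain ⟨x, hx, rfl⟩ := Finset.mem_image.1 ha
        refine hs hx ?_
        rw [mem_closedBall, dist_comm]
        exact hτr x
      · exact pull_of_not_injOn _ hinj
    · rw [mem_van, cobd_pull]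
      filter_upwards [hfine p] with s hs hk
      refine pull_of_not_injOn _ fun hinj => ?_
      have := hstair s hs
      rw [Finset.card_image_of_injOn hinj, hk] at this
      omega
    · change pull r (single T) ∅ = 0
      rw [pull_empty, single, if_neg]
      rintro rfl
      simp at ha

end Decomposition

section Global

variable {X Y : Type*} [DecidableEq X] [DecidableEq Y] [TopologicalSpace X] [TopologicalSpace Y]

lemma csupp_inter [T2Space X] {k : ℕ} {O O' : Set X} {u : Finset X → ZMod 2}
    (h : u ∈ csupp k O) (h' : u ∈ csupp k O') : u ∈ csupp k (O ∩ O') := by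
  obtain ⟨K, h1, h2, h3⟩ := h
  obtain ⟨K', h1', h2', h3'⟩ := h'
  refine ⟨K ∩ K', Set.inter_subset_inter h1 h1', h2.inter h2', fun p hp => ?_⟩
  by_cases hK : p ∈ K
  · exact h3' p fun h => hp ⟨hK, h⟩
  · exact h3 p hK

lemma mem_zer_of_pull {ψ : Y → X} (hψ : IsOpenEmbedding ψ) {k : ℕ} {u : Finset X → ZMod 2}
    (hu : u ∈ csupp k (Set.range ψ)) (h : pull ψ u ∈ zer Y k) : u ∈ zer X k := by
  refine mem_zer.2 fun p => ?_
  by_cases hp : p ∈ Set.range ψ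
  · obtain ⟨q, rfl⟩ := hp
    exact (pull_mem_van_iff hψ).1 (mem_zer.1 h q)
  · exact van_of_notMem_of_mem_csupp hu hp

lemma pull_sum {ι : Type*} (ψ : Y → X) (I : Finset ι) (u : ι → Finset X → ZMod 2) :
    pull ψ (∑ i ∈ I, u i) = ∑ i ∈ I, pull ψ (u i) := by
  classical
  induction I using Finset.induction_on with
  | empty =>
    ext s
    by_cases h : Set.InjOn ψ s
    · simp [pull_of_injOn _ h]
    · simp [pull_of_not_injOn _ h]
  | insert a I ha ih => rw [Finset.sum_insert ha, Finset.sum_insert ha, pull_add, ih]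

lemma exists_sum_eq_sum {A ι κ : Type*} [AddCommGroup A] (G : ι → AddSubgroup A) (I : Finset ι)
    (J : Finset κ) (g : κ → A) (hg : ∀ T ∈ J, ∃ i ∈ I, g T ∈ G i) :
    ∃ h : ι → A, (∀ i, h i ∈ G i) ∧ ∑ T ∈ J, g T = ∑ i ∈ I, h i := by
  classical
  induction J using Finset.induction_on with
  | empty => exact ⟨0, fun i => zero_mem _, by simp⟩
  | insert a J ha ih =>
    obtain ⟨h, h1, h2⟩ := ih fun T hT => hg T (Finset.mem_insert_of_mem hT)
    obtain ⟨i, hi, hgi⟩ := hg a (Finset.mem_insert_self _ _)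
    refine ⟨Pi.single i (g a) + h, fun j => add_mem ?_ (h1 j), ?_⟩
    · by_cases hj : j = i
      · subst hj
        simpa using hgi
      · simp [hj]
    · rw [Finset.sum_insert ha, h2]
      simp [Finset.sum_add_distrib, Finset.sum_pi_single', hi]

variable [T2Space X] {n : ℕ}

lemma IsCell.add_mem_null_iff {Q : Set X} (h : IsCell n Q) {f g : Finset X → ZMod 2}
    (hf : f ∈ cocyc n Q) (hg : g ∈ cocyc n Q) :
    f + g ∈ null n Q ↔ (f ∈ null n Q ↔ g ∈ null n Q) := by
  refine ⟨mem_null_iff_of_add_mem_null, fun hfg => ?_⟩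
  by_cases h1 : f ∈ null n Q
  · exact add_mem h1 (hfg.1 h1)
  · exact h.add_mem_null hf hg h1 fun h2 => h1 (hfg.2 h2)

/-- Cocycles in the intersection of two cells which have the same class in both. -/
def agree {B O : Set X} (hB : IsCell n B) (hO : IsCell n O) :
    AddSubgroup (Finset X → ZMod 2) where
  carrier := {h | h ∈ cocyc n (B ∩ O) ∧ (h ∈ null n B ↔ h ∈ null n O)}
  zero_mem' := ⟨zero_mem _, iff_of_true (zero_mem _) (zero_mem _)⟩
  add_mem' := by
    rintro f g ⟨h1, h2⟩ ⟨h3, h4⟩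
    refine ⟨add_mem h1 h3, ?_⟩
    rw [hB.add_mem_null_iff (cocyc_mono Set.inter_subset_left h1)
      (cocyc_mono Set.inter_subset_left h3), hO.add_mem_null_iff
      (cocyc_mono Set.inter_subset_right h1) (cocyc_mono Set.inter_subset_right h3), h2, h4]
  neg_mem' := by
    rintro f ⟨h1, h2⟩
    exact ⟨neg_mem h1, by rw [neg_mem_iff, neg_mem_iff, h2]⟩

lemma IsCell.exists_agree_decomposition [LocallyCompactSpace X] (hn : 0 < n) {B : Set X}
    (hB : IsCell n B) {ι : Type*} (I : Finset ι) {O : ι → Set X} (hO : ∀ i, IsCell n (O i))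
    {f : Finset X → ZMod 2} (hf : f ∈ cocyc n B) (hf' : f ∈ csupp (n + 1) (⋃ i ∈ I, O i)) :
    ∃ h : ι → Finset X → ZMod 2, (∀ i ∈ I, h i ∈ agree hB (hO i)) ∧
      f + ∑ i ∈ I, h i ∈ zer X (n + 1) := by
  have hB' := hB
  obtain ⟨ψ, hψ, hψB⟩ := hB'
  have himg : ψ '' (⋃ i ∈ (I : Set ι), ψ ⁻¹' O i) = ⋃ i ∈ I, B ∩ O i := by
    simp only [Set.image_iUnion, Set.image_preimage_eq_inter_range, hψB, Finset.mem_coe,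
      Set.inter_comm]
  have hfU : f ∈ cocyc n (ψ '' (⋃ i ∈ (I : Set ι), ψ ⁻¹' O i)) := by
    rw [himg, ← Set.inter_iUnion₂]
    exact ⟨csupp_inter hf.1 hf', hf.2⟩
  obtain ⟨J, g, e, he, he0, hsum, hg⟩ := exists_fine_decomposition
    (fun i _ => (hO i).isOpen.preimage hψ.continuous) (pull_mem_cocyc_of_isOpenEmbedding hψ hfU)
  obtain ⟨e', he', he0', hee'⟩ := exists_extension hψ he he0
  have hg' : ∀ T, ∃ u : Finset X → ZMod 2, T ∈ J → (∃ i ∈ I, u ∈ agree hB (hO i)) ∧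
      pull ψ u + g T ∈ zer _ (n + 1) := by
    intro T
    by_cases hT : T ∈ J
    swap
    · exact ⟨0, fun h => absurd h hT⟩
    obtain ⟨i, hi, Q, hQ, hQc, hgT, hg0⟩ := hg T hT
    obtain ⟨u, hu, hu0, hug⟩ := exists_extension hψ hgT.1 hg0
    refine ⟨u, fun _ => ⟨⟨i, hi, ?_⟩, hug⟩⟩
    have hcell : IsCell n (ψ '' Q) := by
      obtain ⟨φ, hφ, rfl⟩ := hQc
      exact ⟨ψ ∘ φ, hψ.comp hφ, Set.range_comp _ _⟩
    have hQB : ψ '' Q ⊆ B := hψB ▸ Set.image_subset_range _ _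
    have hQO : ψ '' Q ⊆ O i := Set.image_subset_iff.2 hQ
    have huc : u ∈ cocyc n (ψ '' Q) := by
      refine ⟨hu, mem_zer_of_pull hψ (cobd_mem_csupp (csupp_mono (Set.image_subset_range _ _) hu)) ?_⟩
      have h1 := cobd_mem_zer hug
      rw [cobd_add, cobd_pull] at h1
      exact (add_mem_cancel_right hgT.2).1 h1
    refine ⟨cocyc_mono (Set.subset_inter hQB hQO) huc, ?_, ?_⟩
    · exact fun h => null_mono hQO (hB.mem_null_of_subset hcell hQB huc h)
    · exact fun h => null_mono hQB ((hO i).mem_null_of_subset hcell hQO huc h)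
  choose g' hg' using hg'
  obtain ⟨h₁, hh₁, hsum₁⟩ := exists_sum_eq_sum (fun i => agree hB (hO i)) I J g'
    fun T hT => (hg' T hT).1
  rw [himg] at he'
  obtain ⟨e₁, he₁, he₁0, hesum⟩ := exists_partition hn I (fun i => B ∩ O i)
    (fun i _ => hB.isOpen.inter (hO i).isOpen) he'
  refine ⟨fun i => h₁ i + cobd (e₁ i), fun i hi => add_mem (hh₁ i) ⟨cobd_mem_cocyc (he₁ i hi),
    iff_of_true ?_ ?_⟩, ?_⟩
  · exact cobd_mem_null (csupp_mono Set.inter_subset_left (he₁ i hi)) (he₁0 i)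
  · exact cobd_mem_null (csupp_mono Set.inter_subset_right (he₁ i hi)) (he₁0 i)
  have hkey : f + cobd e' + ∑ i ∈ I, h₁ i ∈ zer X (n + 1) := by
    refine mem_zer_of_pull hψ (add_mem (add_mem ?_ ?_) (sum_mem fun i hi => ?_)) ?_
    · exact hψB ▸ hf.1
    · exact hψB ▸ csupp_mono (Set.iUnion₂_subset fun i _ => Set.inter_subset_left)
        (cobd_mem_csupp he')
    · exact hψB ▸ csupp_mono Set.inter_subset_left (hh₁ i).1.1
    · have h1 := cobd_mem_zer hee'
      rw [cobd_add, cobd_pull] at h1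
      have h2 : ∑ T ∈ J, (pull ψ (g' T) + g T) ∈ zer _ (n + 1) := sum_mem fun T hT => (hg' T hT).2
      rw [Finset.sum_add_distrib] at h2
      rw [← hsum₁, pull_add, pull_add, pull_sum]
      have := add_mem (add_mem hsum h1) h2
      convert this using 1
      ext s
      simp only [Pi.add_apply]
      linear_combination -ZModModule.add_self (cobd e s) - ZModModule.add_self ((∑ T ∈ J, g T) s)
  have h1 := cobd_mem_zer hesum
  rw [cobd_add, cobd_sum] at h1
  rw [Finset.sum_add_distrib]
  have := add_mem hkey h1
  convert this using 1
  ext s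
  simp only [Pi.add_apply]
  linear_combination -ZModModule.add_self (cobd e' s)

open scoped Classical in
/-- The class of a cocycle supported in a cell. -/
noncomputable def cls (n : ℕ) (Q : Set X) (f : Finset X → ZMod 2) : ZMod 2 :=
  if f ∈ null n Q then 0 else 1

lemma cls_eq_zero_iff {Q : Set X} {f : Finset X → ZMod 2} : cls n Q f = 0 ↔ f ∈ null n Q := by
  unfold cls
  split_ifs with h <;> simp [h]

lemma cls_congr {Q Q' : Set X} {f f' : Finset X → ZMod 2} (h : f ∈ null n Q ↔ f' ∈ null n Q') :
    cls n Q f = cls n Q' f' := by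
  unfold cls
  by_cases hf : f ∈ null n Q
  · rw [if_pos hf, if_pos (h.1 hf)]
  · rw [if_neg hf, if_neg fun hf' => hf (h.2 hf')]

lemma IsCell.cls_add {Q : Set X} (h : IsCell n Q) {f g : Finset X → ZMod 2}
    (hf : f ∈ cocyc n Q) (hg : g ∈ cocyc n Q) : cls n Q (f + g) = cls n Q f + cls n Q g := by
  unfold cls
  by_cases h1 : f ∈ null n Q <;> by_cases h2 : g ∈ null n Q <;>
    simp [h.add_mem_null_iff hf hg, h1, h2]
  decide

lemma IsCell.cls_sum {ι : Type*} {Q : Set X} (h : IsCell n Q) (I : Finset ι)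
    {f : ι → Finset X → ZMod 2} (hf : ∀ i ∈ I, f i ∈ cocyc n Q) :
    cls n Q (∑ i ∈ I, f i) = ∑ i ∈ I, cls n Q (f i) := by
  classical
  induction I using Finset.induction_on with
  | empty => simpa using cls_eq_zero_iff.2 (zero_mem (null n Q))
  | insert a I ha ih =>
    have hf' : ∀ i ∈ I, f i ∈ cocyc n Q := fun i hi => hf i (Finset.mem_insert_of_mem hi)
    rw [Finset.sum_insert ha, Finset.sum_insert ha,
      h.cls_add (hf a (Finset.mem_insert_self _ _)) (sum_mem hf'), ih hf']

lemma sum_cls_eq_zero [LocallyCompactSpace X] (hn : 0 < n) {ι : Type*} (I : Finset ι)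
    {B : ι → Set X} (hB : ∀ i, IsCell n (B i)) (f : ι → Finset X → ZMod 2)
    (hf : ∀ i ∈ I, f i ∈ cocyc n (B i)) (hsum : ∑ i ∈ I, f i ∈ zer X (n + 1)) :
    ∑ i ∈ I, cls n (B i) (f i) = 0 := by
  classical
  induction I using Finset.induction_on generalizing f with
  | empty => simp
  | insert a I ha ih =>
    rw [Finset.sum_insert ha] at hsum ⊢
    have hfa := hf a (Finset.mem_insert_self _ _)
    have hf' : ∀ i ∈ I, f i ∈ cocyc n (B i) := fun i hi => hf i (Finset.mem_insert_of_mem hi)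
    have hsupp : f a ∈ csupp (n + 1) (⋃ i ∈ I, B i) :=
      (add_mem_cancel_right (sum_mem fun i hi =>
        csupp_mono (Set.subset_biUnion_of_mem (u := B) hi) (hf' i hi).1)).1 (zer_le_csupp hsum)
    obtain ⟨h, hh, hsum'⟩ := (hB a).exists_agree_decomposition hn I hB hfa hsupp
    have hhB : ∀ i ∈ I, h i ∈ cocyc n (B i) := fun i hi =>
      cocyc_mono Set.inter_subset_right (hh i hi).1
    have hha : ∀ i ∈ I, h i ∈ cocyc n (B a) := fun i hi =>
      cocyc_mono Set.inter_subset_left (hh i hi).1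
    have key := ih (fun i => f i + h i) (fun i hi => add_mem (hf' i hi) (hhB i hi)) (by
      rw [Finset.sum_add_distrib]
      convert add_mem hsum hsum' using 1
      ext s
      simp only [Pi.add_apply]
      linear_combination -ZModModule.add_self (f a s))
    rw [Finset.sum_congr rfl fun i hi => (hB i).cls_add (hf' i hi) (hhB i hi),
      Finset.sum_add_distrib] at key
    rw [← Finset.sum_congr rfl fun i hi => cls_congr (hh i hi).2, ← (hB a).cls_sum I hha,
      ← cls_congr (mem_null_iff_of_add_mem_null (zer_le_null hsum'))] at key
    rw [add_comm, key]

lemma notMem_null_univ [CompactSpace X] (hn : 0 < n) (hcell : ∀ x : X, ∃ Q, IsCell n Q ∧ x ∈ Q)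
    {Q : Set X} (hQ : IsCell n Q) {u : Finset X → ZMod 2} (hu : u ∈ cocyc n Q)
    (huQ : u ∉ null n Q) : u ∉ null n Set.univ := by
  rintro ⟨e, he, he0, h⟩
  choose B hB hxB using hcell
  obtain ⟨I, hI⟩ := isCompact_univ.elim_finite_subcover B (fun x => (hB x).isOpen)
    fun x _ => Set.mem_iUnion.2 ⟨x, hxB x⟩
  obtain ⟨f, hf, hf0, hsum⟩ := exists_partition hn I B (fun i _ => (hB i).isOpen)
    (csupp_mono hI he)
  let B' : Option X → Set X := fun o => o.elim Q B
  let f' : Option X → Finset X → ZMod 2 := fun o => o.elim u fun x => cobd (f x)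
  have hB' : ∀ o, IsCell n (B' o) := by
    rintro (_ | x)
    · exact hQ
    · exact hB x
  have key := sum_cls_eq_zero hn I.insertNone hB' f' (by
    rintro (_ | x) ho
    · exact hu
    · exact cobd_mem_cocyc (hf x (Finset.some_mem_insertNone.1 ho))) (by
    rw [Finset.sum_insertNone]
    have h1 := cobd_mem_zer hsum
    rw [cobd_add, cobd_sum] at h1
    convert add_mem h h1 using 1
    ext s
    simp only [f', Pi.add_apply, Option.elim]
    linear_combination -ZModModule.add_self (cobd e s))
  rw [Finset.sum_insertNone, Finset.sum_eq_zero, add_zero] at key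
  · exact huQ (cls_eq_zero_iff.1 key)
  · intro x hx
    exact cls_eq_zero_iff.2 (cobd_mem_null (hf x hx) (hf0 x))

/-- The point classes of a compact connected manifold. -/
theorem exists_point_class [CompactSpace X] [ConnectedSpace X] (hn : 0 < n)
    (hcell : ∀ x : X, ∃ Q, IsCell n Q ∧ x ∈ Q) :
    ∃ u : X → Finset X → ZMod 2, (∀ p, ∀ q ≠ p, u p ∈ van (n + 1) q) ∧
      (∀ p, u p ∉ null n Set.univ) ∧ ∀ p q, u p + u q ∈ null n Set.univ := by
  choose Q hQ hxQ using hcell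
  choose u hu1 hu2 hu3 using fun p => (hQ p).exists_gen (hxQ p)
  have hcoc : ∀ p, ∀ O : Set X, p ∈ O → u p ∈ cocyc n O := fun p O hp =>
    ⟨⟨{p}, Set.singleton_subset_iff.2 hp, isCompact_singleton, hu1 p⟩, hu2 p⟩
  have hnull : ∀ p, u p ∉ null n Set.univ := fun p =>
    notMem_null_univ hn (fun x => ⟨Q x, hQ x, hxQ x⟩) (hQ p) (hcoc p _ (hxQ p)) (hu3 p)
  refine ⟨u, hu1, hnull, fun p q => ?_⟩
  have : Std.Symm fun p q => u p + u q ∈ null n (Set.univ : Set X) :=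
    ⟨fun p q h => by rwa [add_comm]⟩
  refine PreconnectedSpace.induction₂ (fun p q => u p + u q ∈ null n Set.univ) (fun p => ?_)
    ⟨fun p q r h1 h2 => ?_⟩ p q
  · filter_upwards [(hQ p).isOpen.mem_nhds (hxQ p)] with q hq
    exact null_mono (Set.subset_univ _) ((hQ p).add_mem_null (hcoc p _ (hxQ p)) (hcoc q _ hq)
      (hu3 p) fun h => hnull q (null_mono (Set.subset_univ _) h))
  · convert add_mem h1 h2 using 1
    ext s
    simp only [Pi.add_apply]
    linear_combination -ZModModule.add_self (u q s)

end Global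

section Radii

open scoped NNReal ENNReal

variable {M : Type*} [MetricSpace M] [MeasurableSpace M] [BorelSpace M]

lemma lipschitzWith_dist_pi {κ : Type*} [Fintype κ] (z : κ → M) :
    LipschitzWith 1 fun p : M => fun j => dist p (z j) :=
  LipschitzWith.of_dist_le_mul fun p q => by
    rw [NNReal.coe_one, one_mul, dist_pi_le_iff dist_nonneg]
    exact fun j => by simpa [Real.dist_eq] using abs_dist_sub_le p q (z j)

lemma volume_radii_le {ι : Type*} [Fintype ι] (z : ι → M) {ε : ℝ}
    (S : Set M) (P : ι → Prop) [DecidablePred P] {k : ℕ} (hk : Fintype.card {i // P i} = k) :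
    volume {t : ι → ℝ | (∀ i, t i ∈ Set.Ioo ε (2 * ε)) ∧
        ∃ p ∈ S, ∀ i, P i → dist p (z i) = t i} ≤
      μH[(k : ℝ)] {p ∈ S | ∀ i, P i → dist p (z i) < 2 * ε} *
        ENNReal.ofReal ε ^ (Fintype.card ι - k) := by
  subst hk
  set A := {p ∈ S | ∀ i, P i → dist p (z i) < 2 * ε} with hA
  set g : M → ({i // P i} → ℝ) := fun p j => dist p (z j) with hg
  have h1 : {t : ι → ℝ | (∀ i, t i ∈ Set.Ioo ε (2 * ε)) ∧
      ∃ p ∈ S, ∀ i, P i → dist p (z i) = t i} ⊆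
      (MeasurableEquiv.piEquivPiSubtypeProd (fun _ : ι => ℝ) P) ⁻¹'
        ((g '' A) ×ˢ (Set.univ.pi fun _ : {i // ¬ P i} => Set.Ioo ε (2 * ε))) := by
    rintro t ⟨ht, p, hp, hpt⟩
    refine ⟨⟨p, ⟨hp, fun i hi => ?_⟩, ?_⟩, fun i _ => ht i⟩
    · rw [hpt i hi]
      exact (ht i).2
    · ext j
      exact hpt j j.2
  refine (measure_mono h1).trans ?_
  rw [(volume_preserving_piEquivPiSubtypeProd (fun _ : ι => ℝ) P).measure_preimage_equiv,
    Measure.volume_eq_prod, Measure.prod_prod, volume_pi_pi]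
  refine mul_le_mul' ?_ ?_
  · rw [← hausdorffMeasure_pi_real]
    have := (lipschitzWith_dist_pi fun j : {i // P i} => z j).hausdorffMeasure_image_le
      (d := (Fintype.card {i // P i} : ℝ)) (by positivity) A
    simpa using this
  · simp only [Real.volume_Ioo, Finset.prod_const, Finset.card_univ]
    rw [Fintype.card_subtype_compl]
    refine le_of_eq ?_
    congr 2
    ring

lemma exists_radii {D : ℕ} {ε : ℝ} (hε : 0 < ε) (I : Finset M)
    (hI : ∀ p : M, ∀ J ⊆ I, (∀ z ∈ J, dist p z < 2 * ε) → J.card ≤ D) (S : Set M) (m : ℕ)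
    (hS : 2 ^ D * μH[(m : ℝ)] S < ENNReal.ofReal ε ^ m) :
    ∃ t : M → ℝ, (∀ z, t z ∈ Set.Ioo ε (2 * ε)) ∧
      ∀ J ⊆ I, J.card = m → ∀ p ∈ S, ¬ ∀ z ∈ J, dist p z = t z := by
  classical
  by_cases hm : I.card < m
  · refine ⟨fun _ => 3 / 2 * ε, fun _ => ⟨by linarith, by linarith⟩, fun J hJ hJm => ?_⟩
    have := Finset.card_le_card hJ
    omega
  push Not at hm
  let 𝒥 : Finset (Finset I) := Finset.univ.powersetCard m
  let A : Finset I → Set M := fun J => {p | ∀ i ∈ J, dist p (i : M) < 2 * ε}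
  have hAo : ∀ J, IsOpen (A J) := by
    intro J
    have : A J = ⋂ i ∈ J, ball (i : M) (2 * ε) := by
      ext p
      simp [A]
    rw [this]
    exact isOpen_biInter_finset fun i _ => isOpen_ball
  let E : Finset I → Set (I → ℝ) := fun J =>
    {t | (∀ i, t i ∈ Set.Ioo ε (2 * ε)) ∧ ∃ p ∈ S, ∀ i ∈ J, dist p (i : M) = t i}
  have hcount : ∑ J ∈ 𝒥, μH[(m : ℝ)] (A J ∩ S) ≤ 2 ^ D * μH[(m : ℝ)] S := by
    have h1 : ∀ p, ∑ J ∈ 𝒥, (A J).indicator (1 : M → ℝ≥0∞) p ≤ 2 ^ D := by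
      intro p
      have h2 : ∑ J ∈ 𝒥, (A J).indicator (1 : M → ℝ≥0∞) p =
          ((𝒥.filter fun J => p ∈ A J).card : ℝ≥0∞) := by
        rw [Finset.card_filter]
        push_cast
        rw [Finset.sum_congr rfl]
        intro J _
        by_cases h : p ∈ A J
        · rw [Set.indicator_of_mem h, if_pos h, Pi.one_apply]
        · rw [Set.indicator_of_notMem h, if_neg h]
      have h3 : (𝒥.filter fun J => p ∈ A J) ⊆
          (Finset.univ.filter fun i : I => dist p (i : M) < 2 * ε).powerset := by
        intro J hJ
        refine Finset.mem_powerset.2 fun i hi => Finset.mem_filter.2 ⟨Finset.mem_univ _, ?_⟩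
        exact (Finset.mem_filter.1 hJ).2 i hi
      have h4 : (Finset.univ.filter fun i : I => dist p (i : M) < 2 * ε).card ≤ D := by
        rw [← Finset.card_map (Function.Embedding.subtype _)]
        refine hI p _ ?_ ?_
        · intro x hx
          obtain ⟨i, -, rfl⟩ := Finset.mem_map.1 hx
          exact i.2
        · intro x hx
          obtain ⟨i, hi, rfl⟩ := Finset.mem_map.1 hx
          exact (Finset.mem_filter.1 hi).2
      rw [h2]
      have h5 := Finset.card_le_card h3
      rw [Finset.card_powerset] at h5
      exact_mod_cast h5.trans (Nat.pow_le_pow_right (by norm_num) h4)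
    calc ∑ J ∈ 𝒥, μH[(m : ℝ)] (A J ∩ S)
        = ∑ J ∈ 𝒥, ∫⁻ p in S, (A J).indicator 1 p ∂μH[(m : ℝ)] := by
          refine Finset.sum_congr rfl fun J _ => ?_
          rw [lintegral_indicator_one (hAo J).measurableSet,
            Measure.restrict_apply (hAo J).measurableSet]
      _ = ∫⁻ p in S, ∑ J ∈ 𝒥, (A J).indicator 1 p ∂μH[(m : ℝ)] := by
          rw [lintegral_finsetSum]
          exact fun J _ => measurable_one.indicator (hAo J).measurableSet
      _ ≤ ∫⁻ _ in S, 2 ^ D ∂μH[(m : ℝ)] := lintegral_mono h1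
      _ = 2 ^ D * μH[(m : ℝ)] S := by simp
  have hvol : volume (⋃ J ∈ 𝒥, E J) < ENNReal.ofReal ε ^ I.card := by
    calc volume (⋃ J ∈ 𝒥, E J) ≤ ∑ J ∈ 𝒥, volume (E J) := measure_biUnion_finset_le _ _
      _ ≤ ∑ J ∈ 𝒥, μH[(m : ℝ)] (A J ∩ S) * ENNReal.ofReal ε ^ (I.card - m) := by
          refine Finset.sum_le_sum fun J hJ => ?_
          have hJm : J.card = m := (Finset.mem_powersetCard.1 hJ).2
          have := volume_radii_le (fun i : I => (i : M)) (ε := ε) S (· ∈ J)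
            (k := m) (by
              rw [← hJm]
              convert Fintype.card_coe J)
          rw [Fintype.card_coe] at this
          rwa [Set.inter_comm]
      _ = (∑ J ∈ 𝒥, μH[(m : ℝ)] (A J ∩ S)) * ENNReal.ofReal ε ^ (I.card - m) :=
          (Finset.sum_mul _ _ _).symm
      _ < ENNReal.ofReal ε ^ m * ENNReal.ofReal ε ^ (I.card - m) := by
          refine ENNReal.mul_lt_mul_left ?_ ?_ (hcount.trans_lt hS)
          · exact pow_ne_zero _ (by simpa using hε)
          · exact ENNReal.pow_ne_top ENNReal.ofReal_ne_top
      _ = ENNReal.ofReal ε ^ I.card := by rw [← pow_add, Nat.add_sub_cancel' hm]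
  have hQ : volume (Set.univ.pi fun _ : I => Set.Ioo ε (2 * ε)) = ENNReal.ofReal ε ^ I.card := by
    rw [volume_pi_pi]
    simp only [Real.volume_Ioo, Finset.prod_const, Finset.card_univ, Fintype.card_coe]
    congr 2
    ring
  obtain ⟨t, htQ, ht⟩ : ∃ t ∈ Set.univ.pi fun _ : I => Set.Ioo ε (2 * ε), t ∉ ⋃ J ∈ 𝒥, E J := by
    by_contra! hcon
    exact absurd (measure_mono (μ := volume) hcon) (not_le.2 (hQ ▸ hvol))
  refine ⟨fun z => if hz : z ∈ I then t ⟨z, hz⟩ else 3 / 2 * ε, fun z => ?_, ?_⟩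
  · dsimp only
    split_ifs with hz
    · exact htQ _ (Set.mem_univ _)
    · exact ⟨by linarith, by linarith⟩
  · intro J hJ hJm p hp h
    refine ht (Set.mem_biUnion (x := J.subtype (· ∈ I)) ?_
      ⟨fun i => htQ i (Set.mem_univ _), p, hp, ?_⟩)
    · refine Finset.mem_powersetCard.2 ⟨Finset.subset_univ _, ?_⟩
      rw [Finset.card_subtype, Finset.filter_true_of_mem fun x hx => hJ hx, hJm]
    · intro i hi
      refine (h i (Finset.mem_subtype.1 hi)).trans ?_
      exact dif_pos i.2

lemma exists_net {D : ℕ} [CompactSpace M] (hD : IsDoubling D M) {ε : ℝ} (hε : 0 < ε) :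
    ∃ I : Finset M, (∀ p : M, ∃ z ∈ I, dist p z < ε) ∧
      ∀ p : M, ∀ J ⊆ I, (∀ z ∈ J, dist p z < 2 * ε) → J.card ≤ D := by
  classical
  let Sep : Finset M → Prop := fun I => ∀ a ∈ I, ∀ b ∈ I, a ≠ b → ε ≤ dist a b
  obtain ⟨F, -, hF⟩ := isCompact_univ.elim_nhds_subcover (fun z : M => ball z (ε / 2))
    fun z _ => ball_mem_nhds z (by positivity)
  have hbdd : BddAbove {k | ∃ I : Finset M, Sep I ∧ I.card = k} := by
    refine ⟨F.card, ?_⟩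
    rintro _ ⟨I, hI, rfl⟩
    choose c hcF hc using fun p : M => Set.mem_iUnion₂.1 (hF (Set.mem_univ p))
    refine Finset.card_le_card_of_injOn c (fun a _ => hcF a) fun a ha b hb hab => ?_
    by_contra hne
    have h1 : dist a (c a) < ε / 2 := hc a
    have h2 : dist b (c b) < ε / 2 := hc b
    rw [← hab] at h2
    linarith [hI a ha b hb hne, dist_triangle_right a b (c a)]
  have hne : {k | ∃ I : Finset M, Sep I ∧ I.card = k}.Nonempty := ⟨0, ∅, by simp [Sep], rfl⟩
  obtain ⟨I, hI, hIc⟩ := Nat.sSup_mem hne hbdd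
  refine ⟨I, fun p => ?_, fun p J hJ hJp => ?_⟩
  · by_contra! hcon
    have hp : p ∉ I := fun hp => by
      have := hcon p hp
      rw [dist_self] at this
      linarith
    have hsep : Sep (insert p I) := by
      intro a ha b hb hab
      rcases Finset.mem_insert.1 ha with rfl | ha' <;> rcases Finset.mem_insert.1 hb with rfl | hb'
      · exact absurd rfl hab
      · exact hcon b hb'
      · rw [dist_comm]
        exact hcon a ha'
      · exact hI a ha' b hb' hab
    have hmem : (insert p I).card ∈ {k | ∃ I : Finset M, Sep I ∧ I.card = k} :=
      ⟨insert p I, hsep, rfl⟩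
    have := le_csSup hbdd hmem
    rw [← hIc, Finset.card_insert_of_notMem hp] at this
    omega
  · refine hD p (2 * ε) J (fun z hz => mem_ball'.2 (hJp z hz)) fun a ha b hb hab => ?_
    have := hI a (hJ ha) b (hJ hb) hab
    linarith

end Radii

section Filling

variable {M : Type*} [DecidableEq M] [MetricSpace M] [CompactSpace M]

lemma push_eq_zero_of_const {X Y : Type*} [DecidableEq X] [DecidableEq Y] {f : X → Y} {w : Y}
    {A : Set (Finset X)} (hA : ∀ s ∈ A, s.Nonempty ∧ ∀ a ∈ s, f a = w) {c : Chain X}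
    (hc : c ∈ chainsIn A) (hbd : bd c = 0) : push f c = 0 := by
  have h1 : push f c ∈ chainsIn {t : Finset Y | w ∈ t} := by
    refine map_mem_of_simplex _ _ (fun s hs => ?_) hc
    refine Finsupp.supported_mono ?_ (push_simplex_mem f s)
    rintro t ⟨rfl, -⟩
    obtain ⟨a, ha⟩ := (hA s hs).1
    exact Finset.mem_image.2 ⟨a, ha, (hA s hs).2 a ha⟩
  have h2 : cone w (push f c) = 0 :=
    map_eq_of_simplex (cone w) 0 (fun s hs => by rw [cone_simplex, if_pos (show w ∈ s from hs)]; rfl) h1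
  have h3 := bd_cone w (push f c)
  rwa [h2, bd_push, hbd, map_zero, map_zero, map_zero, add_zero, eq_comm] at h3

lemma exists_filling_at {L ρ η : ℝ} (hLLC : IsLLC L M) (z : M) (hρ : 0 < ρ)
    (hρd : ρ ≤ diam (Set.univ : Set M) / L) (hη : 0 < η) :
    ∃ δ > 0, ∀ (k : ℕ) (c : Chain M), 0 < k →
      c ∈ chainsIn {t | t.card = k ∧ (t : Set M) ⊆ ball z (ρ / 2) ∧
        ∀ a ∈ t, ∀ b ∈ t, dist a b < δ} → bd c = 0 →
      ∃ e ∈ chainsIn {t : Finset M | t.card = k + 1 ∧ (t : Set M) ⊆ ball z (L * ρ) ∧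
        ∀ a ∈ t, ∀ b ∈ t, dist a b < η}, bd e = c := by
  obtain ⟨h, hcont, h0, ⟨w, h1⟩, hball⟩ := hLLC z ρ hρ hρd
  have hsub : closedBall z (ρ / 2) ⊆ ball z ρ := closedBall_subset_ball (by linarith)
  have hunif := (isCompact_Icc.prod (isCompact_closedBall z (ρ / 2))).uniformContinuousOn_of_continuous
    (hcont.mono (Set.prod_mono_right hsub))
  obtain ⟨δ, hδ, hunif⟩ := Metric.uniformContinuousOn_iff.1 hunif η hη
  refine ⟨δ, hδ, fun k c hk hc hbd => ?_⟩
  obtain ⟨N, hN⟩ := exists_nat_one_div_lt hδ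
  let f : ℕ → M → M := fun i => h (i / (N + 1))
  have hN0 : (0 : ℝ) < N + 1 := by positivity
  have hicc : ∀ i ≤ N + 1, (i / (N + 1) : ℝ) ∈ Set.Icc (0 : ℝ) 1 := fun i hi =>
    ⟨by positivity, (div_le_one hN0).2 (by exact_mod_cast hi)⟩
  refine ⟨∑ i ∈ Finset.range (N + 1), homotopy (f i) (f (i + 1)) c, ?_, ?_⟩
  · refine sum_mem fun i hi => map_mem_of_simplex _ _ (fun s hs => ?_) hc
    have hi' : i < N + 1 := Finset.mem_range.1 hi
    obtain ⟨hsc, hsz, hsd⟩ := hs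
    refine Finsupp.supported_mono ?_ (homotopy_simplex_mem (f i) (f (i + 1)) s)
    rintro t ⟨hts, htc⟩
    have key : ∀ a ∈ t, ∃ x ∈ s, ∃ j, (j = i ∨ j = i + 1) ∧ a = f j x := by
      intro a ha
      have := hts ha
      rw [Finset.mem_union, Finset.mem_image, Finset.mem_image] at this
      rcases this with ⟨x, hx, rfl⟩ | ⟨x, hx, rfl⟩
      · exact ⟨x, hx, i, Or.inl rfl, rfl⟩
      · exact ⟨x, hx, i + 1, Or.inr rfl, rfl⟩
    refine ⟨by rw [htc, hsc], fun a ha => ?_, fun a ha b hb => ?_⟩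
    · obtain ⟨x, hx, j, hj, rfl⟩ := key a ha
      exact hball _ (hicc j (by omega)) x (hsub (ball_subset_closedBall (hsz hx)))
    · obtain ⟨x, hx, j, hj, rfl⟩ := key a ha
      obtain ⟨y, hy, l, hl, rfl⟩ := key b hb
      refine hunif ((j : ℝ) / (N + 1), x) ⟨hicc j (by omega), ball_subset_closedBall (hsz hx)⟩
        ((l : ℝ) / (N + 1), y) ⟨hicc l (by omega), ball_subset_closedBall (hsz hy)⟩ ?_
      rw [Prod.dist_eq]
      refine max_lt ?_ (hsd x hx y hy)
      refine lt_of_le_of_lt ?_ hN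
      rw [Real.dist_eq, ← sub_div, abs_div, abs_of_pos hN0]
      refine div_le_div_of_nonneg_right ?_ hN0.le
      rcases hj with rfl | rfl <;> rcases hl with rfl | rfl <;> simp
  · have hstep : ∀ i, bd (homotopy (f i) (f (i + 1)) c) = push (f i) c + push (f (i + 1)) c := by
      intro i
      rw [bd_homotopy, hbd, map_zero, add_zero]
    have htel : ∀ m, ∑ i ∈ Finset.range m, (push (f i) c + push (f (i + 1)) c) =
        push (f 0) c + push (f m) c := by
      intro m
      induction m with
      | zero => simp [ZModModule.add_self]
      | succ m ih =>
        rw [Finset.sum_range_succ, ih]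
        have := ZModModule.add_self (push (f m) c)
        calc _ = push (f 0) c + (push (f m) c + push (f m) c) + push (f (m + 1)) c := by abel
          _ = _ := by rw [this, add_zero]
    rw [map_sum, Finset.sum_congr rfl fun i _ => hstep i, htel]
    have e1 : push (f 0) c = c := by
      refine map_eq_of_simplex (push (f 0)) LinearMap.id (fun s hs => ?_) hc
      refine push_simplex_of_eqOn_id fun p hp => ?_
      simpa [f] using h0 p (hsub (ball_subset_closedBall (hs.2.1 hp)))
    have e2 : push (f (N + 1)) c = 0 := by
      refine push_eq_zero_of_const (w := w) (fun s hs => ⟨?_, fun a ha => ?_⟩) hc hbd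
      · rw [← Finset.card_pos, hs.1]
        exact hk
      · have : ((N + 1 : ℕ) : ℝ) / (N + 1) = 1 := by
          rw [Nat.cast_add, Nat.cast_one, div_self hN0.ne']
        simp only [f]
        rw [this]
        exact h1 a (hsub (ball_subset_closedBall (hs.2.1 ha)))
    rw [e1, e2, add_zero]

lemma exists_filling {L ρ η : ℝ} (hL : 1 ≤ L) (hLLC : IsLLC L M) (hρ : 0 < ρ)
    (hρd : ρ ≤ diam (Set.univ : Set M) / L) (hη : 0 < η) :
    ∃ δ > 0, ∀ (p : M) (k : ℕ) (c : Chain M), 0 < k →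
      c ∈ chainsIn {t | t.card = k ∧ (t : Set M) ⊆ ball p (ρ / 4) ∧
        ∀ a ∈ t, ∀ b ∈ t, dist a b < δ} → bd c = 0 →
      ∃ e ∈ chainsIn {t : Finset M | t.card = k + 1 ∧ (t : Set M) ⊆ ball p (2 * L * ρ) ∧
        ∀ a ∈ t, ∀ b ∈ t, dist a b < η}, bd e = c := by
  choose δ hδ hfill using fun z => exists_filling_at hLLC z hρ hρd hη
  obtain ⟨I, -, hI⟩ := isCompact_univ.elim_nhds_subcover (fun z : M => ball z (ρ / 4))
    fun z _ => ball_mem_nhds z (by positivity)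
  obtain ⟨δ', hδ', hmin⟩ : ∃ δ' > 0, ∀ z ∈ I, δ' ≤ δ z := by
    have h : ∀ᶠ x : ℝ in 𝓝[>] 0, ∀ z ∈ I, x ≤ δ z :=
      (Filter.eventually_all_finset I).2 fun z _ => by
        filter_upwards [Ioc_mem_nhdsGT (hδ z)] with x hx using hx.2
    obtain ⟨x, hx1, hx2⟩ := (h.and self_mem_nhdsWithin).exists
    exact ⟨x, hx2, hx1⟩
  refine ⟨δ', hδ', fun p k c hk hc hbd => ?_⟩
  obtain ⟨z, hz, hpz⟩ := Set.mem_iUnion₂.1 (hI (Set.mem_univ p))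
  have hpz : dist p z < ρ / 4 := hpz
  obtain ⟨e, he, hbe⟩ := hfill z k c hk (by
    refine Finsupp.supported_mono ?_ hc
    rintro t ⟨ht1, ht2, ht3⟩
    refine ⟨ht1, fun a ha => ?_, fun a ha b hb => (ht3 a ha b hb).trans_le (hmin z hz)⟩
    have h1 : dist a p < ρ / 4 := ht2 ha
    have h2 := dist_triangle a p z
    refine mem_ball.2 ?_
    linarith) hbd
  refine ⟨e, Finsupp.supported_mono ?_ he, hbe⟩
  rintro t ⟨ht1, ht2, ht3⟩
  refine ⟨ht1, fun a ha => ?_, ht3⟩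
  have h1 : dist a z < L * ρ := ht2 ha
  have h2 := dist_triangle_right a p z
  have h3 : ρ ≤ L * ρ := le_mul_of_one_le_left hρ.le hL
  refine mem_ball.2 ?_
  linarith

/-- A subdivision operator: simplices with at most `k` vertices and diameter at most `ε` are
replaced, compatibly with the boundary operator, by chains of `η`-small simplices nearby. -/
lemma exists_subdivision {L ε : ℝ} (hL : 1 ≤ L) (hLLC : IsLLC L M) (hε : 0 < ε) (k : ℕ)
    (hk : (32 * L) ^ (k + 2) * ε ≤ diam (Set.univ : Set M)) {η : ℝ} (hη : 0 < η) :
    ∃ F : Chain M →ₗ[ZMod 2] Chain M, ∃ δ > 0,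
      (∀ s : Finset M, s.card ≤ k + 1 → (∀ a ∈ s, ∀ b ∈ s, dist a b ≤ ε) →
        bd (F (simplex s)) = F (bd (simplex s))) ∧
      (∀ s : Finset M, s.card ≤ k + 1 → (∀ a ∈ s, ∀ b ∈ s, dist a b ≤ ε) →
        F (simplex s) ∈ chainsIn {t | t.card = s.card ∧ (∀ a ∈ t, ∀ b ∈ t, dist a b < η) ∧
          ∀ p ∈ s, (t : Set M) ⊆ ball p ((32 * L) ^ (k + 1) * ε)}) ∧
      ∀ s : Finset M, s.card ≤ k + 1 → (∀ a ∈ s, ∀ b ∈ s, dist a b < δ) →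
        F (simplex s) = simplex s := by
  induction k generalizing η with
  | zero =>
    refine ⟨LinearMap.id, 1, one_pos, fun s _ _ => rfl, fun s hs _ => simplex_mem ⟨rfl, ?_, ?_⟩,
      fun s _ _ => rfl⟩
    · intro a ha b hb
      rw [Finset.card_le_one.1 (by simpa using hs) a ha b hb, dist_self]
      exact hη
    · intro p hp a ha
      rw [Finset.card_le_one.1 (by simpa using hs) a ha p hp]
      exact mem_ball_self (by positivity)
  | succ k ih =>
    set R := (32 * L) ^ (k + 1) * ε with hR
    have hL0 : 0 < L := by linarith
    have hLL : 1 ≤ 32 * L := by linarith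
    have hεR : ε ≤ R := le_mul_of_one_le_left hε.le (one_le_pow₀ hLL)
    have hR' : (32 * L) ^ (k + 1 + 1) * ε = 32 * L * R := by rw [hR]; ring
    have hR'' : (32 * L) ^ (k + 1 + 2) * ε = 32 * L * (32 * L * R) := by rw [hR]; ring
    have hR0 : 0 < R := by linarith
    have hLR : R ≤ L * R := le_mul_of_one_le_left hR0.le hL
    have hLLR : 32 * L * R ≤ 32 * L * (32 * L * R) :=
      le_mul_of_one_le_left (by positivity) hLL
    rw [hR''] at hk
    have hρd : 8 * R ≤ diam (Set.univ : Set M) / L := by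
      rw [le_div_iff₀ hL0]
      nlinarith
    obtain ⟨δ₁, hδ₁, hfill⟩ := exists_filling hL hLLC (by linarith : 0 < 8 * R) hρd hη
    obtain ⟨F, δ₂, hδ₂, hF1, hF2, hF3⟩ := ih (η := min δ₁ η) (by rw [hR']; linarith)
      (lt_min hδ₁ hη)
    have hface : ∀ s : Finset M, s.card = k + 2 → ∀ p ∈ s, (s.erase p).card = k + 1 := by
      intro s hs p hp
      rw [Finset.card_erase_of_mem hp, hs]
      rfl
    have hex : ∀ s : Finset M, ∃ e : Chain M, s.card = k + 2 → (∀ a ∈ s, ∀ b ∈ s, dist a b ≤ ε) →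
        bd e = F (bd (simplex s)) ∧
        e ∈ chainsIn {t | t.card = s.card ∧ (∀ a ∈ t, ∀ b ∈ t, dist a b < η) ∧
          ∀ p ∈ s, (t : Set M) ⊆ ball p (32 * L * R)} := by
      intro s
      by_cases hs : s.card = k + 2 ∧ ∀ a ∈ s, ∀ b ∈ s, dist a b ≤ ε
      swap
      · exact ⟨0, fun h1 h2 => absurd ⟨h1, h2⟩ hs⟩
      obtain ⟨hsc, hsd⟩ := hs
      have hsd' : ∀ q, ∀ a ∈ s.erase q, ∀ b ∈ s.erase q, dist a b ≤ ε := fun q a ha b hb =>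
        hsd a (Finset.mem_of_mem_erase ha) b (Finset.mem_of_mem_erase hb)
      obtain ⟨p, hp⟩ : s.Nonempty := by
        rw [← Finset.card_pos, hsc]
        omega
      obtain ⟨e, he, hbe⟩ := hfill p (k + 1) (F (bd (simplex s))) (by omega) (by
        rw [bd_simplex, map_sum]
        refine sum_mem fun q hq => ?_
        refine Finsupp.supported_mono ?_ (hF2 (s.erase q) (hface s hsc q hq).le (hsd' q))
        rintro t ⟨ht1, ht2, ht3⟩
        refine ⟨by rw [ht1, hface s hsc q hq], ?_, fun a ha b hb =>
          (ht2 a ha b hb).trans_le (min_le_left _ _)⟩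
        obtain ⟨p', hp'⟩ : (s.erase q).Nonempty := by
          rw [← Finset.card_pos, hface s hsc q hq]
          omega
        intro a ha
        have h1 : dist a p' < R := ht3 p' hp' ha
        have h2 := hsd p' (Finset.mem_of_mem_erase hp') p hp
        have h3 := dist_triangle a p' p
        refine mem_ball.2 ?_
        linarith) (by
        rw [bd_simplex, map_sum, map_sum, Finset.sum_congr rfl fun q hq =>
          hF1 (s.erase q) (hface s hsc q hq).le (hsd' q), ← map_sum, ← map_sum, ← bd_simplex,
          bd_bd, map_zero])
      refine ⟨e, fun _ _ => ⟨hbe, Finsupp.supported_mono ?_ he⟩⟩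
      rintro t ⟨ht1, ht2, ht3⟩
      refine ⟨by rw [ht1, hsc], ht3, fun q hq a ha => ?_⟩
      have h1 : dist a p < 2 * L * (8 * R) := ht2 ha
      have h2 := hsd p hp q hq
      have h3 := dist_triangle a p q
      refine mem_ball.2 ?_
      linarith
    choose e he1 he2 using hex
    classical
    let G : Chain M →ₗ[ZMod 2] Chain M := Finsupp.linearCombination (ZMod 2) fun s =>
      if s.card ≤ k + 1 then F (simplex s) else
        if ∀ a ∈ s, ∀ b ∈ s, dist a b < min δ₂ (min η ε) then simplex s else e s
    have hG : ∀ s, G (simplex s) = if s.card ≤ k + 1 then F (simplex s) else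
        if ∀ a ∈ s, ∀ b ∈ s, dist a b < min δ₂ (min η ε) then simplex s else e s := by
      intro s
      simp [G]
    have hGF : ∀ s : Finset M, s.card ≤ k + 1 → G (simplex s) = F (simplex s) := fun s hs => by
      rw [hG, if_pos hs]
    have hGbd : ∀ s : Finset M, s.card ≤ k + 1 + 1 → G (bd (simplex s)) = F (bd (simplex s)) := by
      intro s hs
      rw [bd_simplex, map_sum, map_sum]
      refine Finset.sum_congr rfl fun q hq => hGF _ ?_
      rw [Finset.card_erase_of_mem hq]
      omega
    refine ⟨G, min δ₂ (min η ε), lt_min hδ₂ (lt_min hη hε), fun s hs hsd => ?_, fun s hs hsd => ?_,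
      fun s hs hsd => ?_⟩
    · rw [hGbd s hs]
      by_cases hsc : s.card ≤ k + 1
      · rw [hGF s hsc, hF1 s hsc hsd]
      rw [hG, if_neg hsc]
      split_ifs with hsmall
      · rw [bd_simplex, map_sum]
        refine Finset.sum_congr rfl fun q hq => (hF3 _ ?_ fun a ha b hb => ?_).symm
        · exact (hface s (by omega) q hq).le
        · exact (hsmall a (Finset.mem_of_mem_erase ha) b (Finset.mem_of_mem_erase hb)).trans_le
            (min_le_left _ _)
      · exact he1 s (by omega) hsd
    · rw [hR']
      by_cases hsc : s.card ≤ k + 1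
      · rw [hGF s hsc]
        refine Finsupp.supported_mono ?_ (hF2 s hsc hsd)
        rintro t ⟨ht1, ht2, ht3⟩
        exact ⟨ht1, fun a ha b hb => (ht2 a ha b hb).trans_le (min_le_right _ _), fun p hp =>
          (ht3 p hp).trans (ball_subset_ball (by linarith))⟩
      rw [hG, if_neg hsc]
      split_ifs with hsmall
      · refine simplex_mem ⟨rfl, fun a ha b hb => (hsmall a ha b hb).trans_le
          ((min_le_right _ _).trans (min_le_left _ _)), fun p hp a ha => ?_⟩
        have h1 := hsd a ha p hp
        refine mem_ball.2 ?_
        linarith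
      · exact he2 s (by omega) hsd
    · by_cases hsc : s.card ≤ k + 1
      · rw [hGF s hsc]
        exact hF3 s hsc fun a ha b hb => (hsd a ha b hb).trans_le (min_le_left _ _)
      · rw [hG, if_neg hsc, if_pos hsd]

end Filling

section Cells

lemma exists_cell_of_isTopManifold {n : ℕ} {M : Type*} [TopologicalSpace M]
    (h : IsTopManifold n M) (x : M) : ∃ Q, IsCell n Q ∧ x ∈ Q := by
  obtain ⟨U, V, hU, hxU, hV, ⟨φ⟩⟩ := h x
  set x₀ : EuclideanSpace ℝ (Fin n) := ((φ ⟨x, hxU⟩ : V) : EuclideanSpace ℝ (Fin n)) with hx₀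
  obtain ⟨r, hr, hrV⟩ := Metric.isOpen_iff.1 hV x₀ (φ ⟨x, hxU⟩).2
  set b : (Fin n → ℝ) → EuclideanSpace ℝ (Fin n) :=
    OpenPartialHomeomorph.univBall x₀ r ∘ (EuclideanSpace.equiv (Fin n) ℝ).symm with hb
  have hb1 : IsOpenEmbedding b :=
    (OpenPartialHomeomorph.isOpenEmbedding _ (OpenPartialHomeomorph.univBall_source x₀ r)).comp
      (EuclideanSpace.equiv (Fin n) ℝ).symm.toHomeomorph.isOpenEmbedding
  have hb2 : ∀ v, b v ∈ V := fun v => by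
    refine hrV ?_
    rw [← OpenPartialHomeomorph.univBall_target x₀ hr]
    exact (OpenPartialHomeomorph.univBall x₀ r).map_source
      (by rw [OpenPartialHomeomorph.univBall_source]; trivial)
  set b' : (Fin n → ℝ) → V := fun v => ⟨b v, hb2 v⟩ with hb'
  have hb3 : IsOpenEmbedding b' := IsOpenEmbedding.of_comp b' hV.isOpenEmbedding_subtypeVal hb1
  refine ⟨_, ⟨fun v => ((φ.symm (b' v) : U) : M),
    hU.isOpenEmbedding_subtypeVal.comp (φ.symm.isOpenEmbedding.comp hb3), rfl⟩,
    EuclideanSpace.equiv (Fin n) ℝ 0, ?_⟩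
  have : b' (EuclideanSpace.equiv (Fin n) ℝ 0) = φ ⟨x, hxU⟩ := by
    refine Subtype.ext ?_
    simp [hb', hb, hx₀]
  change ((φ.symm (b' _) : U) : M) = x
  rw [this, φ.symm_apply_apply]

lemma locallyConnectedSpace_of_cells {n : ℕ} {X : Type*} [TopologicalSpace X]
    (h : ∀ x : X, ∃ Q, IsCell n Q ∧ x ∈ Q) : LocallyConnectedSpace X := by
  refine locallyConnectedSpace_iff_subsets_isOpen_isConnected.2 fun x N hN => ?_
  obtain ⟨_, ⟨ψ, hψ, rfl⟩, v, rfl⟩ := h x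
  obtain ⟨r, hr, hrN⟩ := Metric.mem_nhds_iff.1 (hψ.continuous.continuousAt hN)
  exact ⟨ψ '' ball v r, Set.image_subset_iff.2 hrN, hψ.isOpenMap _ isOpen_ball,
    Set.mem_image_of_mem _ (mem_ball_self hr),
    ((convex_ball v r).isConnected ⟨v, mem_ball_self hr⟩).image ψ hψ.continuous.continuousOn⟩

end Cells

section Retraction

variable {M : Type*} [MetricSpace M]

lemma exists_retraction {ε : ℝ} {m : ℕ} {I : Finset M} (hI : ∀ p : M, ∃ z ∈ I, dist p z < ε)
    (S : Set M) {t : M → ℝ} (ht : ∀ z, t z ∈ Set.Ioo ε (2 * ε))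
    (hS : ∀ J ⊆ I, J.card = m → ∀ p ∈ S, ¬ ∀ z ∈ J, dist p z = t z) :
    ∃ f : M → M, (∀ q ∉ thickening ε S, f q = q) ∧ (∀ q, dist (f q) q < 2 * ε) ∧
      ∀ p ∈ S, ∃ N ∈ 𝓝 p, ∃ T : Finset M, T.card ≤ m ∧ ∀ q ∈ N, f q ∈ T := by
  classical
  obtain ⟨e, he⟩ := Set.countable_iff_exists_injOn.1 I.countable_toSet
  have hcand : ∀ q, (I.filter fun z => dist q z < t z).Nonempty := fun q => by
    obtain ⟨z, hz, hqz⟩ := hI q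
    exact ⟨z, Finset.mem_filter.2 ⟨hz, hqz.trans (ht z).1⟩⟩
  choose w hw hwmin using fun q => Finset.exists_min_image _ e (hcand q)
  have hε : ∀ q : M, 0 < ε := fun q => by
    have := (ht q).1.trans (ht q).2
    linarith
  refine ⟨fun q => if q ∈ thickening ε S then w q else q, fun q hq => if_neg hq, fun q => ?_,
    fun p hp => ?_⟩
  · dsimp only
    split_ifs
    · rw [dist_comm]
      exact (Finset.mem_filter.1 (hw q)).2.trans (ht _).2
    · rw [dist_self]
      linarith [hε q]
  · have hp' : p ∈ thickening ε S := self_subset_thickening (hε p) S hp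
    have hev : ∀ᶠ q in 𝓝 p, ∀ z ∈ I, (dist p z < t z → dist q z < t z) ∧
        (dist q z < t z → dist p z ≤ t z) := by
      refine (Filter.eventually_all_finset I).2 fun z _ => ?_
      have hc : ContinuousAt (fun q : M => dist q z) p := by fun_prop
      rcases lt_trichotomy (dist p z) (t z) with h | h | h
      · filter_upwards [hc.eventually_lt_const h] with q hq
        exact ⟨fun _ => hq, fun _ => h.le⟩
      · exact Eventually.of_forall fun q => ⟨fun h' => absurd h h'.ne, fun _ => h.le⟩
      · filter_upwards [hc.eventually_const_lt h] with q hq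
        exact ⟨fun h' => absurd h h'.not_gt, fun h' => absurd hq h'.not_gt⟩
    refine ⟨_, inter_mem hev (isOpen_thickening.mem_nhds hp'),
      insert (w p) (I.filter fun z => dist p z = t z), ?_, ?_⟩
    · refine (Finset.card_insert_le _ _).trans ?_
      by_contra hcard
      obtain ⟨J, hJ, hJm⟩ := Finset.exists_subset_card_eq
        (show m ≤ (I.filter fun z => dist p z = t z).card by omega)
      exact hS J (hJ.trans (Finset.filter_subset _ _)) hJm p hp fun z hz =>
        (Finset.mem_filter.1 (hJ hz)).2
    · rintro q ⟨hq, hqS⟩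
      dsimp only
      rw [if_pos hqS]
      obtain ⟨hwI, hwt⟩ := Finset.mem_filter.1 (hw q)
      obtain ⟨hpI, hpt⟩ := Finset.mem_filter.1 (hw p)
      rcases ((hq _ hwI).2 hwt).lt_or_eq with h | h
      · refine Finset.mem_insert.2 (Or.inl (he hwI hpI (le_antisymm ?_ ?_)))
        · exact hwmin q _ (Finset.mem_filter.2 ⟨hpI, (hq _ hpI).1 hpt⟩)
        · exact hwmin p _ (Finset.mem_filter.2 ⟨hwI, h⟩)
      · exact Finset.mem_insert_of_mem (Finset.mem_filter.2 ⟨hwI, h⟩)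

end Retraction

section Transfer

variable {M : Type*} [DecidableEq M] [MetricSpace M] [CompactSpace M]

lemma exists_transfer {n : ℕ} {L ρ ε : ℝ} (hL : 1 ≤ L) (hLLC : IsLLC L M) (hε : 0 < ε)
    (hρε : (32 * L) ^ (n + 2) * (5 * ε) ≤ ρ / 8) (hρ : ρ ≤ diam (Set.univ : Set M)) {x y : M}
    {w β : Finset M → ZMod 2} (hw : ∀ p, p ≠ x → p ≠ y → w ∈ van (n + 1) p)
    (hβ : w + cobd β ∈ zer M (n + 1)) {f : M → M} (hfd : ∀ q, dist (f q) q < 2 * ε)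
    (hfx : ∀ q ∈ ball x (ρ / 2) ∪ ball y (ρ / 2), f q = q) :
    ∃ γ : Finset M → ZMod 2, γ ∅ = β ∅ ∧ w + cobd γ ∈ zer M (n + 1) ∧
      ∀ p, ∀ N ∈ 𝓝 p, ∀ T : Finset M, T.card < n → (∀ q ∈ N, f q ∈ T) → γ ∈ van n p := by
  have hL32 : 32 ≤ 32 * L := by linarith
  have hpow : (32 * L) ^ (n + 1) ≤ (32 * L) ^ (n + 2) :=
    pow_le_pow_right₀ (by linarith) (by omega)
  have hpow' : 32 ≤ (32 * L) ^ (n + 2) :=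
    hL32.trans (le_self_pow₀ (by linarith) (by omega))
  have hR : (32 * L) ^ (n + 1) * (5 * ε) ≤ ρ / 8 :=
    (mul_le_mul_of_nonneg_right hpow (by positivity)).trans hρε
  have hερ : 160 * ε ≤ ρ / 8 := by
    have := mul_le_mul_of_nonneg_right hpow' (show 0 ≤ 5 * ε by positivity)
    linarith
  obtain ⟨η₁, hη₁, h1⟩ := exists_uniform_of_mem_zer (k := n + 1) (by omega)
    (isCompact_univ (X := M)) (fun p _ => mem_zer.1 hβ p)
  set K : Set M := (ball x (ρ / 4) ∪ ball y (ρ / 4))ᶜ with hKdef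
  have hK : IsCompact K := (isOpen_ball.union isOpen_ball).isClosed_compl.isCompact
  obtain ⟨η₂, hη₂, h2⟩ := exists_uniform_of_mem_zer (k := n + 1) (by omega) hK (u := w)
    fun p hp => hw p
      (fun h => hp (Or.inl (h ▸ mem_ball_self (by linarith))))
      (fun h => hp (Or.inr (h ▸ mem_ball_self (by linarith))))
  obtain ⟨F, δ, hδ, hF1, hF2, hF3⟩ := exists_subdivision (M := M) hL hLLC
    (show 0 < 5 * ε by positivity) n (by linarith) (lt_min hη₁ hη₂)
  set γ : Finset M → ZMod 2 := fun s => ev β (F (push f (simplex s))) with hγ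
  have hevγ : ∀ c, ev γ c = ev β (F (push f c)) := fun c =>
    linearMap_ext (ev γ) (ev β ∘ₗ F ∘ₗ push f) (fun s => by simp only [ev_simplex]; rfl) c
  have hpush : ∀ p, ∀ s : Finset M, (s : Set M) ⊆ ball p (ε / 2) → s.card = n + 1 →
      push f (simplex s) ∈ chainsIn {t | t.card = n + 1 ∧ (∀ a ∈ t, ∀ b ∈ t, dist a b ≤ 5 * ε) ∧
        ∃ q ∈ t, dist q p < 5 / 2 * ε} := by
    intro p s hs hk
    refine Finsupp.supported_mono ?_ (push_simplex_mem f s)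
    rintro t ⟨rfl, hc⟩
    have hd : ∀ a ∈ s, dist (f a) p < 5 / 2 * ε := fun a ha => by
      have h3 := mem_ball.1 (hs ha)
      have h4 := dist_triangle (f a) a p
      linarith [hfd a]
    refine ⟨hc.trans hk, ?_, ?_⟩
    · rintro _ ha _ hb
      obtain ⟨a, ha', rfl⟩ := Finset.mem_image.1 ha
      obtain ⟨b, hb', rfl⟩ := Finset.mem_image.1 hb
      have := dist_triangle_right (f a) (f b) p
      linarith [hd a ha', hd b hb']
    · obtain ⟨a, ha⟩ := Finset.card_pos.1 (show 0 < s.card by omega)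
      exact ⟨f a, Finset.mem_image_of_mem f ha, hd a ha⟩
  have hFpush : ∀ p, ∀ s : Finset M, (s : Set M) ⊆ ball p (ε / 2) → s.card = n + 1 →
      F (push f (simplex s)) ∈ chainsIn {t | t.card = n + 1 ∧
        (∀ a ∈ t, ∀ b ∈ t, dist a b < min η₁ η₂) ∧ (t : Set M) ⊆ ball p (ρ / 8 + 5 / 2 * ε)} := by
    intro p s hs hk
    refine map_mem_of_simplex F _ ?_ (hpush p s hs hk)
    rintro t ⟨hc, hd, q, hq, hqp⟩
    refine Finsupp.supported_mono ?_ (hF2 t hc.le hd)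
    rintro t' ⟨h3, h4, h5⟩
    refine ⟨h3.trans hc, h4, fun a ha => ?_⟩
    have h6 := mem_ball.1 (h5 q hq ha)
    have h7 := dist_triangle a q p
    rw [mem_ball]
    linarith
  have hcobd : ∀ p, ∀ s : Finset M, (s : Set M) ⊆ ball p (ε / 2) → s.card = n + 1 →
      cobd γ s = ev w (F (push f (simplex s))) := by
    intro p s hs hk
    have h3 : F (bd (push f (simplex s))) = bd (F (push f (simplex s))) :=
      map_eq_of_simplex (F ∘ₗ bd) (bd ∘ₗ F) (fun t ht => (hF1 t ht.1.le ht.2.1).symm)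
        (hpush p s hs hk)
    rw [cobd_eq_ev, hevγ, ← bd_push, h3, ← ev_cobd]
    refine ev_eq_of_mem (fun t ht => ?_) (hFpush p s hs hk)
    have h4 := h1 t (Set.subset_univ _) ht.1 fun a ha b hb => (ht.2.1 a ha b hb).trans_le
      (min_le_left _ _)
    rw [Pi.add_apply] at h4
    linear_combination h4 - ZModModule.add_self (w t)
  refine ⟨γ, ?_, mem_zer.2 fun p => ?_, fun p N hN T hT hfT => ?_⟩
  · change ev β (F (push f (simplex ∅))) = β ∅
    rw [push_simplex_of_eqOn_id (by simp), hF3 ∅ (by simp) (by simp), ev_simplex]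
  · rw [mem_van]
    by_cases hp : p ∈ ball x (ρ / 2) ∪ ball y (ρ / 2)
    · filter_upwards [eventually_sm_subset_of_mem
          ((isOpen_ball.union isOpen_ball).mem_nhds hp),
        eventually_sm_subset_of_mem (ball_mem_nhds p (show 0 < ε / 2 by positivity)),
        eventually_sm_subset_of_mem (ball_mem_nhds p (show 0 < δ / 2 by positivity))]
        with s hs1 hs2 hs3 hk
      rw [Pi.add_apply, hcobd p s hs2 hk, push_simplex_of_eqOn_id fun q hq => hfx q (hs1 hq),
        hF3 s hk.le fun a ha b hb => ?_, ev_simplex]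
      · exact ZModModule.add_self _
      · have h3 := mem_ball.1 (hs3 ha)
        have h4 := mem_ball.1 (hs3 hb)
        have := dist_triangle_right a b p
        linarith
    · have hpx : ρ / 2 ≤ dist p x := not_lt.1 fun h => hp (Or.inl h)
      have hpy : ρ / 2 ≤ dist p y := not_lt.1 fun h => hp (Or.inr h)
      have hwp : w ∈ van (n + 1) p := by
        refine hw p ?_ ?_
        · rintro rfl
          rw [dist_self] at hpx
          linarith
        · rintro rfl
          rw [dist_self] at hpy
          linarith
      filter_upwards [hwp,
        eventually_sm_subset_of_mem (ball_mem_nhds p (show 0 < ε / 2 by positivity))]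
        with s hs1 hs2 hk
      rw [Pi.add_apply, hs1 hk, hcobd p s hs2 hk, zero_add]
      refine ev_eq_zero (fun t ht => ?_) (hFpush p s hs2 hk)
      refine h2 t (fun a ha => ?_) ht.1 fun a ha b hb => (ht.2.1 a ha b hb).trans_le
        (min_le_right _ _)
      have h3 := mem_ball.1 (ht.2.2 ha)
      rintro (h4 | h4)
      · have h5 := mem_ball.1 h4
        have := dist_triangle_left p x a
        linarith
      · have h5 := mem_ball.1 h4
        have := dist_triangle_left p y a
        linarith
  · rw [mem_van]
    filter_upwards [eventually_sm_subset_of_mem hN] with s hs hk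
    have : ¬ Set.InjOn f s := fun h => by
      have h3 := Finset.card_le_card (s := s.image f) (t := T) fun a ha => by
        obtain ⟨q, hq, rfl⟩ := Finset.mem_image.1 ha
        exact hfT q (hs hq)
      rw [Finset.card_image_of_injOn h] at h3
      omega
    change ev β (F (push f (simplex s))) = 0
    rw [push_simplex_of_not_injOn this, map_zero, map_zero]

end Transfer

section Separation

variable {M : Type*} [MetricSpace M] [CompactSpace M] [ConnectedSpace M] [MeasurableSpace M]
  [BorelSpace M]

lemma le_hausdorffMeasure_of_frontier_subset {n D : ℕ} {L ρ ε : ℝ} (hL : 1 ≤ L)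
    (hM : IsTopManifold (n + 1) M) (hD : IsDoubling D M) (hLLC : IsLLC L M) (hε : 0 < ε)
    (hρε : (32 * L) ^ (n + 3) * (5 * ε) ≤ ρ / 8) {S V : Set M} (hV : IsOpen V)
    (hVS : frontier V ⊆ S) {x y : M} (hx : ball x ρ ⊆ (V ∪ S)ᶜ) (hy : ball y ρ ⊆ V \ S) :
    ENNReal.ofReal ε ^ n ≤ 2 ^ D * μH[(n : ℝ)] S := by
  classical
  by_contra hlt
  obtain ⟨I, hI, hID⟩ := exists_net hD hε
  obtain ⟨t, ht, htS⟩ := exists_radii hε I hID S n (not_le.1 hlt)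
  obtain ⟨f, hf1, hf2, hf3⟩ := exists_retraction hI S ht htS
  have hpow : 32 ≤ (32 * L) ^ (n + 3) :=
    (show 32 ≤ 32 * L by linarith).trans (le_self_pow₀ (by linarith) (by omega))
  have hερ : 160 * ε ≤ ρ / 8 := by
    have := mul_le_mul_of_nonneg_right hpow (show 0 ≤ 5 * ε by positivity)
    linarith
  have hρ : 0 < ρ := by linarith
  have hxV : x ∉ V := fun h => hx (mem_ball_self hρ) (Or.inl h)
  have hyV : y ∈ V := (hy (mem_ball_self hρ)).1
  have hdiam : ρ ≤ diam (Set.univ : Set M) := by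
    refine le_trans ?_ (dist_le_diam_of_mem isCompact_univ.isBounded (Set.mem_univ y)
      (Set.mem_univ x))
    exact not_lt.1 fun h => hx (mem_ball.2 h) (Or.inl hyV)
  have hfix : ∀ z, (∀ q ∈ ball z ρ, q ∉ S) → ∀ q ∈ ball z (ρ / 2), f q = q := by
    intro z hz q hq
    refine hf1 q fun hqS => ?_
    obtain ⟨p, hp, hqp⟩ := mem_thickening_iff.1 hqS
    refine hz p (mem_ball.2 ?_) hp
    have := dist_triangle_left p z q
    have := mem_ball.1 hq
    linarith
  obtain ⟨u, hu1, hu2, hu3⟩ := exists_point_class (n := n + 1) (X := M) (by omega)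
    (exists_cell_of_isTopManifold hM)
  obtain ⟨β, -, hβ0, hβ⟩ := hu3 x y
  obtain ⟨γ, hγ0, hγ, hγS⟩ := exists_transfer (n := n + 1) (x := x) (y := y) hL hLLC hε hρε hdiam
    (fun p hpx hpy => add_mem (hu1 x p hpx) (hu1 y p hpy)) hβ hf2 (by
      rintro q (hq | hq)
      · exact hfix x (fun q hq h => hx hq (Or.inr h)) q hq
      · exact hfix y (fun q hq h => (hy hq).2 h) q hq)
  refine hu2 y ⟨restr V γ, ⟨Set.univ, subset_rfl, isCompact_univ, fun p hp => absurd trivial hp⟩,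
    by rw [restr_empty, hγ0, hβ0], mem_zer.2 fun p => ?_⟩
  by_cases hpV : p ∈ V
  · have h1 := mem_zer.1 hγ p
    have h2 := hu1 x p fun h => hxV (h ▸ hpV)
    have h3 : cobd (γ + restr V γ) ∈ van (n + 1 + 1) p :=
      cobd_mem_van (add_restr_mem_van (hV.mem_nhds hpV))
    have : u y + cobd (restr V γ) = u x + u y + cobd γ + u x + cobd (γ + restr V γ) := by
      rw [cobd_add]
      ext s
      simp only [Pi.add_apply]
      linear_combination -ZModModule.add_self (u x s) - ZModModule.add_self (cobd γ s)
    rw [this]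
    exact add_mem (add_mem h1 h2) h3
  · refine add_mem (hu1 y p fun h => hpV (h ▸ hyV)) (cobd_mem_van ?_)
    by_cases hpc : p ∈ closure V
    · obtain ⟨N, hN, T, hT, hfT⟩ := hf3 p (hVS ⟨hpc, by rwa [hV.interior_eq]⟩)
      exact restr_mem_van (hγS p N hN T (by omega) hfT)
    · exact restr_mem_van_of_notMem (mem_of_superset
        (isClosed_closure.isOpen_compl.mem_nhds hpc) (Set.compl_subset_compl.2 subset_closure))

lemma frontier_connectedComponentIn_subset {X : Type*} [TopologicalSpace X]
    [LocallyConnectedSpace X] {S : Set X} (hS : IsClosed S) (y : X) :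
    frontier (connectedComponentIn Sᶜ y) ⊆ S := by
  intro p hp
  by_contra hpS
  obtain ⟨q, hq1, hq2⟩ := mem_closure_iff.1 hp.1 _ (hS.isOpen_compl.connectedComponentIn (x := p))
    (mem_connectedComponentIn hpS)
  have h1 := connectedComponentIn_eq hq1
  have h2 := connectedComponentIn_eq hq2
  refine hp.2 ?_
  rw [hS.isOpen_compl.connectedComponentIn.interior_eq, h2, ← h1]
  exact mem_connectedComponentIn hpS

lemma inrad_pos_of_isOpen {E : Set M} (hE : IsOpen E) (hne : E.Nonempty) (hE' : E ≠ Set.univ) :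
    0 < inrad E ∧ ∀ r < inrad E, ∃ x, ball x r ⊆ E := by
  obtain ⟨z, hz⟩ := (Set.ne_univ_iff_exists_notMem E).1 hE'
  have hbdd : BddAbove {r : ℝ | 0 ≤ r ∧ ∃ x : M, ball x r ⊆ E} := by
    refine ⟨diam (Set.univ : Set M), fun r ⟨_, x, hx⟩ => ?_⟩
    refine le_trans ?_ (dist_le_diam_of_mem isCompact_univ.isBounded (Set.mem_univ z)
      (Set.mem_univ x))
    exact not_lt.1 fun h => hz (hx (mem_ball.2 h))
  obtain ⟨x, hx⟩ := hne
  obtain ⟨r, hr, hrE⟩ := Metric.isOpen_iff.1 hE x hx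
  have hrs : r ∈ {r : ℝ | 0 ≤ r ∧ ∃ x : M, ball x r ⊆ E} := ⟨hr.le, x, hrE⟩
  refine ⟨hr.trans_le (le_csSup hbdd hrs), fun s hs => ?_⟩
  obtain ⟨s', ⟨_, x', hx'⟩, hs'⟩ := exists_lt_of_lt_csSup ⟨r, hrs⟩ hs
  exact ⟨x', (ball_subset_ball hs'.le).trans hx'⟩

end Separation

end AlexanderSpanier

open AlexanderSpanier

/-- There is `c > 0` depending only on `n`, `D`, `L` such that for every closed, connected,
`D`-doubling, `L`-linearly locally contractible metric `n`-manifold `M`: if `S ⊆ M` is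
closed and `U`, `V` are distinct connected components of `M \ S`, then
`H_{n-1}(S) ≥ c ⋅ min(inrad U, inrad V)^{n-1}`. -/
theorem separating_set_measure_vs_inrad (n D : ℕ) (L : ℝ)
    (hn : 1 ≤ n) (hD : 1 ≤ D) (hL : 1 ≤ L) :
    ∃ c : ℝ, 0 < c ∧
      ∀ (M : Type) [MetricSpace M] [CompactSpace M] [ConnectedSpace M]
        [MeasurableSpace M] [BorelSpace M],
        IsTopManifold n M → IsDoubling D M → IsLLC L M →
        ∀ (S : Set M) (U V : Set M) (x y : M), IsClosed S →
          x ∈ Sᶜ → y ∈ Sᶜ →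
          U = connectedComponentIn Sᶜ x → V = connectedComponentIn Sᶜ y → U ≠ V →
          ENNReal.ofReal (c * min (inrad U) (inrad V) ^ (n - 1)) ≤ μH[(n : ℝ) - 1] S := by
  obtain ⟨m, rfl⟩ : ∃ m, n = m + 1 := ⟨n - 1, by omega⟩
  have hL0 : 0 < L := by linarith
  set κ : ℝ := 1 / (80 * (32 * L) ^ (m + 3)) with hκ
  have hκ0 : 0 < κ := by positivity
  refine ⟨κ ^ m / 2 ^ D, by positivity, ?_⟩
  intro M _ _ _ _ _ hM hDbl hLLC S U V x y hS hx hy hU hV hUV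
  have : LocallyConnectedSpace M := locallyConnectedSpace_of_cells (exists_cell_of_isTopManifold hM)
  have hUo : IsOpen U := hU ▸ hS.isOpen_compl.connectedComponentIn
  have hVo : IsOpen V := hV ▸ hS.isOpen_compl.connectedComponentIn
  have hxU : x ∈ U := hU ▸ mem_connectedComponentIn hx
  have hyV : y ∈ V := hV ▸ mem_connectedComponentIn hy
  have hUS : U ⊆ Sᶜ := hU ▸ connectedComponentIn_subset _ _
  have hVS : V ⊆ Sᶜ := hV ▸ connectedComponentIn_subset _ _
  have hdisj : ∀ p ∈ U, p ∉ V := by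
    intro p hpU hpV
    rw [hU] at hpU
    rw [hV] at hpV
    refine hUV ?_
    rw [hU, hV, connectedComponentIn_eq hpU, connectedComponentIn_eq hpV]
  obtain ⟨hU0, hUr⟩ := inrad_pos_of_isOpen hUo ⟨x, hxU⟩
    ((Set.ne_univ_iff_exists_notMem U).2 ⟨y, fun h => hdisj y h hyV⟩)
  obtain ⟨hV0, hVr⟩ := inrad_pos_of_isOpen hVo ⟨y, hyV⟩
    ((Set.ne_univ_iff_exists_notMem V).2 ⟨x, hdisj x hxU⟩)
  set r := min (inrad U) (inrad V) with hr
  have hr0 : 0 < r := lt_min hU0 hV0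
  obtain ⟨x₁, hx₁⟩ := hUr (r / 2) ((half_lt_self hr0).trans_le (min_le_left _ _))
  obtain ⟨y₁, hy₁⟩ := hVr (r / 2) ((half_lt_self hr0).trans_le (min_le_right _ _))
  have key := le_hausdorffMeasure_of_frontier_subset (n := m) (ρ := r / 2) (ε := κ * r) (S := S)
    hL hM hDbl hLLC (by positivity)
    (le_of_eq (by rw [hκ]; field_simp; norm_num))
    hVo (hV ▸ frontier_connectedComponentIn_subset hS y)
    (fun p hp => not_or.2 ⟨hdisj p (hx₁ hp), hUS (hx₁ hp)⟩)
    (fun p hp => ⟨hy₁ hp, hVS (hy₁ hp)⟩)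
  rw [show ((m + 1 : ℕ) : ℝ) - 1 = (m : ℝ) by push_cast; ring, Nat.add_sub_cancel]
  rw [← ENNReal.ofReal_pow (by positivity), mul_pow] at key
  rw [show κ ^ m / 2 ^ D * r ^ m = κ ^ m * r ^ m / 2 ^ D by ring,
    ENNReal.ofReal_div_of_pos (by positivity), ENNReal.ofReal_pow (by norm_num),
    ENNReal.ofReal_ofNat]
  exact ENNReal.div_le_of_le_mul' key
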